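/- Let n ≥ 5. An endomorphism φ of A[B_n] is surjective if and only if there exists x ∈ A[B_n] such that conj_x ∘ φ is an endomorphism of type (2a) or of type (2b) with parameter q = 0. -/

import Mathlib

/-- The defining relators of the Artin group of type `Bₙ`, as elements of the free
group on `n` generators (0-indexed: generator `i` corresponds to `r_{i+1}`). -/
def BnRels (n : ℕ) : Set (FreeGroup (Fin n)) :=
  {w | (∃ i j : Fin n, (i : ℕ) + 1 = (j : ℕ) ∧ (j : ℕ) + 1 < n ∧
          w = FreeGroup.of i * FreeGroup.of j * FreeGroup.of i *
              (FreeGroup.of j * FreeGroup.of i * FreeGroup.of j)⁻¹) ∨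
       (∃ i j : Fin n, (i : ℕ) + 2 = n ∧ (j : ℕ) + 1 = n ∧
          w = FreeGroup.of i * FreeGroup.of j * FreeGroup.of i * FreeGroup.of j *
              (FreeGroup.of j * FreeGroup.of i * FreeGroup.of j * FreeGroup.of i)⁻¹) ∨
       (∃ i j : Fin n, (i : ℕ) + 2 ≤ (j : ℕ) ∧
          w = FreeGroup.of i * FreeGroup.of j * (FreeGroup.of j * FreeGroup.of i)⁻¹)}

/-- The Artin group `A[Bₙ]` of type `Bₙ`. -/
abbrev ArtinB (n : ℕ) := PresentedGroup (BnRels n)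

/-- The standard generator `r_i` (1-indexed, `1 ≤ i ≤ n`). -/
def rB (n i : ℕ) : ArtinB n :=
  if h : i - 1 < n then PresentedGroup.of ⟨i - 1, h⟩ else 1

/-- `ρ_B = r_1 r_2 ⋯ r_n`. -/
def ρB (n : ℕ) : ArtinB n := ((List.range n).map fun i => rB n (i + 1)).prod

/-- `Δ_B = ρ_B ^ n`, the generator of the center. -/
def ΔB (n : ℕ) : ArtinB n := ρB n ^ n

/-- `t_i` for `i` read modulo `n`: `t_i = r_i` for `1 ≤ i ≤ n-1`,
and `t_0 = ρ_B r_{n-1} ρ_B⁻¹`. -/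
def tB (n i : ℕ) : ArtinB n :=
  if i % n = 0 then ρB n * rB n (n - 1) * (ρB n)⁻¹ else rB n (i % n)

/-- `Δ_Y = (t_1⋯t_{n-1})(t_1⋯t_{n-2})⋯(t_1t_2)t_1`, the Garside element of the
parabolic subgroup of type `A_{n-1}`. -/
def ΔY (n : ℕ) : ArtinB n :=
  ((List.range (n - 1)).map fun k =>
    ((List.range (n - 1 - k)).map fun i => rB n (i + 1)).prod).prod

/-- `ρ_0 = t_1 t_2 ⋯ t_{n-1}`. -/
def ρ₀B (n : ℕ) : ArtinB n := ((List.range (n - 1)).map fun i => rB n (i + 1)).prod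

/-- `ρ_1 = t_1⁻¹ t_2⁻¹ ⋯ t_{n-1}⁻¹`. -/
def ρ₁B (n : ℕ) : ArtinB n := ((List.range (n - 1)).map fun i => (rB n (i + 1))⁻¹).prod

/-- `ρ_k` for `k ∈ {0,1}`. -/
def ρkB (n k : ℕ) : ArtinB n := if k = 0 then ρ₀B n else ρ₁B n

/-- `v_k = ρ_k t_{n-1} ρ_k⁻¹` for `k ∈ {0,1}`. -/
def vB (n k : ℕ) : ArtinB n := ρkB n k * rB n (n - 1) * (ρkB n k)⁻¹

/-- `δ = r_{n-1} r_{n-2} ⋯ r_2 r_1² r_2 ⋯ r_{n-2} r_{n-1}`. -/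
def δB (n : ℕ) : ArtinB n :=
  ((List.range (n - 2)).map fun i => rB n (n - 1 - i)).prod * rB n 1 ^ 2 *
  ((List.range (n - 2)).map fun i => rB n (i + 2)).prod

/-- The quotient `Ā = A[Bₙ]/Z(A[Bₙ])`. -/
abbrev AbarB (n : ℕ) := ArtinB n ⧸ Subgroup.center (ArtinB n)

/-- The canonical projection `π : A[Bₙ] → Ā`. -/
def πB (n : ℕ) : ArtinB n →* AbarB n := QuotientGroup.mk' (Subgroup.center (ArtinB n))

/-- `t̄_i = π(t_i)`. -/
def tbar (n i : ℕ) : AbarB n := πB n (tB n i)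

/-- `ρ̄_B = π(ρ_B)`. -/
def ρbar (n : ℕ) : AbarB n := πB n (ρB n)

/-- The composition `conj_x ∘ φ` of an endomorphism with an inner automorphism. -/
def conjComp {G : Type*} [Group G] (x : G) (φ : G →* G) : G →* G :=
  (MulAut.conj x).toMonoidHom.comp φ

/-- Type (1): there are commuting `g, h` with `φ(t_i) = g` for all `0 ≤ i ≤ n-1`
and `φ(ρ_B) = h`. -/
def IsType1 (n : ℕ) (φ : ArtinB n →* ArtinB n) : Prop :=
  ∃ g h : ArtinB n, g * h = h * g ∧ (∀ i < n, φ (tB n i) = g) ∧ φ (ρB n) = h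

/-- Type (2a) with parameters `ε ∈ {1,-1}`, `p q : ℤ`. -/
def IsType2a (n : ℕ) (ε p q : ℤ) (φ : ArtinB n →* ArtinB n) : Prop :=
  (ε = 1 ∨ ε = -1) ∧ (∀ i < n, φ (tB n i) = tB n i ^ ε * ΔB n ^ p) ∧
    φ (ρB n) = ρB n * ΔB n ^ q

/-- Type (2b) with parameters `ε ∈ {1,-1}`, `p q : ℤ`. -/
def IsType2b (n : ℕ) (ε p q : ℤ) (φ : ArtinB n →* ArtinB n) : Prop :=
  (ε = 1 ∨ ε = -1) ∧ (∀ i < n, φ (tB n i) = tB n (n - i) ^ ε * ΔB n ^ p) ∧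
    φ (ρB n) = (ρB n)⁻¹ * ΔB n ^ q

/-- Type (3) with parameters `ε ∈ {1,-1}`, `k ∈ {0,1}`, `p q r s : ℤ`. -/
def IsType3 (n : ℕ) (ε : ℤ) (k : ℕ) (p q r s : ℤ) (φ : ArtinB n →* ArtinB n) : Prop :=
  (ε = 1 ∨ ε = -1) ∧ (k = 0 ∨ k = 1) ∧
    (∀ i, 1 ≤ i → i ≤ n - 1 → φ (tB n i) = tB n i ^ ε * ΔY n ^ (2 * p) * ΔB n ^ q) ∧
    φ (tB n 0) = vB n k ^ ε * ΔY n ^ (2 * p) * ΔB n ^ q ∧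
    φ (ρB n) = ρkB n k * ΔY n ^ (2 * r) * ΔB n ^ s

set_option linter.unusedSectionVars false

namespace FreeGroup
variable {α : Type*} [DecidableEq α]

/-- No cancellation occurs in the product `x * y`. -/
def NC (x y : FreeGroup α) : Prop := norm (x * y) = norm x + norm y

theorem nc_iff {x y : FreeGroup α} : NC x y ↔ IsReduced (x.toWord ++ y.toWord) := by
  unfold NC norm
  rw [toWord_mul, ← List.length_append]
  constructor
  · intro h
    apply IsReduced.of_reduce_eq
    exact (Red.sublist reduce.red).eq_of_length h
  · intro h
    rw [h.reduce_eq]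

theorem NC.toWord {x y : FreeGroup α} (h : NC x y) : (x * y).toWord = x.toWord ++ y.toWord := by
  rw [toWord_mul, (nc_iff.1 h).reduce_eq]

theorem nc_one_right (x : FreeGroup α) : NC x 1 := by simp [NC]

theorem nc_one_left (x : FreeGroup α) : NC 1 x := by simp [NC]

theorem nc_iff_last {x y : FreeGroup α} : NC x y ↔
    ∀ a ∈ x.toWord.getLast?, ∀ b ∈ y.toWord.head?, a.1 = b.1 → a.2 = b.2 := by
  rw [nc_iff, IsReduced, List.isChain_append]
  exact ⟨fun h => h.2.2, fun h => ⟨isReduced_toWord, isReduced_toWord, h⟩⟩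

theorem NC.inv {x y : FreeGroup α} (h : NC x y) : NC y⁻¹ x⁻¹ := by
  unfold NC at *
  rw [← mul_inv_rev, norm_inv_eq, norm_inv_eq, norm_inv_eq, h, add_comm]

theorem NC.mul_left {x y z : FreeGroup α} (h₁ : NC x y) (h₂ : NC y z) (hy : y ≠ 1) :
    NC (x * y) z := by
  rw [nc_iff, h₁.toWord]
  exact IsReduced.append_overlap (nc_iff.1 h₁) (nc_iff.1 h₂) (by simpa using hy)

theorem NC.mul_right {x y z : FreeGroup α} (h₁ : NC x y) (h₂ : NC y z) (hy : y ≠ 1) :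
    NC x (y * z) := by
  rw [nc_iff, h₂.toWord, ← List.append_assoc]
  exact IsReduced.append_overlap (nc_iff.1 h₁) (nc_iff.1 h₂) (by simpa using hy)

theorem NC.of_mul_right {x y z : FreeGroup α} (h : NC x (y * z)) (h₂ : NC y z) : NC x y := by
  rw [nc_iff, h₂.toWord, ← List.append_assoc] at h
  rw [nc_iff]
  exact List.IsChain.left_of_append h

theorem NC.of_mul_left {x y z : FreeGroup α} (h : NC (x * y) z) (h₂ : NC x y) : NC y z := by
  rw [nc_iff, h₂.toWord, List.append_assoc] at h
  rw [nc_iff]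
  exact List.IsChain.right_of_append h

/-- The free group element of a letter. -/
def lt (l : α × Bool) : FreeGroup α := mk [l]

@[simp] theorem lt_true (a : α) : lt (a, true) = of a := rfl

@[simp] theorem lt_false (a : α) : lt (a, false) = (of a)⁻¹ := rfl

@[simp] theorem toWord_lt (l : α × Bool) : (lt l).toWord = [l] := by
  simp [lt, toWord_mk]

@[simp] theorem norm_lt (l : α × Bool) : norm (lt l) = 1 := by simp [norm]

theorem lt_ne_one (l : α × Bool) : lt l ≠ 1 := by
  intro h
  have := norm_lt l
  simp [h] at this

theorem lt_inv (l : α × Bool) : (lt l)⁻¹ = lt (l.1, !l.2) := by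
  simp [lt, invRev]

theorem nc_lt_left {l : α × Bool} {x : FreeGroup α} :
    NC (lt l) x ↔ ∀ b ∈ x.toWord.head?, l.1 = b.1 → l.2 = b.2 := by
  simp [nc_iff_last]

theorem exists_first {x : FreeGroup α} (hx : x ≠ 1) : ∃ l x', x = lt l * x' ∧ NC (lt l) x' := by
  rcases h : x.toWord with _ | ⟨l, w⟩
  · simp at h; exact absurd h hx
  · have hr : IsReduced (l :: w) := h ▸ isReduced_toWord
    have hw : (mk w).toWord = w := by
      rw [toWord_mk, IsReduced.reduce_eq]
      exact List.IsChain.tail hr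
    refine ⟨l, mk w, ?_, ?_⟩
    · rw [← mk_toWord (x := x), h, lt, mul_mk]; rfl
    · rw [nc_iff, hw, toWord_lt]
      exact hr

theorem exists_last {x : FreeGroup α} (hx : x ≠ 1) : ∃ l x', x = x' * lt l ∧ NC x' (lt l) := by
  obtain ⟨l, x', h, h'⟩ := exists_first (inv_ne_one.2 hx)
  refine ⟨(l.1, !l.2), x'⁻¹, ?_, ?_⟩
  · rw [← lt_inv, ← mul_inv_rev, ← h, inv_inv]
  · rw [← lt_inv]; exact h'.inv

theorem NC.norm_eq {x y : FreeGroup α} (h : NC x y) : norm (x * y) = norm x + norm y := h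

/-- A letter either does not cancel with `x` or `x` starts with its inverse. -/
theorem nc_or_cancel (l : α × Bool) (x : FreeGroup α) :
    NC (lt l) x ∨ ∃ x', x = (lt l)⁻¹ * x' ∧ NC (lt l)⁻¹ x' := by
  by_cases hx : x = 1
  · left; rw [hx]; exact nc_one_right _
  obtain ⟨m, x', h, h'⟩ := exists_first hx
  by_cases hm : m = (l.1, !l.2)
  · right; refine ⟨x', ?_, ?_⟩ <;> rw [lt_inv, ← hm] <;> assumption
  · left
    rw [nc_lt_left, h, h'.toWord]
    intro b hb
    simp only [toWord_lt, List.cons_append, List.nil_append, List.head?_cons, Option.mem_def,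
      Option.some.injEq] at hb
    subst hb
    intro h1
    rcases m with ⟨m1, m2⟩; rcases l with ⟨l1, l2⟩
    simp only at h1 hm ⊢
    subst h1
    cases l2 <;> cases m2 <;> simp_all

theorem nc_or_cancel_right (l : α × Bool) (x : FreeGroup α) :
    NC x (lt l) ∨ ∃ x', x = x' * (lt l)⁻¹ ∧ NC x' (lt l)⁻¹ := by
  rcases nc_or_cancel (l.1, !l.2) x⁻¹ with h | ⟨x', h, h'⟩
  · left; have := h.inv; rwa [inv_inv, ← lt_inv, inv_inv] at this
  · right; refine ⟨x'⁻¹, ?_, ?_⟩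
    · rw [← inv_inv x, h, ← lt_inv]; simp
    · have := h'.inv; rwa [← lt_inv, inv_inv] at this

theorem nc_lt_lt {l m : α × Bool} (h : l.1 ≠ m.1) : NC (lt l) (lt m) := by
  rw [nc_lt_left]; simp [h]

theorem nc_lt_self (l : α × Bool) : NC (lt l) (lt l) := by
  rw [nc_lt_left]; simp

/-- The first letter is unique. -/
theorem first_unique {l m : α × Bool} {x y : FreeGroup α} (h : lt l * x = lt m * y)
    (hx : NC (lt l) x) (hy : NC (lt m) y) : l = m := by
  have h1 := hx.toWord
  rw [h, hy.toWord] at h1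
  simp at h1
  exact h1.1.symm

theorem norm_zpow_of (a : α) (k : ℤ) : norm (of a ^ k) = k.natAbs := by
  obtain ⟨n, rfl | rfl⟩ := k.eq_nat_or_neg
  · simp
  · simp [norm_inv_eq]

theorem zpow_ne_one_of {a : α} {k : ℤ} (hk : k ≠ 0) : of a ^ k ≠ 1 := by
  intro h
  have := norm_zpow_of a k
  rw [h] at this
  simp at this
  omega

theorem lt_pow_nc (l : α × Bool) (n : ℕ) (x : FreeGroup α) (h : NC (lt l) x) :
    NC (lt l ^ n) x := by
  induction n with
  | zero => simpa using nc_one_left x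
  | succ n ih =>
    rw [pow_succ']
    rcases Nat.eq_zero_or_pos n with rfl | hn
    · simpa using h
    · have h1 : NC (lt l) (lt l ^ n) := by
        clear ih h
        have h2 : ∀ k, (lt l ^ k).toWord = List.replicate k l := by
          intro k
          rw [toWord_pow, toWord_lt]
          simp [List.flatten_replicate_singleton, reduce_replicate]
        rw [nc_iff, h2, toWord_lt]
        rw [List.singleton_append, ← List.replicate_succ, ← h2]
        exact isReduced_toWord
      refine NC.mul_left h1 ih ?_
      intro h0
      have h3 : norm (lt l ^ n) = n := by
        rcases l with ⟨a, b⟩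
        cases b
        · rw [lt_false, inv_pow, norm_inv_eq, norm_of_pow]
        · rw [lt_true, norm_of_pow]
      rw [h0] at h3; simp at h3; omega

theorem zpow_nc {a : α} {x : FreeGroup α} (h1 : NC (of a) x) (h2 : NC (of a)⁻¹ x) (k : ℤ) :
    NC (of a ^ k) x := by
  obtain ⟨n, rfl | rfl⟩ := k.eq_nat_or_neg
  · simpa using lt_pow_nc (a, true) n x h1
  · simpa using lt_pow_nc (a, false) n x h2

theorem nc_zpow {a : α} {x : FreeGroup α} (h1 : NC x (of a)) (h2 : NC x (of a)⁻¹) (k : ℤ) :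
    NC x (of a ^ k) := by
  have := (zpow_nc (a := a) (x := x⁻¹) (by simpa using h2.inv) h1.inv (-k)).inv
  simpa using this

/-- An element commuting with a basis element is a power of it. -/
theorem mem_zpowers_of_commute {a : α} {u : FreeGroup α} (h : Commute (of a) u) :
    u ∈ Subgroup.zpowers (of a) := by
  induction hn : norm u using Nat.strong_induction_on generalizing u with
  | _ n ih =>
  by_cases hu : u = 1
  · rw [hu]; exact one_mem _
  have key : ∀ l : α × Bool, l.1 = a → ∀ x', u = lt l * x' → NC (lt l) x' →
      u ∈ Subgroup.zpowers (of a) := by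
    rintro ⟨b, c⟩ rfl x' h1 h2
    have hl : lt (b, c) ∈ Subgroup.zpowers (of b) := by
      cases c <;> simp
    have hc : Commute (of b) (lt (b, c)) := by
      cases c <;> simp
    rw [h1]
    refine mul_mem hl (ih (norm x') ?_ ?_ rfl)
    · rw [← hn, h1, h2.norm_eq]; simp
    · have : x' = (lt (b, c))⁻¹ * u := by rw [h1]; group
      rw [this]; exact hc.inv_right.mul_right h
  rcases nc_or_cancel (a, true) u with h1 | ⟨x', h1, h2⟩
  · have h3 : NC u (of a) := by
      unfold NC; rw [← h.eq]; rw [lt_true] at h1; rw [h1.norm_eq]; ring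
    obtain ⟨l, y, hy, hy'⟩ := exists_first hu
    by_cases hy1 : y = 1
    · refine key l ?_ y hy hy'
      subst hy1
      rw [mul_one] at hy
      subst hy
      have := first_unique (l := (a, true)) (m := l) h.eq h1 h3
      rw [← this]
    · refine key l ?_ y hy hy'
      have h4 : NC (lt l) (y * of a) := by
        apply hy'.mul_right _ hy1
        rw [hy] at h3
        exact h3.of_mul_left hy'
      have := first_unique (l := (a, true)) (m := l) (x := u) (y := y * of a)
        (by rw [lt_true, h.eq, ← mul_assoc, ← hy]) h1 h4
      rw [← this]
  · rw [lt_inv] at h1 h2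
    exact key _ rfl x' h1 h2

end FreeGroup

/-- The centralizer of a nontrivial element of a free group is cyclic. -/
theorem FreeGroup.exists_root {α : Type} {u : FreeGroup α} (hu : u ≠ 1) :
    ∃ r : FreeGroup α, ∀ g, Commute g u → g ∈ Subgroup.zpowers r := by
  classical
  let C := Subgroup.centralizer ({u} : Set (FreeGroup α))
  have hC : ∀ g, g ∈ C ↔ Commute g u := by
    intro g
    rw [Subgroup.mem_centralizer_singleton_iff]; exact Iff.rfl
  let e := IsFreeGroup.toFreeGroup C
  let u' : C := ⟨u, (hC u).2 (Commute.refl u)⟩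
  have hcent : ∀ g : C, Commute g u' := fun g => Subtype.ext ((hC g).1 g.2)
  have hsub : ∀ p q : IsFreeGroup.Generators C, p = q := by
    intro p q
    by_contra hpq
    have h1 : ∀ x, Commute x (e u') := by
      intro x
      have := (hcent (e.symm x)).map e
      simpa using this
    obtain ⟨i, hi⟩ := FreeGroup.mem_zpowers_of_commute (h1 (FreeGroup.of p))
    obtain ⟨j, hj⟩ := FreeGroup.mem_zpowers_of_commute (h1 (FreeGroup.of q))
    simp only at hi hj
    have h2 := congrArg (FreeGroup.lift (fun x => if x = p then Multiplicative.ofAdd (1:ℤ) else 1))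
      (hi.trans hj.symm)
    rw [map_zpow, map_zpow] at h2
    simp only [FreeGroup.lift_apply_of, if_true, if_neg (Ne.symm hpq), one_zpow] at h2
    rw [← ofAdd_zsmul] at h2
    have h3 : i = 0 := by simpa using h2
    subst h3
    have : e u' = 1 := by rw [← hi]; simp
    have h5 : u' = 1 := by simpa using this
    exact hu (congrArg Subtype.val h5)
  by_cases hne : Nonempty (IsFreeGroup.Generators C)
  · obtain ⟨p⟩ := hne
    refine ⟨(e.symm (FreeGroup.of p)).1, fun g hg => ?_⟩
    have : ∀ x, x ∈ Subgroup.zpowers (FreeGroup.of p) := by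
      intro x
      induction x using FreeGroup.induction_on with
      | C1 => exact one_mem _
      | of x => rw [hsub x p]; exact Subgroup.mem_zpowers _
      | inv_of x h => exact inv_mem h
      | mul x y hx hy => exact mul_mem hx hy
    obtain ⟨k, hk⟩ := this (e ⟨g, (hC g).2 hg⟩)
    refine ⟨k, ?_⟩
    have h6 := congrArg (fun x => (e.symm x).1) hk
    simpa using h6
  · exfalso
    have : IsEmpty (IsFreeGroup.Generators C) := not_nonempty_iff.1 hne
    have h7 : e u' = 1 := Subsingleton.elim _ _
    have h5 : u' = 1 := by simpa using h7
    exact hu (congrArg Subtype.val h5)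

namespace FreeGroup
variable {α : Type*} [DecidableEq α]

/-- The subgroup generated by the letters other than `a`. -/
def avoid (a : α) : Subgroup (FreeGroup α) := Subgroup.closure (Set.image of {b | b ≠ a})

theorem not_mem_toWord_of_mem_avoid {a : α} {g : FreeGroup α} (hg : g ∈ avoid a) :
    ∀ l ∈ g.toWord, l.1 ≠ a := by
  induction hg using Subgroup.closure_induction with
  | mem x hx => obtain ⟨b, hb, rfl⟩ := hx; simpa using hb
  | one => simp
  | mul x y _ _ hx hy =>
    intro l hl
    have := (toWord_mul_sublist x y).subset hl
    rcases List.mem_append.1 this with h | h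
    · exact hx l h
    · exact hy l h
  | inv x _ hx =>
    intro l hl
    rw [toWord_inv] at hl
    simp only [invRev, List.mem_reverse, List.mem_map] at hl
    obtain ⟨m, hm, rfl⟩ := hl
    exact hx m hm

theorem zpow_nc_avoid {a : α} {g : FreeGroup α} (hg : g ∈ avoid a) (k : ℤ) : NC (of a ^ k) g := by
  have h := not_mem_toWord_of_mem_avoid hg
  apply zpow_nc
  · rw [← lt_true, nc_lt_left]
    exact fun b hb hab => absurd hab.symm (h b (List.mem_of_mem_head? hb))
  · rw [← lt_false, nc_lt_left]
    exact fun b hb hab => absurd hab.symm (h b (List.mem_of_mem_head? hb))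

theorem avoid_nc_zpow {a : α} {g : FreeGroup α} (hg : g ∈ avoid a) (k : ℤ) : NC g (of a ^ k) := by
  have := (zpow_nc_avoid (inv_mem hg) (-k)).inv
  simpa using this

/-- The product `a^{e₁} g₁ a^{e₂} g₂ ⋯`. -/
def altProd (a : α) (L : List (ℤ × FreeGroup α)) : FreeGroup α :=
  (L.map fun p => of a ^ p.1 * p.2).prod

@[simp] theorem altProd_nil (a : α) : altProd a [] = 1 := rfl

@[simp] theorem altProd_cons (a : α) (p) (L : List (ℤ × FreeGroup α)) :
    altProd a (p :: L) = of a ^ p.1 * p.2 * altProd a L := by simp [altProd]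

@[simp] theorem altProd_append (a : α) (L M : List (ℤ × FreeGroup α)) :
    altProd a (L ++ M) = altProd a L * altProd a M := by simp [altProd]

/-- The expected length of an alternating product. -/
def altLen (L : List (ℤ × FreeGroup α)) : ℕ := (L.map fun p => p.1.natAbs + norm p.2).sum

/-- All syllables are nontrivial. -/
def AltGood (a : α) (L : List (ℤ × FreeGroup α)) : Prop :=
  ∀ p ∈ L, p.1 ≠ 0 ∧ p.2 ≠ 1 ∧ p.2 ∈ avoid a

theorem nc_altProd {a : α} {L : List (ℤ × FreeGroup α)} (hL : AltGood a L) {g : FreeGroup α}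
    (hg : g ∈ avoid a) : NC g (altProd a L) ∧ norm (altProd a L) = altLen L := by
  induction L generalizing g with
  | nil => exact ⟨nc_one_right g, by simp [altLen]⟩
  | cons p L ih =>
    obtain ⟨hp0, hp1, hp2⟩ := hL p (by simp)
    obtain ⟨h1, h2⟩ := ih (fun q hq => hL q (by simp [hq])) hp2
    have h3 : NC (of a ^ p.1) (p.2 * altProd a L) := (zpow_nc_avoid hp2 p.1).mul_right h1 hp1
    rw [altProd_cons, mul_assoc]
    refine ⟨(avoid_nc_zpow hg p.1).mul_right h3 (zpow_ne_one_of hp0), ?_⟩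
    rw [h3.norm_eq, h1.norm_eq, h2, norm_zpow_of]
    simp [altLen, add_assoc]

theorem altGood_pow {a : α} {L : List (ℤ × FreeGroup α)} (hL : AltGood a L) (m : ℕ) :
    norm (altProd a L ^ m) = m * altLen L := by
  have h1 : altProd a L ^ m = altProd a (List.replicate m L).flatten := by
    induction m with
    | zero => simp
    | succ m ih => rw [List.replicate_succ, List.flatten_cons, altProd_append, ← ih, pow_succ']
  have h2 : altLen (List.replicate m L).flatten = m * altLen L := by
    induction m with
    | zero => simp [altLen]
    | succ m ih =>
      have : altLen (L ++ (List.replicate m L).flatten)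
          = altLen L + altLen (List.replicate m L).flatten := by simp [altLen]
      rw [List.replicate_succ, List.flatten_cons, this, ih]
      · ring
      · clear this ih h1
        induction m with
        | zero => simp
        | succ m ih => rw [List.replicate_succ, List.flatten_cons, altProd_append, ← ih, pow_succ']
  rw [h1, ← h2]
  refine (nc_altProd ?_ (one_mem (avoid a))).2
  intro p hp
  simp only [List.mem_flatten, List.mem_replicate] at hp
  obtain ⟨M, ⟨_, rfl⟩, h⟩ := hp
  exact hL p h

theorem altLen_le_of_isConj {a : α} {L M : List (ℤ × FreeGroup α)} (hL : AltGood a L)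
    (hM : AltGood a M) (h : IsConj (altProd a L) (altProd a M)) : altLen L ≤ altLen M := by
  obtain ⟨c, hc⟩ := isConj_iff.1 h.symm
  by_contra hlt
  push Not at hlt
  have key : ∀ m : ℕ, m * altLen L ≤ m * altLen M + 2 * norm c := by
    intro m
    rw [← altGood_pow hL, ← altGood_pow hM, ← hc, conj_pow]
    have h1 := norm_mul_le (c * altProd a M ^ m) c⁻¹
    have h2 := norm_mul_le c (altProd a M ^ m)
    rw [norm_inv_eq] at h1
    omega
  have := key (2 * norm c + 1)
  nlinarith

theorem exists_altProd (a : α) (u : FreeGroup α) :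
    ∃ L : List (ℤ × FreeGroup α), (∀ p ∈ L, p.2 ∈ avoid a) ∧ u = altProd a L := by
  have hav : ∀ b, b ≠ a → of b ∈ avoid a := fun b hb => Subgroup.subset_closure ⟨b, hb, rfl⟩
  induction u using FreeGroup.induction_on with
  | C1 => exact ⟨[], by simp, by simp⟩
  | of b =>
    by_cases hb : b = a
    · exact ⟨[(1, 1)], by simp [one_mem], by simp [hb]⟩
    · exact ⟨[(0, of b)], fun p hp => by
        rw [List.mem_singleton.1 hp]; exact hav b hb, by simp⟩
  | inv_of b _ =>
    by_cases hb : b = a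
    · exact ⟨[(-1, 1)], by simp [one_mem], by simp [hb]⟩
    · exact ⟨[(0, (of b)⁻¹)], fun p hp => by
        rw [List.mem_singleton.1 hp]; exact inv_mem (hav b hb), by simp⟩
  | mul x y hx hy =>
    obtain ⟨L, h1, rfl⟩ := hx
    obtain ⟨M, h2, rfl⟩ := hy
    refine ⟨L ++ M, ?_, by simp⟩
    intro p hp
    rcases List.mem_append.1 hp with h | h
    · exact h1 p h
    · exact h2 p h

theorem isConj_mul_comm {G : Type*} [Group G] (x y : G) : IsConj (x * y) (y * x) :=
  isConj_iff.2 ⟨y, by group⟩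

theorem exists_altGood_isConj (a : α) (u : FreeGroup α) :
    (∃ h ∈ avoid a, IsConj u h) ∨ (∃ k : ℤ, IsConj u (of a ^ k)) ∨
      ∃ L, L ≠ [] ∧ AltGood a L ∧ IsConj u (altProd a L) := by
  obtain ⟨L, hL, rfl⟩ := exists_altProd a u
  induction hn : L.length using Nat.strong_induction_on generalizing L with
  | _ n ih =>
  subst hn
  by_cases hL0 : L = []
  · left; exact ⟨1, one_mem _, by rw [hL0]; simp⟩
  by_cases hgood : AltGood a L
  · right; right; exact ⟨L, hL0, hgood, IsConj.refl _⟩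
  have step : ∀ M : List (ℤ × FreeGroup α), M.length < L.length → (∀ p ∈ M, p.2 ∈ avoid a) →
      IsConj (altProd a L) (altProd a M) → (∃ h ∈ avoid a, IsConj (altProd a L) h) ∨
      (∃ k : ℤ, IsConj (altProd a L) (of a ^ k)) ∨
      ∃ N, N ≠ [] ∧ AltGood a N ∧ IsConj (altProd a L) (altProd a N) := by
    intro M hM hMa hc
    rcases ih _ hM M hMa rfl with ⟨h, h1, h2⟩ | ⟨k, h1⟩ | ⟨N, h1, h2, h3⟩
    · exact Or.inl ⟨h, h1, hc.trans h2⟩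
    · exact Or.inr (Or.inl ⟨k, hc.trans h1⟩)
    · exact Or.inr (Or.inr ⟨N, h1, h2, hc.trans h3⟩)
  have hbad : ∃ p ∈ L, p.1 = 0 ∨ p.2 = 1 := by
    by_contra hcon
    push Not at hcon
    exact hgood fun p hp => ⟨(hcon p hp).1, (hcon p hp).2, hL p hp⟩
  obtain ⟨p, hp, hpb⟩ := hbad
  obtain ⟨s, t, rfl⟩ := List.append_of_mem hp
  have hp2 := hL p hp
  have hrot : IsConj (altProd a (s ++ p :: t)) (of a ^ p.1 * p.2 * altProd a (t ++ s)) := by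
    have := isConj_mul_comm (altProd a s) (altProd a (p :: t))
    rw [altProd_append, altProd_append, ← mul_assoc, ← altProd_cons]
    exact this
  have hR : ∀ q ∈ t ++ s, q.2 ∈ avoid a := by
    intro q hq
    apply hL
    simp only [List.mem_append, List.mem_cons] at hq ⊢
    tauto
  have hlen : (s ++ p :: t).length = (t ++ s).length + 1 := by simp; omega
  generalize t ++ s = R at *
  rcases hpb with h0 | h0
  · rw [h0, zpow_zero, one_mul] at hrot
    rcases List.eq_nil_or_concat' R with rfl | ⟨R', q, rfl⟩
    · left; exact ⟨p.2, hp2, by simpa using hrot⟩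
    · refine step (R' ++ [(q.1, q.2 * p.2)]) (by rw [hlen]; simp) ?_ ?_
      · intro r hr
        rcases List.mem_append.1 hr with h | h
        · exact hR r (by simp [h])
        · simp only [List.mem_singleton] at h
          subst h
          exact mul_mem (hR q (by simp)) hp2
      · refine hrot.trans ((isConj_mul_comm _ _).trans ?_)
        rw [show altProd a (R' ++ [q]) * p.2 = altProd a (R' ++ [(q.1, q.2 * p.2)]) by
          simp [mul_assoc]]
  · rw [h0, mul_one] at hrot
    rcases R with _ | ⟨q, R'⟩
    · right; left; exact ⟨p.1, by simpa using hrot⟩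
    · refine step ((p.1 + q.1, q.2) :: R') (by rw [hlen]; simp) ?_ ?_
      · intro r hr
        rcases List.mem_cons.1 hr with h | h
        · subst h; exact hR q (by simp)
        · exact hR r (by simp [h])
      · rwa [show altProd a ((p.1 + q.1, q.2) :: R') = of a ^ p.1 * altProd a (q :: R') by
          simp [mul_assoc, zpow_add]]

theorem norm_zpow_mul_mul_zpow {w : α} {g : FreeGroup α} (hg : g ∉ Subgroup.zpowers (of w))
    (M N : ℤ) : M.natAbs + N.natAbs ≤ norm (of w ^ M * g * of w ^ N) + norm g := by
  induction hn : norm g using Nat.strong_induction_on generalizing g M N with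
  | _ n ih =>
  subst hn
  have hw : ∀ k : ℤ, of w ^ k ∈ Subgroup.zpowers (of w) := fun k => ⟨k, rfl⟩
  have left : ∀ s : ℤ, s.natAbs = 1 → ∀ x', g = of w ^ s * x' → NC (of w ^ s) x' →
      M.natAbs + N.natAbs ≤ norm (of w ^ M * g * of w ^ N) + norm g := by
    intro s hs x' h1 h2
    have h3 : norm g = 1 + norm x' := by rw [h1, h2.norm_eq, norm_zpow_of, hs]
    have h4 : x' ∉ Subgroup.zpowers (of w) := by
      intro h; exact hg (h1 ▸ mul_mem (hw s) h)
    have h5 := ih (norm x') (by omega) h4 (M + s) N rfl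
    have h6 : of w ^ M * g * of w ^ N = of w ^ (M + s) * x' * of w ^ N := by
      rw [h1, zpow_add]; group
    rw [h6]; omega
  have right : ∀ s : ℤ, s.natAbs = 1 → ∀ x', g = x' * of w ^ s → NC x' (of w ^ s) →
      M.natAbs + N.natAbs ≤ norm (of w ^ M * g * of w ^ N) + norm g := by
    intro s hs x' h1 h2
    have h3 : norm g = norm x' + 1 := by rw [h1, h2.norm_eq, norm_zpow_of, hs]
    have h4 : x' ∉ Subgroup.zpowers (of w) := by
      intro h; exact hg (h1 ▸ mul_mem h (hw s))
    have h5 := ih (norm x') (by omega) h4 M (s + N) rfl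
    have h6 : of w ^ M * g * of w ^ N = of w ^ M * x' * of w ^ (s + N) := by
      rw [h1, zpow_add]; group
    rw [h6]; omega
  rcases nc_or_cancel (w, true) g with h1 | ⟨x', h1, h2⟩
  swap
  · exact left (-1) rfl x' (by simpa using h1) (by simpa using h2)
  rcases nc_or_cancel (w, false) g with h2 | ⟨x', h3, h4⟩
  swap
  · exact left 1 rfl x' (by simpa using h3) (by simpa using h4)
  rcases nc_or_cancel_right (w, true) g with h3 | ⟨x', h3, h4⟩
  swap
  · exact right (-1) rfl x' (by simpa using h3) (by simpa using h4)
  rcases nc_or_cancel_right (w, false) g with h4 | ⟨x', h5, h6⟩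
  swap
  · exact right 1 rfl x' (by simpa using h5) (by simpa using h6)
  have hg1 : g ≠ 1 := by rintro rfl; exact hg (one_mem _)
  have k1 := zpow_nc h1 h2 M
  have k2 := (k1.mul_left (nc_zpow h3 h4 N) hg1)
  rw [k2.norm_eq, k1.norm_eq, norm_zpow_of, norm_zpow_of]
  omega

/-- An element whose conjugacy class is fixed by a partial conjugation is conjugate into one of
two obvious subgroups. -/
theorem isConj_of_partialConj_invariant {a w : α} (haw : a ≠ w) (τ : FreeGroup α →* FreeGroup α)
    {ε : ℤ} (hε : ε ≠ 0) (hτa : τ (of a) = of w ^ ε * of a * of w ^ (-ε))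
    (hτ : ∀ b, b ≠ a → τ (of b) = of b) {u : FreeGroup α}
    (hu : ∀ N : ℕ, IsConj u (τ^[N] u)) :
    (∃ h ∈ avoid a, IsConj u h) ∨
      ∃ h ∈ Subgroup.closure {of a, of w}, IsConj u h := by
  rcases exists_altGood_isConj a u with h | ⟨k, h⟩ | ⟨L, h1, h2, h3⟩
  · exact Or.inl h
  · exact Or.inr ⟨_, zpow_mem (Subgroup.subset_closure (by simp)) k, h⟩
  right
  have hH : ∀ N : ℕ, ∀ g ∈ avoid a, τ^[N] g = g := by
    intro N g hg
    have : τ g = g := by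
      induction hg using Subgroup.closure_induction with
      | mem x hx => obtain ⟨b, hb, rfl⟩ := hx; exact hτ b hb
      | one => simp
      | mul x y _ _ hx hy => rw [_root_.map_mul, hx, hy]
      | inv x _ hx => rw [_root_.map_inv, hx]
    exact Function.iterate_fixed this N
  have hwm : of w ∈ avoid a := Subgroup.subset_closure ⟨w, haw.symm, rfl⟩
  have hA : ∀ N : ℕ, τ^[N] (of a) = of w ^ (ε * N) * of a * of w ^ (-(ε * N)) := by
    intro N
    induction N with
    | zero => simp
    | succ N ih =>
      rw [Function.iterate_succ_apply', ih]
      simp only [_root_.map_mul, _root_.map_zpow, hτ w haw.symm, hτa]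
      push_cast
      rw [mul_add, mul_one, zpow_add, neg_add_rev, zpow_add]
      group
  have hP : ∀ (N : ℕ) (M : List (ℤ × FreeGroup α)), (∀ p ∈ M, p.2 ∈ avoid a) →
      τ^[N] (altProd a M) = of w ^ (ε * N) *
        altProd a (M.map fun p => (p.1, of w ^ (-(ε * N)) * p.2 * of w ^ (ε * N))) *
          of w ^ (-(ε * N)) := by
    intro N M hM
    induction M with
    | nil => rw [altProd_nil, iterate_map_one]; simp
    | cons p M ih =>
      rw [altProd_cons, List.map_cons, altProd_cons]
      have h4 : τ^[N] (of a ^ p.1) = of w ^ (ε * N) * of a ^ p.1 * of w ^ (-(ε * N)) := by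
        rw [iterate_map_zpow, hA, zpow_neg, conj_zpow]
      have h5 : τ^[N] (of a ^ p.1 * p.2 * altProd a M) =
          τ^[N] (of a ^ p.1) * τ^[N] p.2 * τ^[N] (altProd a M) := by
        simp only [iterate_map_mul]
      rw [h5, h4, hH N p.2 (hM p (by simp)), ih fun q hq => hM q (by simp [hq])]
      group
  have hgood : ∀ N : ℕ, AltGood a
      (L.map fun p => (p.1, of w ^ (-(ε * N)) * p.2 * of w ^ (ε * N))) := by
    intro N p hp
    obtain ⟨q, hq, rfl⟩ := List.mem_map.1 hp
    obtain ⟨k1, k2, k3⟩ := h2 q hq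
    refine ⟨k1, ?_, mul_mem (mul_mem (zpow_mem hwm _) k3) (zpow_mem hwm _)⟩
    intro h
    apply k2
    have : q.2 = of w ^ (ε * N) * (of w ^ (-(ε * N)) * q.2 * of w ^ (ε * N)) *
      of w ^ (-(ε * N)) := by group
    simp only at h
    rw [this, h]; group
  have hlen : ∀ N : ℕ, altLen (L.map fun p => (p.1, of w ^ (-(ε * N)) * p.2 * of w ^ (ε * N)))
      ≤ altLen L := by
    intro N
    apply altLen_le_of_isConj (hgood N) h2
    have k1 : IsConj (altProd a L) (τ^[N] (altProd a L)) := by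
      obtain ⟨c, hc⟩ := isConj_iff.1 h3
      have : IsConj (τ^[N] u) (τ^[N] (altProd a L)) := by
        rw [isConj_iff]
        refine ⟨τ^[N] c, ?_⟩
        rw [← iterate_map_inv, ← iterate_map_mul, ← iterate_map_mul, hc]
      exact (h3.symm.trans (hu N)).trans this
    rw [hP N L fun p hp => (h2 p hp).2.2] at k1
    refine IsConj.trans ?_ k1.symm
    rw [isConj_iff]
    exact ⟨of w ^ (ε * N), by rw [zpow_neg]⟩
  have hmem : ∀ p ∈ L, p.2 ∈ Subgroup.zpowers (of w) := by
    intro p hp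
    by_contra hcon
    let N := altLen L + norm p.2 + 1
    have k1 := norm_zpow_mul_mul_zpow hcon (-(ε * N)) (ε * N)
    have k2 := hlen N
    have k3 : norm (of w ^ (-(ε * N)) * p.2 * of w ^ (ε * N)) ≤
        altLen (L.map fun p => (p.1, of w ^ (-(ε * N)) * p.2 * of w ^ (ε * N))) := by
      unfold altLen
      rw [List.map_map]
      refine le_trans ?_ (List.single_le_sum (by simp) _ (List.mem_map.2 ⟨p, hp, rfl⟩))
      simp
    have k4 : N ≤ (ε * N).natAbs := by
      rw [Int.natAbs_mul]
      simpa using Nat.le_mul_of_pos_left N (Int.natAbs_pos.2 hε)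
    rw [Int.natAbs_neg] at k1
    omega
  refine ⟨altProd a L, ?_, h3⟩
  clear hlen hgood h1 h2 h3 hP hA hH
  induction L with
  | nil => exact one_mem _
  | cons p L ih =>
    rw [altProd_cons]
    obtain ⟨k, hk⟩ := hmem p (by simp)
    refine mul_mem (mul_mem (zpow_mem (Subgroup.subset_closure (by simp)) _) ?_)
      (ih fun q hq => hmem q (by simp [hq]))
    rw [← hk]
    exact zpow_mem (Subgroup.subset_closure (by simp)) _

end FreeGroup

/-- The standard generators, indexed from `0`. -/
def sB (n i : ℕ) : ArtinB n := rB n (i + 1)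

theorem sB_of_lt {n i : ℕ} (h : i < n) : sB n i = PresentedGroup.of ⟨i, h⟩ := by
  simp [sB, rB, h]

theorem sB_of_le {n i : ℕ} (h : n ≤ i) : sB n i = 1 := by
  simp [sB, rB, h]

theorem sB_braid {n i : ℕ} (h : i + 2 < n) :
    sB n i * sB n (i + 1) * sB n i = sB n (i + 1) * sB n i * sB n (i + 1) := by
  rw [sB_of_lt (show i < n by omega), sB_of_lt (show i + 1 < n by omega)]
  have : (QuotientGroup.mk' _ _ : ArtinB n) = 1 := (QuotientGroup.eq_one_iff _).2
    (Subgroup.subset_normalClosure (s := BnRels n)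
    (Or.inl ⟨⟨i, by omega⟩, ⟨i + 1, by omega⟩, rfl, h, rfl⟩))
  rw [map_mul, map_inv, mul_inv_eq_one] at this
  exact this

theorem sB_four {n i : ℕ} (h : i + 2 = n) :
    sB n i * sB n (i + 1) * sB n i * sB n (i + 1) =
      sB n (i + 1) * sB n i * sB n (i + 1) * sB n i := by
  rw [sB_of_lt (show i < n by omega), sB_of_lt (show i + 1 < n by omega)]
  have : (QuotientGroup.mk' _ _ : ArtinB n) = 1 := (QuotientGroup.eq_one_iff _).2
    (Subgroup.subset_normalClosure (s := BnRels n)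
    (Or.inr (Or.inl ⟨⟨i, by omega⟩, ⟨i + 1, by omega⟩, h, by simp only; omega, rfl⟩)))
  rw [map_mul, map_inv, mul_inv_eq_one] at this
  exact this

theorem sB_comm {n i j : ℕ} (h : i + 2 ≤ j) : Commute (sB n i) (sB n j) := by
  by_cases hj : j < n
  · rw [sB_of_lt (show i < n by omega), sB_of_lt hj]
    have : (QuotientGroup.mk' _ _ : ArtinB n) = 1 := (QuotientGroup.eq_one_iff _).2
      (Subgroup.subset_normalClosure (s := BnRels n)
      (Or.inr (Or.inr ⟨⟨i, by omega⟩, ⟨j, by omega⟩, h, rfl⟩)))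
    rw [map_mul, map_inv, mul_inv_eq_one] at this
    exact this
  · rw [sB_of_le (not_lt.1 hj)]; exact Commute.one_right _

/-- Universal property of the Artin group. -/
def ArtinB.lift {H : Type*} [Group H] (n : ℕ) (f : ℕ → H)
    (hb : ∀ i, i + 2 < n → f i * f (i + 1) * f i = f (i + 1) * f i * f (i + 1))
    (h4 : ∀ i, i + 2 = n →
      f i * f (i + 1) * f i * f (i + 1) = f (i + 1) * f i * f (i + 1) * f i)
    (hc : ∀ i j, i + 2 ≤ j → j < n → f i * f j = f j * f i) : ArtinB n →* H :=
  PresentedGroup.toGroup (rels := BnRels n) (f := fun i : Fin n => f i) (by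
    rintro r (⟨i, j, h1, h2, rfl⟩ | ⟨i, j, h1, h2, rfl⟩ | ⟨i, j, h1, rfl⟩)
    · simp only [map_mul, map_inv, FreeGroup.lift_apply_of, mul_inv_eq_one]
      rw [← h1]; exact hb i (by omega)
    · simp only [map_mul, map_inv, FreeGroup.lift_apply_of, mul_inv_eq_one]
      rw [show (j : ℕ) = i + 1 by omega]; exact h4 i h1
    · simp only [map_mul, map_inv, FreeGroup.lift_apply_of, mul_inv_eq_one]
      exact hc i j h1 j.2)

theorem ArtinB.lift_sB {H : Type*} [Group H] {n : ℕ} {f : ℕ → H} {hb h4 hc} {i : ℕ} (hi : i < n) :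
    ArtinB.lift n f hb h4 hc (sB n i) = f i := by
  rw [sB_of_lt hi, ArtinB.lift, PresentedGroup.toGroup.of]

theorem ArtinB.closure_eq_top {n : ℕ} {K : Subgroup (ArtinB n)} (h : ∀ i, i < n → sB n i ∈ K)
    (g : ArtinB n) : g ∈ K := by
  have : (⊤ : Subgroup (ArtinB n)) ≤ K := by
    rw [← PresentedGroup.closure_range_of (BnRels n), Subgroup.closure_le]
    rintro _ ⟨i, rfl⟩
    have := h i i.2
    rwa [sB_of_lt i.2] at this
  exact this trivial

theorem ArtinB.hom_ext {H : Type*} [Group H] {n : ℕ} {f g : ArtinB n →* H}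
    (h : ∀ i, i < n → f (sB n i) = g (sB n i)) : f = g := by
  ext x
  exact ArtinB.closure_eq_top (K := f.eqLocus g) h (PresentedGroup.of x)

open FreeGroup in
theorem FreeGroup.mulAut_ext {α : Type*} {f g : MulAut (FreeGroup α)}
    (h : ∀ k, f (of k) = g (of k)) : f = g := by
  apply MulEquiv.toMonoidHom_injective
  exact FreeGroup.ext_hom _ _ h

namespace Braid
open FreeGroup (of mulAut_ext)

/-- Forward half twist on letters. -/
def htF (i : ℕ) : FreeGroup ℕ →* FreeGroup ℕ :=
  FreeGroup.lift fun k => if k = i then of (i + 1) else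
    if k = i + 1 then (of (i + 1))⁻¹ * of i * of (i + 1) else of k

/-- Backward half twist on letters. -/
def htB (i : ℕ) : FreeGroup ℕ →* FreeGroup ℕ :=
  FreeGroup.lift fun k => if k = i + 1 then of i else
    if k = i then of i * of (i + 1) * (of i)⁻¹ else of k

theorem htF_self (i : ℕ) : htF i (of i) = of (i + 1) := by simp [htF]
theorem htF_succ (i : ℕ) : htF i (of (i + 1)) = (of (i + 1))⁻¹ * of i * of (i + 1) := by
  simp [htF]
theorem htF_of_ne {i k : ℕ} (h : k ≠ i) (h' : k ≠ i + 1) : htF i (of k) = of k := by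
  simp [htF, h, h']
theorem htB_succ (i : ℕ) : htB i (of (i + 1)) = of i := by simp [htB]
theorem htB_self (i : ℕ) : htB i (of i) = of i * of (i + 1) * (of i)⁻¹ := by
  simp [htB]
theorem htB_of_ne {i k : ℕ} (h : k ≠ i) (h' : k ≠ i + 1) : htB i (of k) = of k := by
  simp [htB, h, h']

/-- The half twist. -/
def ht (i : ℕ) : MulAut (FreeGroup ℕ) :=
  MonoidHom.toMulEquiv (htF i) (htB i)
    (by
      ext k
      simp only [MonoidHom.comp_apply, MonoidHom.id_apply]
      by_cases h : k = i
      · subst h; rw [htF_self, htB_succ]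
      by_cases h' : k = i + 1
      · subst h'; rw [htF_succ]
        simp only [map_mul, map_inv, htB_succ, htB_self]; group
      · rw [htF_of_ne h h', htB_of_ne h h'])
    (by
      ext k
      simp only [MonoidHom.comp_apply, MonoidHom.id_apply]
      by_cases h' : k = i + 1
      · subst h'; rw [htB_succ, htF_self]
      by_cases h : k = i
      · subst h; rw [htB_self]
        simp only [map_mul, map_inv, htF_succ, htF_self]; group
      · rw [htB_of_ne h h', htF_of_ne h h'])

theorem ht_self (i : ℕ) : ht i (of i) = of (i + 1) := htF_self i
theorem ht_succ (i : ℕ) : ht i (of (i + 1)) = (of (i + 1))⁻¹ * of i * of (i + 1) := htF_succ i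
theorem ht_of_ne {i k : ℕ} (h : k ≠ i) (h' : k ≠ i + 1) : ht i (of k) = of k := htF_of_ne h h'

theorem ht_braid (i : ℕ) : ht i * ht (i + 1) * ht i = ht (i + 1) * ht i * ht (i + 1) := by
  apply mulAut_ext
  intro k
  simp only [MulAut.mul_apply]
  by_cases h1 : k = i
  · subst h1
    rw [ht_self, ht_self, ht_of_ne (by omega) (by omega), ht_of_ne (by omega) (by omega),
      ht_self, ht_self]
  by_cases h2 : k = i + 1
  · subst h2
    simp only [ht_succ, map_mul, map_inv, ht_self, ht_of_ne (show i + 2 ≠ i by omega)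
      (show i + 2 ≠ i + 1 by omega), ht_of_ne (show i ≠ i + 1 by omega)
      (show i ≠ i + 1 + 1 by omega)]
  by_cases h3 : k = i + 2
  · subst h3
    have e := ht_of_ne (show i + 2 ≠ i by omega) (show i + 2 ≠ i + 1 by omega)
    have e' := ht_of_ne (show i ≠ i + 1 by omega) (show i ≠ i + 1 + 1 by omega)
    have s := ht_succ (i + 1)
    have s' := ht_self (i + 1)
    simp only [add_assoc, Nat.reduceAdd] at e e' s s'
    simp only [e, s, map_mul, map_inv, e', s', ht_succ]
    group
  · rw [ht_of_ne h1 h2, ht_of_ne h2 h3, ht_of_ne h1 h2, ht_of_ne h2 h3]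

theorem ht_comm {i j : ℕ} (h : i + 2 ≤ j) : ht i * ht j = ht j * ht i := by
  apply mulAut_ext
  intro k
  simp only [MulAut.mul_apply]
  by_cases h1 : k = i
  · subst h1
    rw [ht_of_ne (i := j) (by omega) (by omega), ht_self, ht_of_ne (by omega) (by omega)]
  by_cases h2 : k = i + 1
  · subst h2
    rw [ht_of_ne (i := j) (by omega) (by omega), ht_succ]
    simp only [map_mul, map_inv, ht_of_ne (i := j) (k := i) (by omega) (by omega),
      ht_of_ne (i := j) (k := i + 1) (by omega) (by omega)]
  rw [ht_of_ne (i := i) h1 h2]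
  by_cases h3 : k = j
  · subst h3
    rw [ht_self, ht_of_ne (by omega) (by omega)]
  by_cases h4 : k = j + 1
  · subst h4
    rw [ht_succ]
    simp only [map_mul, map_inv, ht_of_ne (i := i) (k := j) (by omega) (by omega),
      ht_of_ne (i := i) (k := j + 1) (by omega) (by omega)]
  · rw [ht_of_ne h3 h4, ht_of_ne h1 h2]

theorem conj_map {G : Type*} [Group G] (f : MulAut G) (x : G) :
    f * MulAut.conj x * f⁻¹ = MulAut.conj (f x) := by
  ext y
  simp [MulAut.mul_apply, MulAut.conj_apply]

/-- Images of the generators in the automorphism group of the free group. -/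
def actGen (n i : ℕ) : MulAut (FreeGroup ℕ) := if i + 1 < n then ht i else MulAut.conj (of i)

theorem ht_conj_comm {i j : ℕ} (h : i + 2 ≤ j) :
    ht i * MulAut.conj (of j) = MulAut.conj (of j) * ht i := by
  have := conj_map (ht i) (of j)
  rw [ht_of_ne (by omega) (by omega), mul_inv_eq_iff_eq_mul] at this
  exact this

/-- The action of `A[Bₙ]` on the free group. -/
def act (n : ℕ) : ArtinB n →* MulAut (FreeGroup ℕ) :=
  ArtinB.lift n (actGen n)
    (by
      intro i hi
      simp only [actGen, if_pos (show i + 1 < n by omega), if_pos (show i + 1 + 1 < n by omega)]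
      exact ht_braid i)
    (by
      intro i hi
      simp only [actGen, if_pos (show i + 1 < n by omega), if_neg (show ¬ i + 1 + 1 < n by omega)]
      apply mulAut_ext
      intro k
      simp only [MulAut.mul_apply, MulAut.conj_apply]
      by_cases h1 : k = i
      · subst h1
        simp only [map_mul, map_inv, ht_succ, ht_self]; group
      by_cases h2 : k = i + 1
      · subst h2
        simp only [map_mul, map_inv, ht_succ, ht_self]; group
      simp only [map_mul, map_inv, ht_succ, ht_self, ht_of_ne h1 h2]
      group)
    (by
      intro i j h1 h2
      simp only [actGen, if_pos (show i + 1 < n by omega)]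
      split
      · exact ht_comm h1
      · exact ht_conj_comm h1)

theorem act_sB {n i : ℕ} (h : i + 1 < n) : act n (sB n i) = ht i := by
  rw [act, ArtinB.lift_sB (by omega), actGen, if_pos h]

theorem act_sB_last {n i : ℕ} (h : i + 1 = n) : act n (sB n i) = MulAut.conj (of i) := by
  rw [act, ArtinB.lift_sB (by omega), actGen, if_neg (by omega)]

/-- Auxiliary descending recursion for `X`. -/
def Xaux (n : ℕ) : ℕ → ArtinB n
  | 0 => sB n (n - 1)
  | d + 1 => (sB n (n - 2 - d))⁻¹ * Xaux n d * sB n (n - 2 - d)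

/-- The free generators `X_i` of the kernel of `A[Bₙ] → A[A_{n-1}]`. -/
def X (n i : ℕ) : ArtinB n := if i < n then Xaux n (n - 1 - i) else 1

theorem X_of_le {n i : ℕ} (h : n ≤ i) : X n i = 1 := by simp [X, h]

theorem X_last {n i : ℕ} (h : i + 1 = n) : X n i = sB n i := by
  subst h; simp [X, Xaux]

theorem X_eq {n i : ℕ} (h : i + 1 < n) : X n i = (sB n i)⁻¹ * X n (i + 1) * sB n i := by
  rw [X, X, if_pos (by omega), if_pos h, show n - 1 - i = (n - 1 - (i + 1)) + 1 by omega, Xaux,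
    show n - 2 - (n - 1 - (i + 1)) = i by omega]

/-- Descending induction below `n`. -/
theorem desc_induction {n : ℕ} {P : ℕ → Prop} (h0 : ∀ i, i + 1 = n → P i)
    (h1 : ∀ i, i + 1 < n → P (i + 1) → P i) : ∀ i, i < n → P i := by
  intro i hi
  obtain ⟨d, hd⟩ : ∃ d, i + 1 + d = n := ⟨n - i - 1, by omega⟩
  induction d generalizing i with
  | zero => exact h0 i hd
  | succ d ih => exact h1 i (by omega) (ih (i + 1) (by omega) (by omega))

theorem sB_conj_X {n i : ℕ} (h : i + 1 < n) : sB n i * X n i * (sB n i)⁻¹ = X n (i + 1) := by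
  rw [X_eq h]; group

theorem sB_comm_X_of_lt {n i k : ℕ} (h : i + 2 ≤ k) (hk : k < n) :
    Commute (sB n i) (X n k) := by
  revert h
  refine desc_induction (n := n) (P := fun k => i + 2 ≤ k → Commute (sB n i) (X n k))
    ?_ ?_ k hk
  · intro k hk h
    rw [X_last hk]; exact sB_comm h
  · intro k hk ih h
    rw [X_eq hk]
    have := sB_comm (n := n) h
    exact (this.inv_right.mul_right (ih (by omega))).mul_right this

theorem sB_comm_X_of_gt {n i k : ℕ} (h : k < i) (hi : i + 1 < n) :
    Commute (sB n i) (X n k) := by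
  refine desc_induction (n := i) (P := fun k => Commute (sB n i) (X n k)) ?_ ?_ k h
  · rintro k rfl
    rw [X_eq (show k + 1 < n by omega), X_eq hi]
    have h1 := sB_comm_X_of_lt (show k + 2 ≤ k + 1 + 1 by omega) hi
    have h2 := sB_braid (show k + 2 < n by omega)
    generalize X n (k + 1 + 1) = x at *
    generalize sB n k = a at *
    generalize sB n (k + 1) = b at *
    have h3 : b * (a⁻¹ * b⁻¹) = a⁻¹ * b⁻¹ * a := by
      rw [← mul_assoc, mul_inv_eq_iff_eq_mul, eq_comm, mul_assoc, mul_assoc, inv_mul_eq_iff_eq_mul,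
        inv_mul_eq_iff_eq_mul]
      rw [← mul_assoc, ← mul_assoc] at *
      rw [eq_mul_inv_iff_mul_eq, h2]
    have h4 : (b * a) * b = a * (b * a) := by rw [← h2]; group
    show b * (a⁻¹ * (b⁻¹ * x * b) * a) = (a⁻¹ * (b⁻¹ * x * b) * a) * b
    calc b * (a⁻¹ * (b⁻¹ * x * b) * a) = (b * (a⁻¹ * b⁻¹)) * x * (b * a) := by group
      _ = a⁻¹ * b⁻¹ * (a * x) * (b * a) := by rw [h3]; group
      _ = a⁻¹ * b⁻¹ * x * (a * (b * a)) := by rw [h1.eq]; group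
      _ = _ := by rw [← h4]; group
  · intro k hk ih
    rw [X_eq (by omega)]
    have := (sB_comm (n := n) (show k + 2 ≤ i by omega)).symm
    exact (this.inv_right.mul_right ih).mul_right this

theorem four_X {n i : ℕ} (h : i + 1 < n) : sB n i * X n (i + 1) * sB n i * X n (i + 1) =
    X n (i + 1) * sB n i * X n (i + 1) * sB n i := by
  have : ∀ i, i < n - 1 → sB n i * X n (i + 1) * sB n i * X n (i + 1) =
    X n (i + 1) * sB n i * X n (i + 1) * sB n i := by
    apply desc_induction
    · intro i hi
      rw [X_last (show i + 1 + 1 = n by omega)]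
      exact sB_four (by omega)
    · intro i hi ih
      have h1 := sB_comm_X_of_lt (show i + 2 ≤ i + 1 + 1 by omega) (show i + 1 + 1 < n by omega)
      have h2 := sB_braid (show i + 2 < n by omega)
      rw [X_eq (show i + 1 + 1 < n by omega)]
      generalize X n (i + 1 + 1) = x at *
      generalize sB n i = a at *
      generalize sB n (i + 1) = b at *
      have e1 : b⁻¹ * x * b = (a * b)⁻¹ * x * (a * b) := by
        have : a⁻¹ * x * a = x := by rw [mul_assoc, ← h1.eq]; group
        calc b⁻¹ * x * b = b⁻¹ * (a⁻¹ * x * a) * b := by rw [this]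
          _ = _ := by group
      have e2 : a = (a * b)⁻¹ * b * (a * b) := by
        rw [eq_comm, mul_assoc, inv_mul_eq_iff_eq_mul, h2, mul_assoc]
      generalize a * b = w at *
      rw [e1, e2]
      have := congrArg (fun y => w⁻¹ * y * w) ih
      convert this using 1 <;> group
  exact this i (by omega)

theorem sB_conj_X_succ {n i : ℕ} (h : i + 1 < n) :
    sB n i * X n (i + 1) * (sB n i)⁻¹ = (X n (i + 1))⁻¹ * X n i * X n (i + 1) := by
  have := four_X h
  rw [X_eq h]
  generalize X n (i + 1) = x at *
  generalize sB n i = s at *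
  rw [mul_inv_eq_iff_eq_mul]
  calc s * x = x⁻¹ * s⁻¹ * (s * x * s * x) := by group
    _ = _ := by rw [this]; group

end Braid

namespace Braid
open FreeGroup (of mulAut_ext)

/-- Induction on group elements from generators. -/
theorem sB_induction {n : ℕ} {P : ArtinB n → Prop} (h1 : P 1) (hs : ∀ i, i < n → P (sB n i))
    (hm : ∀ g h, P g → P h → P (g * h)) (hi : ∀ g, P g → P g⁻¹) (g : ArtinB n) : P g :=
  ArtinB.closure_eq_top
    (K := { carrier := {g | P g}, mul_mem' := fun {a b} => hm a b, one_mem' := h1,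
            inv_mem' := fun {a} => hi a }) hs g

/-- The embedding of the free group. -/
def Xh (n : ℕ) : FreeGroup ℕ →* ArtinB n := FreeGroup.lift (X n)

@[simp] theorem Xh_of (n i : ℕ) : Xh n (of i) = X n i := FreeGroup.lift_apply_of

theorem sB_conj_Xh {n i : ℕ} (hi : i < n) (f : FreeGroup ℕ) :
    sB n i * Xh n f * (sB n i)⁻¹ = Xh n (act n (sB n i) f) := by
  have : ((MulAut.conj (sB n i)).toMonoidHom.comp (Xh n)) =
      (Xh n).comp (act n (sB n i)).toMonoidHom := by
    apply FreeGroup.ext_hom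
    intro k
    simp only [MonoidHom.comp_apply, MulEquiv.toMonoidHom_eq_coe, MonoidHom.coe_coe,
      MulAut.conj_apply, Xh_of]
    by_cases hin : i + 1 < n
    · rw [act_sB hin]
      by_cases h1 : k = i
      · subst h1; rw [ht_self, Xh_of, sB_conj_X hin]
      by_cases h2 : k = i + 1
      · subst h2; rw [ht_succ, sB_conj_X_succ hin]; simp
      rw [ht_of_ne h1 h2, Xh_of]
      by_cases hk : k < n
      · have : Commute (sB n i) (X n k) := by
          rcases lt_or_gt_of_ne h1 with h | h
          · exact sB_comm_X_of_gt h hin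
          · exact sB_comm_X_of_lt (by omega) hk
        rw [this.eq]; group
      · rw [X_of_le (by omega)]; group
    · rw [act_sB_last (by omega), MulAut.conj_apply]
      simp [X_last (show i + 1 = n by omega)]
  exact DFunLike.congr_fun this f

theorem conj_Xh {n : ℕ} (g : ArtinB n) (f : FreeGroup ℕ) :
    g * Xh n f * g⁻¹ = Xh n (act n g f) := by
  revert f
  refine sB_induction (P := fun g => ∀ f, g * Xh n f * g⁻¹ = Xh n (act n g f)) ?_ ?_ ?_ ?_ g
  · intro f; simp
  · intro i hi f; exact sB_conj_Xh hi f
  · intro g h hg hh f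
    rw [map_mul, MulAut.mul_apply, ← hg, ← hh]; group
  · intro g hg f
    have := hg (act n g⁻¹ f)
    rw [← MulAut.mul_apply, ← map_mul, mul_inv_cancel, map_one, MulAut.one_apply] at this
    rw [← this]; group

/-- Kill the letters that are at least `n`. -/
def kap (n : ℕ) : FreeGroup ℕ →* FreeGroup ℕ := FreeGroup.lift fun i => if i < n then of i else 1

theorem kap_of_lt {n i : ℕ} (h : i < n) : kap n (of i) = of i := by simp [kap, h]
theorem kap_of_le {n i : ℕ} (h : n ≤ i) : kap n (of i) = 1 := by simp [kap, h]

theorem kap_act {n : ℕ} (g : ArtinB n) (f : FreeGroup ℕ) :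
    kap n (act n g f) = act n g (kap n f) := by
  revert f
  refine sB_induction (P := fun g => ∀ f, kap n (act n g f) = act n g (kap n f)) ?_ ?_ ?_ ?_ g
  · intro f; simp
  · intro i hi f
    have : (kap n).comp (act n (sB n i)).toMonoidHom =
        (act n (sB n i)).toMonoidHom.comp (kap n) := by
      apply FreeGroup.ext_hom
      intro k
      simp only [MonoidHom.comp_apply, MulEquiv.toMonoidHom_eq_coe, MonoidHom.coe_coe]
      by_cases hin : i + 1 < n
      · rw [act_sB hin]
        by_cases h1 : k = i
        · subst h1; rw [kap_of_lt hi, ht_self, kap_of_lt hin]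
        by_cases h2 : k = i + 1
        · subst h2; rw [kap_of_lt hin, ht_succ]
          simp [kap_of_lt hi, kap_of_lt hin]
        rw [ht_of_ne h1 h2]
        by_cases hk : k < n
        · rw [kap_of_lt hk, ht_of_ne h1 h2]
        · rw [kap_of_le (by omega), map_one]
      · rw [act_sB_last (by omega), MulAut.conj_apply, MulAut.conj_apply]
        simp [kap_of_lt hi]
    exact DFunLike.congr_fun this f
  · intro g h hg hh f
    rw [map_mul, MulAut.mul_apply, MulAut.mul_apply, hg, hh]
  · intro g hg f
    have := hg (act n g⁻¹ f)
    rw [← MulAut.mul_apply, ← map_mul, mul_inv_cancel, map_one, MulAut.one_apply] at this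
    rw [this, ← MulAut.mul_apply, ← map_mul, inv_mul_cancel, map_one, MulAut.one_apply]

theorem Xh_kap {n : ℕ} (f : FreeGroup ℕ) : Xh n (kap n f) = Xh n f := by
  have : (Xh n).comp (kap n) = Xh n := by
    apply FreeGroup.ext_hom
    intro k
    rw [MonoidHom.comp_apply]
    by_cases hk : k < n
    · rw [kap_of_lt hk]
    · rw [kap_of_le (by omega), Xh_of, X_of_le (by omega), map_one]
  exact DFunLike.congr_fun this f

theorem kap_kap {n : ℕ} (f : FreeGroup ℕ) : kap n (kap n f) = kap n f := by
  have : (kap n).comp (kap n) = kap n := by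
    apply FreeGroup.ext_hom
    intro k
    rw [MonoidHom.comp_apply]
    by_cases hk : k < n
    · rw [kap_of_lt hk, kap_of_lt hk]
    · rw [kap_of_le (by omega), map_one]
  exact DFunLike.congr_fun this f

theorem act_X {n i : ℕ} (hi : i < n) : act n (X n i) = MulAut.conj (of i) := by
  refine desc_induction (n := n) (P := fun i => act n (X n i) = MulAut.conj (of i)) ?_ ?_ i hi
  · intro i hi; rw [X_last hi, act_sB_last hi]
  · intro i hi ih
    rw [X_eq hi, map_mul, map_mul, map_inv, ih, act_sB hi]
    have := conj_map (ht i)⁻¹ (of (i + 1))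
    rw [inv_inv, ← ht_self i, MulAut.inv_apply_self] at this
    rw [← this]
    rw [ht_self]

theorem act_Xh {n : ℕ} (f : FreeGroup ℕ) : act n (Xh n f) = MulAut.conj (kap n f) := by
  have : (act n).comp (Xh n) = MulAut.conj.comp (kap n) := by
    apply FreeGroup.ext_hom
    intro k
    simp only [MonoidHom.comp_apply, Xh_of]
    by_cases hk : k < n
    · rw [act_X hk, kap_of_lt hk]
    · rw [X_of_le (by omega), kap_of_le (by omega), map_one, map_one]
  exact DFunLike.congr_fun this f

theorem eq_one_of_central {f : FreeGroup ℕ} (h : ∀ g, Commute f g) : f = 1 := by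
  obtain ⟨i, hi⟩ := FreeGroup.mem_zpowers_of_commute (h (of 0)).symm
  obtain ⟨j, hj⟩ := FreeGroup.mem_zpowers_of_commute (h (of 1)).symm
  simp only at hi hj
  have h2 := congrArg (FreeGroup.lift (fun x => if x = 0 then Multiplicative.ofAdd (1:ℤ) else 1))
    (hi.trans hj.symm)
  rw [map_zpow, map_zpow] at h2
  simp only [FreeGroup.lift_apply_of, if_true, one_ne_zero, if_false, one_zpow] at h2
  rw [← ofAdd_zsmul] at h2
  have h3 : i = 0 := by simpa using h2
  rw [← hi, h3, zpow_zero]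

theorem kap_eq_one_of_Xh {n : ℕ} {f : FreeGroup ℕ} (h : Xh n f = 1) : kap n f = 1 := by
  have h1 := act_Xh (n := n) f
  rw [h, map_one] at h1
  apply eq_one_of_central
  intro g
  have := DFunLike.congr_fun h1 g
  rw [MulAut.one_apply, MulAut.conj_apply] at this
  rw [commute_iff_eq]
  nth_rw 2 [this]
  group

theorem kap_eq_of_Xh_eq {n : ℕ} {f g : FreeGroup ℕ} (h : Xh n f = Xh n g) : kap n f = kap n g := by
  have := kap_eq_one_of_Xh (n := n) (f := f * g⁻¹) (by rw [map_mul, map_inv, h, mul_inv_cancel])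
  rwa [map_mul, map_inv, mul_inv_eq_one] at this

/-- The retraction killing the last generator. -/
def eB (n : ℕ) : ArtinB n →* ArtinB n :=
  ArtinB.lift n (fun i => if i + 1 < n then sB n i else 1)
    (by
      intro i hi
      simp only [if_pos (show i + 1 < n by omega), if_pos (show i + 1 + 1 < n by omega)]
      exact sB_braid hi)
    (by
      intro i hi
      simp only [if_neg (show ¬ i + 1 + 1 < n by omega)]; group)
    (by
      intro i j h1 h2
      split <;> split
      · exact (sB_comm h1).eq
      all_goals simp)

theorem eB_sB {n i : ℕ} (h : i + 1 < n) : eB n (sB n i) = sB n i := by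
  rw [eB, ArtinB.lift_sB (by omega), if_pos h]

theorem eB_last {n i : ℕ} (h : i + 1 = n) : eB n (sB n i) = 1 := by
  rw [eB, ArtinB.lift_sB (by omega), if_neg (by omega)]

theorem eB_X (n i : ℕ) : eB n (X n i) = 1 := by
  by_cases hi : i < n
  · refine desc_induction (n := n) (P := fun i => eB n (X n i) = 1) ?_ ?_ i hi
    · intro i hi; rw [X_last hi, eB_last hi]
    · intro i hi ih
      rw [X_eq hi, map_mul, map_mul, ih, map_inv]; group
  · rw [X_of_le (by omega), map_one]

theorem eB_Xh {n : ℕ} (f : FreeGroup ℕ) : eB n (Xh n f) = 1 := by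
  have : (eB n).comp (Xh n) = 1 := by
    apply FreeGroup.ext_hom
    intro k
    simp [eB_X]
  exact DFunLike.congr_fun this f

theorem eB_eB {n : ℕ} (g : ArtinB n) : eB n (eB n g) = eB n g := by
  have : (eB n).comp (eB n) = eB n := by
    apply ArtinB.hom_ext
    intro i hi
    rw [MonoidHom.comp_apply]
    by_cases h : i + 1 < n
    · rw [eB_sB h, eB_sB h]
    · rw [eB_last (by omega), map_one]
  exact DFunLike.congr_fun this g

/-- Semidirect product decomposition. -/
theorem exists_Xh_mul_eB {n : ℕ} (g : ArtinB n) : ∃ f, kap n f = f ∧ g = Xh n f * eB n g := by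
  suffices h : ∃ f, g = Xh n f * eB n g by
    obtain ⟨f, hf⟩ := h
    exact ⟨kap n f, kap_kap f, by rw [Xh_kap]; exact hf⟩
  refine sB_induction (P := fun g => ∃ f, g = Xh n f * eB n g) ⟨1, by simp⟩ ?_ ?_ ?_ g
  · intro i hi
    by_cases h : i + 1 < n
    · exact ⟨1, by rw [eB_sB h]; simp⟩
    · exact ⟨of i, by rw [eB_last (by omega), Xh_of, X_last (by omega), mul_one]⟩
  · rintro g h ⟨f, hf⟩ ⟨f', hf'⟩
    refine ⟨f * act n (eB n g) f', ?_⟩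
    rw [map_mul, ← conj_Xh, map_mul]
    nth_rw 1 [hf, hf']
    group
  · rintro g ⟨f, hf⟩
    refine ⟨act n (eB n g)⁻¹ f⁻¹, ?_⟩
    rw [← conj_Xh, map_inv, map_inv]
    nth_rw 1 [hf]
    group

/-- Elements of the kernel of `eB`. -/
theorem exists_Xh_of_eB_eq_one {n : ℕ} {g : ArtinB n} (h : eB n g = 1) :
    ∃ f, kap n f = f ∧ g = Xh n f := by
  obtain ⟨f, h1, h2⟩ := exists_Xh_mul_eB g
  exact ⟨f, h1, by rw [h2, h, mul_one]⟩

/-- Prefix products of the letters. -/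
def D (k : ℕ) : FreeGroup ℕ := ((List.range k).map fun i => of i).prod

@[simp] theorem D_zero : D 0 = 1 := rfl
theorem D_succ (k : ℕ) : D (k + 1) = D k * of k := by
  simp [D, List.range_succ]

/-- Prefix products of the generators. -/
def pr (n k : ℕ) : ArtinB n := ((List.range k).map (sB n)).prod

@[simp] theorem pr_zero (n : ℕ) : pr n 0 = 1 := rfl
theorem pr_succ (n k : ℕ) : pr n (k + 1) = pr n k * sB n k := by
  simp [pr, List.range_succ]

theorem rhoB_eq (n : ℕ) : ρB n = pr n n := rfl

theorem ht_D {i k : ℕ} (h : i + 1 ≠ k) : ht i (D k) = D k := by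
  induction k with
  | zero => simp
  | succ k ih =>
    by_cases h2 : k = i + 1
    · subst h2
      rw [D_succ, D_succ]
      have : ∀ j, j ≤ i → ht i (D j) = D j := by
        intro j hj
        induction j with
        | zero => simp
        | succ j ih => rw [D_succ, map_mul, ih (by omega), ht_of_ne (by omega) (by omega)]
      rw [map_mul, map_mul, this i le_rfl, ht_self, ht_succ]
      group
    · rw [D_succ, map_mul, ih (by omega), ht_of_ne (by omega) h2]

theorem act_eB_D {n : ℕ} (g : ArtinB n) : act n (eB n g) (D n) = D n := by
  refine sB_induction (P := fun g => act n (eB n g) (D n) = D n) (by simp) ?_ ?_ ?_ g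
  · intro i hi
    by_cases h : i + 1 < n
    · rw [eB_sB h, act_sB h, ht_D (by omega)]
    · rw [eB_last (by omega)]; simp
  · intro g h hg hh
    rw [map_mul, map_mul, MulAut.mul_apply, hh, hg]
  · intro g hg
    rw [map_inv, map_inv]
    nth_rw 1 [← hg]
    rw [MulAut.inv_apply_self]

theorem act_pr_D {n k m : ℕ} (hk : k < n) (hm : k < m) : act n (pr n k) (D m) = D m := by
  induction k with
  | zero => simp
  | succ k ih =>
    rw [pr_succ, map_mul, MulAut.mul_apply, act_sB hk, ht_D (by omega), ih (by omega) (by omega)]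

theorem act_pr_of_gt {n k i : ℕ} (hk : k < n) (hi : k < i) : act n (pr n k) (of i) = of i := by
  induction k with
  | zero => simp
  | succ k ih =>
    rw [pr_succ, map_mul, MulAut.mul_apply, act_sB hk, ht_of_ne (by omega) (by omega),
      ih (by omega) (by omega)]

theorem act_pr_of_lt {n k i : ℕ} (hk : k < n) (hi : i < k) :
    act n (pr n k) (of i) = of (i + 1) := by
  induction k with
  | zero => omega
  | succ k ih =>
    rw [pr_succ, map_mul, MulAut.mul_apply, act_sB hk]
    by_cases h : i = k
    · subst h; rw [ht_self, act_pr_of_gt (by omega) (by omega)]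
    · rw [ht_of_ne h (by omega), ih (by omega) (by omega)]

theorem act_pr_self {n k : ℕ} (hk : k < n) :
    act n (pr n k) (of k) = (D (k + 1))⁻¹ * of 0 * D (k + 1) := by
  have h1 := act_pr_D (m := k + 1) hk (by omega)
  have h2 : ∀ j, j ≤ k → of 0 * act n (pr n k) (D j) = D (j + 1) := by
    intro j hj
    induction j with
    | zero => simp [D_succ]
    | succ j ih =>
      rw [D_succ j, map_mul, ← mul_assoc, ih (by omega), act_pr_of_lt hk (by omega), ← D_succ]
  rw [D_succ, map_mul] at h1
  have h3 := h2 k le_rfl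
  have h4 : act n (pr n k) (D k) = (of 0)⁻¹ * D (k + 1) := by rw [← h3]; group
  rw [h4, ← D_succ] at h1
  calc act n (pr n k) (of k) = (D (k + 1))⁻¹ * of 0 *
        ((of 0)⁻¹ * D (k + 1) * act n (pr n k) (of k)) := by group
    _ = _ := by rw [h1]

theorem act_pr_pow {n k : ℕ} (hk : k < n) {i : ℕ} (hi : i < k + 1) {j : ℕ} (hj : j ≤ k + 1) :
    act n (pr n k ^ j) (of i) = if i + j < k + 1 then of (i + j) else
      (D (k + 1))⁻¹ * of (i + j - (k + 1)) * D (k + 1) := by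
  induction j with
  | zero => simp [hi]
  | succ j ih =>
    rw [pow_succ', map_mul, MulAut.mul_apply, ih (by omega)]
    by_cases h1 : i + j < k + 1
    · rw [if_pos h1]
      by_cases h2 : i + j < k
      · rw [act_pr_of_lt hk h2, if_pos (by omega)]; rfl
      · have h3 : i + j = k := by omega
        rw [h3, act_pr_self hk, if_neg (by omega), show i + (j + 1) - (k + 1) = 0 by omega]
    · rw [if_neg h1, if_neg (by omega)]
      simp only [map_mul, map_inv]
      rw [act_pr_D hk (by omega), act_pr_of_lt hk (by omega),
        show i + j - (k + 1) + 1 = i + (j + 1) - (k + 1) by omega]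

/-- The full twist on the first `k + 1` strands. -/
theorem act_twist {n k : ℕ} (hk : k < n) {i : ℕ} (hi : i < k + 1) :
    act n (pr n k ^ (k + 1)) (of i) = (D (k + 1))⁻¹ * of i * D (k + 1) := by
  rw [act_pr_pow hk hi le_rfl, if_neg (by omega), Nat.add_sub_cancel]

theorem act_pr_pow_of_gt {n k i : ℕ} (hk : k < n) (hi : k < i) (j : ℕ) :
    act n (pr n k ^ j) (of i) = of i := by
  induction j with
  | zero => simp
  | succ j ih => rw [pow_succ', map_mul, MulAut.mul_apply, ih, act_pr_of_gt hk hi]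

theorem pr_shift {n k i : ℕ} (hi : i + 1 < k) (hk : k < n) :
    pr n k * sB n i = sB n (i + 1) * pr n k := by
  obtain ⟨d, rfl⟩ : ∃ d, k = i + 2 + d := ⟨k - (i + 2), by omega⟩
  clear hi
  have hc : ∀ m, m ≤ i → Commute (pr n m) (sB n (i + 1)) := by
    intro m hm
    induction m with
    | zero => exact Commute.one_left _
    | succ m ih =>
      rw [pr_succ]; exact (ih (by omega)).mul_left (sB_comm (by omega))
  induction d with
  | zero =>
    have hb := sB_braid (show i + 2 < n by omega)
    have := hc i le_rfl
    rw [Nat.add_zero, pr_succ, pr_succ]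
    calc pr n i * sB n i * sB n (i + 1) * sB n i
        = pr n i * (sB n i * sB n (i + 1) * sB n i) := by group
      _ = (pr n i * sB n (i + 1)) * sB n i * sB n (i + 1) := by rw [hb]; simp only [mul_assoc]
      _ = _ := by rw [this.eq]; simp only [mul_assoc]
  | succ d ih =>
    rw [← add_assoc, pr_succ, mul_assoc, ← (sB_comm (show i + 2 ≤ i + 2 + d by omega)).eq,
      ← mul_assoc, ih (by omega), mul_assoc]

theorem rho_shift {n i : ℕ} (hi : i + 2 < n) : ρB n * sB n i = sB n (i + 1) * ρB n := by
  obtain ⟨m, rfl⟩ : ∃ m, n = m + 1 := ⟨n - 1, by omega⟩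
  rw [rhoB_eq, pr_succ, mul_assoc, ← (sB_comm (show i + 2 ≤ m by omega)).eq,
    ← mul_assoc, pr_shift (by omega) (by omega), mul_assoc]

/-- The product `s_0 ⋯ s_{n-2}`. -/
def cB (n : ℕ) : ArtinB n := pr n (n - 1)

theorem rho_eq_cB {n : ℕ} (hn : 0 < n) : ρB n = cB n * X n (n - 1) := by
  obtain ⟨m, rfl⟩ : ∃ m, n = m + 1 := ⟨n - 1, by omega⟩
  rw [rhoB_eq, pr_succ, cB, X_last (by omega)]; rfl

theorem eB_pr {n k : ℕ} (hk : k < n) : eB n (pr n k) = pr n k := by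
  induction k with
  | zero => simp
  | succ k ih => rw [pr_succ, map_mul, ih (by omega), eB_sB hk]

theorem rho_pow {n : ℕ} (hn : 0 < n) {k : ℕ} (hk : k ≤ n) :
    ρB n ^ k = Xh n ((D n)⁻¹ * D k * D n) * cB n ^ k := by
  obtain ⟨m, rfl⟩ : ∃ m, n = m + 1 := ⟨n - 1, by omega⟩
  induction k with
  | zero => simp
  | succ k ih =>
    have h1 : cB (m + 1) ^ (k + 1) * X (m + 1) m = Xh (m + 1) ((D (m + 1))⁻¹ * of k * D (m + 1)) *
        cB (m + 1) ^ (k + 1) := by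
      have := conj_Xh (cB (m + 1) ^ (k + 1)) (of m)
      rw [cB, Nat.add_sub_cancel, act_pr_pow (by omega) (by omega) (by omega),
        if_neg (by omega), show m + (k + 1) - (m + 1) = k by omega] at this
      rw [cB, Nat.add_sub_cancel, ← this, Xh_of]; group
    rw [pow_succ, ih (by omega), rho_eq_cB hn, Nat.add_sub_cancel]
    calc _ = Xh (m + 1) ((D (m + 1))⁻¹ * D k * D (m + 1)) *
          (cB (m + 1) ^ (k + 1) * X (m + 1) m) := by rw [pow_succ]; simp only [mul_assoc]
      _ = _ := by
        rw [h1, ← mul_assoc, ← map_mul, D_succ k]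
        congr 2; group

theorem Delta_eq {n : ℕ} (hn : 0 < n) : ΔB n = Xh n (D n) * cB n ^ n := by
  rw [ΔB, rho_pow hn le_rfl]; congr 2; group

theorem eB_cB {n : ℕ} (hn : 0 < n) : eB n (cB n) = cB n := eB_pr (by omega)

theorem act_cB_pow {n i : ℕ} (hi : i < n) :
    act n (cB n ^ n) (of i) = (D n)⁻¹ * of i * D n := by
  obtain ⟨m, rfl⟩ : ∃ m, n = m + 1 := ⟨n - 1, by omega⟩
  exact act_twist (by omega) hi

theorem kap_D {n k : ℕ} (h : k ≤ n) : kap n (D k) = D k := by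
  induction k with
  | zero => simp
  | succ k ih => rw [D_succ, map_mul, ih (by omega), kap_of_lt (by omega)]

theorem act_Delta {n i : ℕ} (hi : i < n) : act n (ΔB n) (of i) = of i := by
  rw [Delta_eq (by omega), map_mul, MulAut.mul_apply, act_cB_pow hi, act_Xh, kap_D le_rfl,
    MulAut.conj_apply]
  group

/-- Elements of `B` act trivially on large letters. -/
theorem act_eB_of_le {n i : ℕ} (hi : n ≤ i) (g : ArtinB n) : act n (eB n g) (of i) = of i := by
  refine sB_induction (P := fun g => act n (eB n g) (of i) = of i) (by simp) ?_ ?_ ?_ g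
  · intro k hk
    by_cases h : k + 1 < n
    · rw [eB_sB h, act_sB h, ht_of_ne (by omega) (by omega)]
    · rw [eB_last (by omega)]; simp
  · intro g h hg hh
    rw [map_mul, map_mul, MulAut.mul_apply, hh, hg]
  · intro g hg
    rw [map_inv, map_inv]
    nth_rw 1 [← hg]
    rw [MulAut.inv_apply_self]

end Braid

namespace FreeGroup
variable {α : Type*} [DecidableEq α]

theorem exists_cancel (y z : FreeGroup α) : ∃ y₁ c z₁, y = y₁ * c ∧ z = c⁻¹ * z₁ ∧
    NC y₁ c ∧ NC c⁻¹ z₁ ∧ NC y₁ z₁ := by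
  induction hN : norm y using Nat.strong_induction_on generalizing y z with
  | _ N ih =>
  by_cases h : NC y z
  · exact ⟨y, 1, z, by simp, by simp, nc_one_right _, by simpa using nc_one_left z, h⟩
  · have hy : y ≠ 1 := by rintro rfl; exact h (nc_one_left z)
    obtain ⟨l, y', rfl, hy'⟩ := exists_last hy
    rcases nc_or_cancel l z with h1 | ⟨z', rfl, hz'⟩
    · exact absurd (hy'.mul_left h1 (lt_ne_one l)) h
    · obtain ⟨y₁, c, z₁, rfl, rfl, h1, h2, h3⟩ := ih (norm y')
        (by rw [← hN, hy'.norm_eq, norm_lt]; omega) y' z' rfl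
      refine ⟨y₁, c * lt l, z₁, by group, by group, ?_, ?_, h3⟩
      · by_cases hc : c = 1
        · subst hc; simpa using hy'
        · exact h1.mul_right (hy'.of_mul_left h1) hc
      · rw [mul_inv_rev]
        by_cases hc : c = 1
        · subst hc; simpa using hz'
        · exact (hz'.of_mul_right h2).mul_left h2 (by simpa using hc)

theorem exists_of_not_nc {l : α × Bool} {y z : FreeGroup α} (h : NC (lt l) y)
    (h' : ¬ NC (lt l) (y * z)) : norm (y⁻¹ * lt l * y * z) < norm z := by
  obtain ⟨y₁, c, z₁, rfl, rfl, h1, h2, h3⟩ := exists_cancel y z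
  have hy : y₁ = 1 := by
    by_contra hy
    exact h' (by simpa [mul_assoc] using (h.of_mul_right h1).mul_right h3 hy)
  subst hy
  rcases nc_or_cancel l z₁ with h4 | ⟨r, rfl, hr⟩
  · exact absurd (by simpa [mul_assoc] using h4) h'
  · have e1 := h2.norm_eq
    have e2 := hr.norm_eq
    have e3 := norm_mul_le c⁻¹ r
    have e4 : norm (lt l)⁻¹ = 1 := by rw [norm_inv_eq, norm_lt]
    have : (1 * c)⁻¹ * lt l * (1 * c) * (c⁻¹ * ((lt l)⁻¹ * r)) = c⁻¹ * r := by group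
    rw [this]; omega

end FreeGroup

namespace Braid
open FreeGroup (of norm NC lt nc_or_cancel nc_or_cancel_right exists_of_not_nc)

theorem ht_inv_self (i : ℕ) : (ht i)⁻¹ (of i) = of i * of (i + 1) * (of i)⁻¹ := htB_self i
theorem ht_inv_succ (i : ℕ) : (ht i)⁻¹ (of (i + 1)) = of i := htB_succ i
theorem ht_inv_of_ne {i k : ℕ} (h : k ≠ i) (h' : k ≠ i + 1) : (ht i)⁻¹ (of k) = of k :=
  htB_of_ne h h'

theorem norm_D_le (n : ℕ) : norm (D n) ≤ n := by
  induction n with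
  | zero => simp
  | succ n ih =>
    rw [D_succ]
    refine (FreeGroup.norm_mul_le _ _).trans ?_
    rw [FreeGroup.norm_of]; omega

theorem eq_id_of_prod {n : ℕ} {π : ℕ → ℕ}
    (h : ((List.range n).map fun i => of (π i)).prod = D n) : ∀ i, i < n → π i = i := by
  have key : ∀ f : ℕ → ℕ, ((List.range n).map fun i => of (f i)).prod.toWord =
      (List.range n).map fun i => (f i, true) := by
    intro f
    have : ((List.range n).map fun i => of (f i)).prod =
        FreeGroup.mk ((List.range n).map fun i => (f i, true)) := by
      induction List.range n with
      | nil => rfl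
      | cons a L ih => rw [List.map_cons, List.prod_cons, ih, FreeGroup.of, FreeGroup.mul_mk]; rfl
    rw [this, FreeGroup.toWord_mk]
    refine FreeGroup.IsReduced.reduce_eq ?_
    exact (List.pairwise_map.2 (List.pairwise_of_forall fun _ _ _ => rfl)).isChain
  have h1 := key π
  rw [h, D, key] at h1
  intro i hi
  have := List.map_inj_left.1 h1 i (by simpa using hi)
  simpa using this.symm

theorem junction {x x' ω ω' : FreeGroup ℕ} {i j : ℕ} (hx : x = of i) (hx' : x' = of j)
    (h1 : NC x ω⁻¹) (h2 : NC x'⁻¹ ω'⁻¹)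
    (h3 : norm ω' ≤ norm (ω * x * ω⁻¹ * ω')) (h4 : norm ω ≤ norm (ω' * x'⁻¹ * ω'⁻¹ * ω)) :
    NC x (ω⁻¹ * ω' * x') ∧ NC (ω⁻¹ * ω') x' := by
  have e1 : NC x (ω⁻¹ * ω') := by
    by_contra h
    rw [hx, ← FreeGroup.lt_true] at h h1 h3
    have := exists_of_not_nc h1 h
    rw [inv_inv] at this; omega
  have e2 : NC (ω⁻¹ * ω') x' := by
    rw [← inv_inv (ω⁻¹ * ω'), ← inv_inv x']
    refine FreeGroup.NC.inv ?_
    rw [mul_inv_rev, inv_inv]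
    by_contra h
    rw [hx', ← FreeGroup.lt_false] at h h2 h4
    have := exists_of_not_nc h2 h
    rw [inv_inv] at this; omega
  refine ⟨?_, e2⟩
  by_cases h : ω⁻¹ * ω' = 1
  · rw [h, one_mul, hx, hx', ← FreeGroup.lt_true, ← FreeGroup.lt_true]
    by_cases hij : i = j
    · subst hij; exact FreeGroup.nc_lt_self _
    · exact FreeGroup.nc_lt_lt hij
  · exact e1.mul_right e2 h

theorem norm_prod_conj {n : ℕ} (ω : ℕ → FreeGroup ℕ) (π : ℕ → ℕ)
    (h1 : ∀ i, i ≤ n → NC (ω i) (of (π i)))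
    (h1' : ∀ i, i ≤ n → NC (of (π i)) (ω i)⁻¹)
    (h2 : ∀ i, i < n → NC (of (π i)) ((ω i)⁻¹ * ω (i + 1) * of (π (i + 1))) ∧
      NC ((ω i)⁻¹ * ω (i + 1)) (of (π (i + 1)))) :
    norm (((List.range (n + 1)).map fun i => ω i * of (π i) * (ω i)⁻¹).prod) =
      norm (ω 0) + (n + 1) + (∑ i ∈ Finset.range n, norm ((ω i)⁻¹ * ω (i + 1))) +
        norm (ω n) := by
  have key : ∀ k, k ≤ n → ∃ R, NC R (of (π k)) ∧
      ((List.range (k + 1)).map fun i => ω i * of (π i) * (ω i)⁻¹).prod =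
        R * of (π k) * (ω k)⁻¹ ∧ norm (R * of (π k)) =
        norm (ω 0) + (k + 1) + (∑ i ∈ Finset.range k, norm ((ω i)⁻¹ * ω (i + 1))) := by
    intro k
    induction k with
    | zero =>
      intro _
      exact ⟨ω 0, h1 0 (by omega), by simp, by rw [(h1 0 (by omega)).norm_eq]; simp⟩
    | succ k ih =>
      intro hk
      obtain ⟨R, hR, e1, e2⟩ := ih (by omega)
      obtain ⟨h3, h4⟩ := h2 k (by omega)
      have h5 : NC (R * of (π k)) ((ω k)⁻¹ * ω (k + 1) * of (π (k + 1))) :=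
        hR.mul_left h3 (FreeGroup.of_ne_one _)
      have h6 := h5.norm_eq
      rw [h4.norm_eq, FreeGroup.norm_of] at h6
      have h7 := FreeGroup.norm_mul_le (R * of (π k)) ((ω k)⁻¹ * ω (k + 1))
      have h8 := FreeGroup.norm_mul_le (R * of (π k) * ((ω k)⁻¹ * ω (k + 1))) (of (π (k + 1)))
      rw [FreeGroup.norm_of] at h8
      have e : R * of (π k) * ((ω k)⁻¹ * ω (k + 1)) * of (π (k + 1)) =
        R * of (π k) * ((ω k)⁻¹ * ω (k + 1) * of (π (k + 1))) := by group
      rw [e] at h8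
      refine ⟨R * of (π k) * ((ω k)⁻¹ * ω (k + 1)), ?_, ?_, ?_⟩
      · rw [FreeGroup.NC, e, FreeGroup.norm_of]; omega
      · rw [List.range_succ, List.map_append, List.prod_append, e1]; simp [mul_assoc]
      · rw [e, h6, e2, Finset.sum_range_succ]; omega
  obtain ⟨R, hR, e1, e2⟩ := key n le_rfl
  rw [e1, (hR.mul_left (h1' n le_rfl) (FreeGroup.of_ne_one _)).norm_eq, e2,
    FreeGroup.norm_inv_eq]

/-- A product preserving system of conjugates of free generators is a braid image of the
standard system. -/
theorem exists_braid {n : ℕ} (α : FreeGroup ℕ →* FreeGroup ℕ) (ω : ℕ → FreeGroup ℕ) (π : ℕ → ℕ)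
    (hα : ∀ i, i < n → α (of i) = ω i * of (π i) * (ω i)⁻¹) (hD : α (D n) = D n) :
    ∃ g, ∀ i, i < n → α (act n (eB n g) (of i)) = of i := by
  induction hN : ∑ i ∈ Finset.range n, norm (ω i) using Nat.strong_induction_on
    generalizing α ω π with
  | _ N ih =>
  have step : ∀ s (ω' : ℕ → FreeGroup ℕ) (π' : ℕ → ℕ),
      (∀ i, i < n → α (act n (eB n s) (of i)) = ω' i * of (π' i) * (ω' i)⁻¹) →
      ∑ i ∈ Finset.range n, norm (ω' i) < N →
      ∃ g, ∀ i, i < n → α (act n (eB n g) (of i)) = of i := by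
    intro s ω' π' h1 h2
    obtain ⟨g, hg⟩ := ih _ h2 (α.comp (act n (eB n s)).toMonoidHom) ω' π' h1
      (by simpa [act_eB_D] using hD) rfl
    refine ⟨s * g, fun i hi => ?_⟩
    simpa using hg i hi
  have upd1 : ∀ (ω : ℕ → FreeGroup ℕ) (i : ℕ) (y : FreeGroup ℕ),
      ∑ k ∈ Finset.range n, norm (ω k) = N → i < n → norm y < norm (ω i) →
      ∑ k ∈ Finset.range n, norm (Function.update ω i y k) < N := by
    intro ω i y hN hi hy
    rw [← hN]
    refine Finset.sum_lt_sum (fun k _ => ?_) ⟨i, by simpa using hi, by simpa using hy⟩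
    by_cases h : k = i
    · subst h; simpa using hy.le
    · simp [h]
  have hsw : ∀ i, i + 1 < n →
      ∑ k ∈ Finset.range n, norm ((ω ∘ Equiv.swap i (i + 1)) k) = N := by
    intro i hi
    rw [← hN]
    refine Finset.sum_equiv (Equiv.swap i (i + 1)) (fun k => ?_) (fun _ _ => rfl)
    simp only [Finset.mem_range, Equiv.swap_apply_def]
    split_ifs <;> omega
  by_contra hcon
  have hc1 : ∀ i, i < n → ∀ b, NC (ω i) (lt (π i, b)) := by
    intro i hi b
    by_contra h
    rcases nc_or_cancel_right (π i, b) (ω i) with h1 | ⟨x', hx, hx'⟩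
    · exact h h1
    · refine hcon (step 1 (Function.update ω i x') π ?_ (upd1 ω i x' hN hi ?_))
      · intro k hk
        by_cases hki : k = i
        · subst hki
          simp only [map_one, MulAut.one_apply, hα k hk, Function.update_self]
          rw [hx]
          cases b <;> simp [mul_assoc]
        · simp [hα k hk, hki]
      · rw [hx, hx'.norm_eq, FreeGroup.norm_inv_eq, FreeGroup.norm_lt]; omega
  have hc2 : ∀ i, i + 1 < n →
      norm (ω (i + 1)) ≤ norm (ω i * of (π i) * (ω i)⁻¹ * ω (i + 1)) := by
    intro i hi
    by_contra h
    refine hcon (step (sB n i)⁻¹ (Function.update (ω ∘ Equiv.swap i (i + 1)) i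
      (ω i * of (π i) * (ω i)⁻¹ * ω (i + 1))) (π ∘ Equiv.swap i (i + 1)) ?_
      (upd1 _ i _ (hsw i hi) (by omega) (by simpa using h)))
    intro k hk
    rw [map_inv, eB_sB hi, map_inv, act_sB hi]
    by_cases h1 : k = i
    · subst h1
      rw [ht_inv_self]
      simp [hα k hk, hα (k + 1) hi, mul_assoc]
    · by_cases h2 : k = i + 1
      · subst h2
        rw [ht_inv_succ]
        simp [hα i (by omega)]
      · rw [ht_inv_of_ne h1 h2, hα k hk]
        simp [h1, Equiv.swap_apply_of_ne_of_ne h1 h2]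
  have hc3 : ∀ i, i + 1 < n →
      norm (ω i) ≤ norm (ω (i + 1) * (of (π (i + 1)))⁻¹ * (ω (i + 1))⁻¹ * ω i) := by
    intro i hi
    by_contra h
    refine hcon (step (sB n i) (Function.update (ω ∘ Equiv.swap i (i + 1)) (i + 1)
      (ω (i + 1) * (of (π (i + 1)))⁻¹ * (ω (i + 1))⁻¹ * ω i)) (π ∘ Equiv.swap i (i + 1)) ?_
      (upd1 _ (i + 1) _ (hsw i hi) (by omega) (by simpa using h)))
    intro k hk
    rw [eB_sB hi, act_sB hi]
    by_cases h1 : k = i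
    · subst h1
      rw [ht_self]
      simp [hα (k + 1) hi]
    · by_cases h2 : k = i + 1
      · subst h2
        rw [ht_succ]
        simp [hα i (by omega), hα (i + 1) hk, mul_assoc]
      · rw [ht_of_ne h1 h2, hα k hk]
        simp [h2, Equiv.swap_apply_of_ne_of_ne h1 h2]
  have hc1' : ∀ i, i < n → ∀ b, NC (lt (π i, b)) (ω i)⁻¹ := by
    intro i hi b
    have := (hc1 i hi (!b)).inv
    rwa [FreeGroup.lt_inv, Bool.not_not] at this
  obtain _ | m := n
  · exact hcon ⟨1, by simp⟩
  have hj := fun i (hi : i < m) => junction (ω := ω i) (ω' := ω (i + 1)) rfl rfl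
    (hc1' i (by omega) true) (hc1' (i + 1) (by omega) false) (hc2 i (by omega)) (hc3 i (by omega))
  have hn := norm_prod_conj (n := m) ω π (fun i hi => hc1 i (by omega) true)
    (fun i hi => hc1' i (by omega) true) hj
  have hprod : ∀ k, k ≤ m + 1 →
      α (D k) = ((List.range k).map fun i => ω i * of (π i) * (ω i)⁻¹).prod := by
    intro k
    induction k with
    | zero => simp
    | succ k ih =>
      intro hk
      rw [D_succ, map_mul, ih (by omega), hα k (by omega), List.range_succ]
      simp
  rw [← hprod _ le_rfl, hD] at hn
  have hle := norm_D_le (m + 1)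
  have hω0 : ω 0 = 1 := FreeGroup.norm_eq_zero.1 (by omega)
  have hωs : ∀ i, i < m → ω i = ω (i + 1) := by
    intro i hi
    have h0 : ∑ i ∈ Finset.range m, norm ((ω i)⁻¹ * ω (i + 1)) = 0 := by omega
    have := Finset.sum_eq_zero_iff.1 h0 i (by simpa using hi)
    exact inv_mul_eq_one.1 (FreeGroup.norm_eq_zero.1 this)
  have hω : ∀ i, i < m + 1 → ω i = 1 := by
    intro i
    induction i with
    | zero => intro _; exact hω0
    | succ i ih => intro hi; rw [← hωs i (by omega), ih (by omega)]
  have hid := eq_id_of_prod (n := m + 1) (π := π) (by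
    conv_rhs => rw [← hD, hprod _ le_rfl]
    congr 1
    refine List.map_congr_left fun i hi => ?_
    rw [hω i (by simpa using hi)]; simp)
  exact hcon ⟨1, fun i hi => by simp [hα i hi, hω i hi, hid i hi]⟩

end Braid

namespace Braid
open FreeGroup (of)

/-- The exponent sum of the letter `i`. -/
def expo (i : ℕ) : FreeGroup ℕ →* Multiplicative ℤ :=
  FreeGroup.lift fun k => Multiplicative.ofAdd (if k = i then 1 else 0)

/-- The exponent sum of the letter `i`, as an integer. -/
def ex (i : ℕ) (f : FreeGroup ℕ) : ℤ := (expo i f).toAdd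

@[simp] theorem ex_one (i : ℕ) : ex i 1 = 0 := by simp [ex]
@[simp] theorem ex_mul (i : ℕ) (f g : FreeGroup ℕ) : ex i (f * g) = ex i f + ex i g := by simp [ex]
@[simp] theorem ex_inv (i : ℕ) (f : FreeGroup ℕ) : ex i f⁻¹ = - ex i f := by simp [ex]
@[simp] theorem ex_zpow (i : ℕ) (f : FreeGroup ℕ) (k : ℤ) : ex i (f ^ k) = k * ex i f := by
  simp [ex]
@[simp] theorem ex_of (i k : ℕ) : ex i (of k) = if k = i then 1 else 0 := by
  simp only [ex, expo, FreeGroup.lift_apply_of]; rfl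

theorem ex_conj (i : ℕ) (f g : FreeGroup ℕ) : ex i (f * g * f⁻¹) = ex i g := by simp

theorem ex_isConj (i : ℕ) {f g : FreeGroup ℕ} (h : IsConj f g) : ex i f = ex i g := by
  obtain ⟨c, rfl⟩ := isConj_iff.1 h
  rw [ex_conj]

theorem ex_D (i n : ℕ) : ex i (D n) = if i < n then 1 else 0 := by
  induction n with
  | zero => simp
  | succ n ih =>
    rw [D_succ, ex_mul, ih, ex_of]
    split_ifs <;> omega

theorem eq_zpow_D {n : ℕ} (hn : 0 < n) {f : FreeGroup ℕ} (h : Commute f (D n)) :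
    ∃ k : ℤ, f = D n ^ k := by
  have hD : D n ≠ 1 := by
    intro h0
    have := ex_D 0 n
    rw [h0] at this; simp [hn] at this
  obtain ⟨r, hr⟩ := FreeGroup.exists_root hD
  obtain ⟨a, ha⟩ := Subgroup.mem_zpowers_iff.1 (hr _ (Commute.refl _))
  obtain ⟨b, hb⟩ := Subgroup.mem_zpowers_iff.1 (hr _ h)
  have h1 : a * ex 0 r = 1 := by rw [← ex_zpow, ha, ex_D, if_pos hn]
  have ha2 : a * a = 1 := by
    rcases Int.isUnit_iff.1 (IsUnit.of_mul_eq_one _ h1) with h | h <;> subst h <;> rfl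
  refine ⟨a * b, ?_⟩
  rw [← ha, ← zpow_mul, ← mul_assoc, ha2, one_mul, hb]

theorem eq_one_of_commute_indep {f u v : FreeGroup ℕ} {i j : ℕ} (hu : Commute f u)
    (hv : Commute f v) (h1 : ex i u = 1) (h2 : ex j u = 0) (h4 : ex j v = 1) : f = 1 := by
  by_contra hf
  obtain ⟨r, hr⟩ := FreeGroup.exists_root hf
  obtain ⟨a, ha⟩ := Subgroup.mem_zpowers_iff.1 (hr _ hu.symm)
  obtain ⟨b, hb⟩ := Subgroup.mem_zpowers_iff.1 (hr _ hv.symm)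
  rw [← ha, ex_zpow] at h1 h2
  rw [← hb, ex_zpow] at h4
  rcases mul_eq_zero.1 h2 with h | h
  · rw [h] at h1; simp at h1
  · rw [h] at h4; simp at h4

/-- The underlying permutation of a type `B` braid. -/
def prm (n : ℕ) : ArtinB n →* Equiv.Perm ℕ :=
  ArtinB.lift n (fun i => if i + 1 < n then Equiv.swap i (i + 1) else 1)
    (by
      intro i hi
      simp only [if_pos (show i + 1 < n by omega), if_pos (show i + 1 + 1 < n by omega)]
      rw [Equiv.swap_mul_swap_mul_swap (by omega) (by omega),
        Equiv.swap_comm i (i + 1), Equiv.swap_comm (i + 1) (i + 1 + 1),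
        Equiv.swap_mul_swap_mul_swap (by omega) (by omega), Equiv.swap_comm])
    (by
      intro i hi
      simp only [if_neg (show ¬ i + 1 + 1 < n by omega)]; group)
    (by
      intro i j h1 h2
      split <;> split
      · refine (Equiv.Perm.Disjoint.commute fun k => ?_).eq
        by_cases h : k = i ∨ k = i + 1
        · right; exact Equiv.swap_apply_of_ne_of_ne (by omega) (by omega)
        · left; exact Equiv.swap_apply_of_ne_of_ne (by omega) (by omega)
      all_goals simp)

theorem prm_sB {n i : ℕ} (h : i + 1 < n) : prm n (sB n i) = Equiv.swap i (i + 1) := by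
  rw [prm, ArtinB.lift_sB (by omega), if_pos h]

theorem prm_last {n i : ℕ} (h : i + 1 = n) : prm n (sB n i) = 1 := by
  rw [prm, ArtinB.lift_sB (by omega), if_neg (by omega)]

theorem prm_of_le {n i : ℕ} (hi : n ≤ i) (g : ArtinB n) : prm n g i = i := by
  refine sB_induction (P := fun g => prm n g i = i) (by simp) ?_ ?_ ?_ g
  · intro k hk
    by_cases h : k + 1 < n
    · rw [prm_sB h, Equiv.swap_apply_of_ne_of_ne (by omega) (by omega)]
    · rw [prm_last (by omega)]; rfl
  · intro g h hg hh; simp [hg, hh]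
  · intro g hg; rw [map_inv, Equiv.Perm.inv_eq_iff_eq, hg]

theorem prm_lt {n i : ℕ} (hi : i < n) (g : ArtinB n) : prm n g i < n := by
  by_contra h
  have := prm_of_le (i := prm n g i) (by omega) g
  have := (prm n g).injective this
  omega

theorem prm_X (n i : ℕ) : prm n (X n i) = 1 := by
  by_cases hi : i < n
  · refine desc_induction (n := n) (P := fun i => prm n (X n i) = 1) ?_ ?_ i hi
    · intro i hi; rw [X_last hi, prm_last hi]
    · intro i hi ih
      rw [X_eq hi]; simp [ih]
  · rw [X_of_le (by omega), map_one]

theorem prm_Xh {n : ℕ} (f : FreeGroup ℕ) : prm n (Xh n f) = 1 := by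
  have : (prm n).comp (Xh n) = 1 := FreeGroup.ext_hom _ _ fun i => by simp [prm_X]
  exact DFunLike.congr_fun this f

theorem prm_eB {n : ℕ} (g : ArtinB n) : prm n (eB n g) = prm n g := by
  obtain ⟨f, -, hf⟩ := exists_Xh_mul_eB g
  conv_rhs => rw [hf, map_mul, prm_Xh, one_mul]

theorem act_of_conj {n : ℕ} (g : ArtinB n) (i : ℕ) :
    ∃ ω, act n g (of i) = ω * of (prm n g i) * ω⁻¹ := by
  revert i
  refine sB_induction
    (P := fun g => ∀ i, ∃ ω, act n g (of i) = ω * of (prm n g i) * ω⁻¹) ?_ ?_ ?_ ?_ g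
  · intro i; exact ⟨1, by simp⟩
  · intro k hk i
    by_cases h : k + 1 < n
    · rw [prm_sB h, act_sB h]
      by_cases h1 : i = k
      · subst h1; exact ⟨1, by simp [ht_self]⟩
      by_cases h2 : i = k + 1
      · subst h2; exact ⟨(of (k + 1))⁻¹, by simp [ht_succ]⟩
      exact ⟨1, by simp [ht_of_ne h1 h2, Equiv.swap_apply_of_ne_of_ne h1 h2]⟩
    · rw [prm_last (by omega), act_sB_last (by omega)]
      exact ⟨of k, by simp⟩
  · intro g h hg hh i
    obtain ⟨ω, hω⟩ := hh i
    obtain ⟨ω', hω'⟩ := hg (prm n h i)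
    exact ⟨act n g ω * ω', by simp [hω, hω', mul_assoc]⟩
  · intro g hg i
    obtain ⟨ω, hω⟩ := hg (prm n g⁻¹ i)
    refine ⟨(act n g⁻¹) ω⁻¹, ?_⟩
    have e : prm n g (prm n g⁻¹ i) = i := by simp
    rw [e] at hω
    have h2 : act n g⁻¹ (act n g (of (prm n g⁻¹ i))) = of (prm n g⁻¹ i) := by simp
    rw [hω] at h2
    rw [← h2]
    simp [mul_assoc]

theorem prm_eq_of_isConj {n : ℕ} {g : ArtinB n} {i j : ℕ}
    (h : IsConj (act n g (of i)) (of j)) : prm n g i = j := by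
  obtain ⟨ω, hω⟩ := act_of_conj g i
  have := ex_isConj j h
  rw [hω, ex_conj] at this
  simpa using this

/-- The cabling homomorphism turning the axis into a strand. -/
def jB (m : ℕ) : ArtinB m →* ArtinB (m + 1) :=
  ArtinB.lift m (fun i => if i + 1 < m then sB (m + 1) i else sB (m + 1) i ^ 2)
    (by
      intro i hi
      simp only [if_pos (show i + 1 < m by omega), if_pos (show i + 1 + 1 < m by omega)]
      exact sB_braid (by omega))
    (by
      intro i hi
      simp only [if_pos (show i + 1 < m by omega), if_neg (show ¬ i + 1 + 1 < m by omega)]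
      have h := sB_braid (n := m + 1) (i := i) (by omega)
      generalize sB (m + 1) i = a at *
      generalize sB (m + 1) (i + 1) = b at *
      have e1 : a * b ^ 2 * a * b ^ 2 = (a * b) ^ 3 := by
        calc _ = a * b * (b * a * b) * b := by simp only [pow_succ, pow_zero, one_mul, mul_assoc]
          _ = _ := by rw [← h]; simp only [pow_succ, pow_zero, one_mul, mul_assoc]
      have e2 : b ^ 2 * a * b ^ 2 * a = (a * b) ^ 3 := by
        calc _ = b * (b * a * b) * (b * a) := by simp only [pow_succ, pow_zero, one_mul, mul_assoc]
          _ = b * (a * b * a) * (b * a) := by rw [h]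
          _ = (b * a * b) * (a * b * a) := by simp only [mul_assoc]
          _ = (a * b * a) * (b * a * b) := by rw [h]
          _ = _ := by simp only [pow_succ, pow_zero, one_mul, mul_assoc]
      rw [e1, e2])
    (by
      intro i j h1 h2
      rw [if_pos (show i + 1 < m by omega)]
      split
      · exact (sB_comm h1).eq
      · exact ((sB_comm h1).pow_right 2).eq)

theorem jB_sB {m i : ℕ} (h : i + 1 < m) : jB m (sB m i) = sB (m + 1) i := by
  rw [jB, ArtinB.lift_sB (by omega), if_pos h]

theorem jB_last {m i : ℕ} (h : i + 1 = m) : jB m (sB m i) = sB (m + 1) i ^ 2 := by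
  rw [jB, ArtinB.lift_sB (by omega), if_neg (by omega)]

theorem eB_jB {m : ℕ} (g : ArtinB m) : eB (m + 1) (jB m g) = jB m g := by
  have : (eB (m + 1)).comp (jB m) = jB m := ArtinB.hom_ext fun i hi => by
    by_cases h : i + 1 < m
    · simp [jB_sB h, eB_sB (show i + 1 < m + 1 by omega)]
    · simp [jB_last (show i + 1 = m by omega), eB_sB (show i + 1 < m + 1 by omega)]
  exact DFunLike.congr_fun this g

theorem prm_jB {m : ℕ} (g : ArtinB m) : prm (m + 1) (jB m g) = prm m g := by
  have : (prm (m + 1)).comp (jB m) = prm m := ArtinB.hom_ext fun i hi => by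
    by_cases h : i + 1 < m
    · simp [jB_sB h, prm_sB h, prm_sB (show i + 1 < m + 1 by omega)]
    · have h' : i + 1 = m := by omega
      simp [jB_last h', prm_last h', prm_sB (show i + 1 < m + 1 by omega), sq]
  exact DFunLike.congr_fun this g

theorem act_jB_eB {m : ℕ} (g : ArtinB m) : act (m + 1) (jB m (eB m g)) = act m (eB m g) := by
  have : ((act (m + 1)).comp (jB m)).comp (eB m) = (act m).comp (eB m) :=
    ArtinB.hom_ext fun i hi => by
    by_cases h : i + 1 < m
    · simp [jB_sB h, eB_sB h, act_sB h, act_sB (show i + 1 < m + 1 by omega)]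
    · simp [eB_last (show i + 1 = m by omega)]
  exact DFunLike.congr_fun this g

theorem Xh_act_jB {m : ℕ} (g : ArtinB m) (f : FreeGroup ℕ) :
    Xh m (act (m + 1) (jB m g) f) = eB m g * Xh m f * (eB m g)⁻¹ := by
  revert f
  refine sB_induction (P := fun g => ∀ f, Xh m (act (m + 1) (jB m g) f) =
    eB m g * Xh m f * (eB m g)⁻¹) (by simp) ?_ ?_ ?_ g
  · intro i hi f
    by_cases h : i + 1 < m
    · rw [jB_sB h, eB_sB h, act_sB (by omega), conj_Xh, act_sB h]
    · have h' : i + 1 = m := by omega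
      rw [jB_last h', eB_last h', map_pow, act_sB (by omega)]
      have : (Xh m).comp (ht i ^ 2 : MulAut (FreeGroup ℕ)).toMonoidHom = Xh m := by
        refine FreeGroup.ext_hom _ _ fun k => ?_
        by_cases h1 : k = i
        · subst h1
          simp [sq, ht_self, ht_succ, X_of_le (show m ≤ k + 1 by omega)]
        by_cases h2 : k = i + 1
        · subst h2
          simp [sq, ht_self, ht_succ, X_of_le (show m ≤ i + 1 by omega)]
        simp [sq, ht_of_ne h1 h2]
      simpa using DFunLike.congr_fun this f
  · intro g h hg hh f
    simp only [map_mul, MulAut.mul_apply, hg, hh]; group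
  · intro g hg f
    have := hg (act (m + 1) (jB m g⁻¹) f)
    rw [← MulAut.mul_apply, ← map_mul, ← map_mul, mul_inv_cancel] at this
    simp only [map_one, MulAut.one_apply] at this
    rw [this]; simp only [map_inv]; group

theorem act_jB_of {m : ℕ} (hm : 0 < m) (g : ArtinB m) :
    ∃ ω, act (m + 1) (jB m g) (of m) = ω * of m * ω⁻¹ ∧ Xh m ω = eB m g * g⁻¹ := by
  refine sB_induction (P := fun g => ∃ ω, act (m + 1) (jB m g) (of m) = ω * of m * ω⁻¹ ∧
    Xh m ω = eB m g * g⁻¹) ⟨1, by simp⟩ ?_ ?_ ?_ g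
  · intro i hi
    by_cases h : i + 1 < m
    · exact ⟨1, by simp [jB_sB h, act_sB (show i + 1 < m + 1 by omega),
        ht_of_ne (show m ≠ i by omega) (show m ≠ i + 1 by omega)], by simp [eB_sB h]⟩
    · obtain rfl : m = i + 1 := by omega
      refine ⟨(of (i + 1))⁻¹ * (of i)⁻¹, ?_, ?_⟩
      · rw [jB_last rfl, map_pow, act_sB (by omega)]
        simp [sq, ht_self, ht_succ, mul_assoc]
      · simp [eB_last, X_of_le, X_last]
  · rintro g h ⟨ω, h1, h2⟩ ⟨ω', h3, h4⟩
    refine ⟨act (m + 1) (jB m g) ω' * ω, by simp [h1, h3, mul_assoc], ?_⟩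
    rw [map_mul, Xh_act_jB, h2, h4, map_mul]; group
  · rintro g ⟨ω, h1, h2⟩
    refine ⟨act (m + 1) (jB m g⁻¹) ω⁻¹, ?_, ?_⟩
    · have h3 : act (m + 1) (jB m g⁻¹) (act (m + 1) (jB m g) (of m)) = of m := by simp
      rw [h1] at h3
      rw [map_mul, map_mul, map_inv] at h3
      conv_rhs => rw [← h3]
      simp [mul_assoc]
    · rw [Xh_act_jB, map_inv, map_inv, h2]; group

end Braid

namespace Braid
open FreeGroup (of)

/-- Auxiliary descending products of generators. -/
def Waux (n k : ℕ) : ℕ → ArtinB n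
  | 0 => 1
  | d + 1 => Waux n k d * sB n (k - 1 - d)

/-- The product `s_{k-1} ⋯ s_i`. -/
def W (n k i : ℕ) : ArtinB n := Waux n k (k - i)

@[simp] theorem W_self (n k : ℕ) : W n k k = 1 := by simp [W, Waux]

theorem W_eq {n k i : ℕ} (h : i < k) : W n k i = W n k (i + 1) * sB n i := by
  rw [W, W, show k - i = (k - (i + 1)) + 1 by omega, Waux]
  congr 2; omega

theorem W_induction {k : ℕ} {P : ℕ → Prop} (h0 : P k) (h1 : ∀ i, i < k → P (i + 1) → P i) :
    ∀ i, i ≤ k → P i := by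
  intro i hi
  induction hd : k - i generalizing i with
  | zero => obtain rfl : i = k := by omega
            exact h0
  | succ d ih => exact h1 i (by omega) (ih (i + 1) (by omega) (by omega))

theorem W_comm {n k l : ℕ} : ∀ i, i ≤ k → l + 2 ≤ i → Commute (sB n l) (W n k i) := by
  refine W_induction (by simp) fun i hi ih hl => ?_
  rw [W_eq hi]
  exact (ih (by omega)).mul_right (sB_comm hl)

theorem W_shift {n k l : ℕ} (hl : l + 1 < k) (hk : k < n) : ∀ i, i ≤ k → i ≤ l →
    W n k i * sB n (l + 1) = sB n l * W n k i := by
  refine W_induction (by omega) fun i hi ih hil => ?_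
  by_cases h : i = l
  · subst h
    rw [W_eq hi, W_eq hl]
    have h1 := W_comm (n := n) (k := k) (l := i) (i + 1 + 1) (by omega) (by omega)
    have h2 := sB_braid (n := n) (i := i) (by omega)
    calc _ = W n k (i + 1 + 1) * (sB n (i + 1) * sB n i * sB n (i + 1)) := by group
      _ = (W n k (i + 1 + 1) * sB n i) * sB n (i + 1) * sB n i := by rw [← h2]; group
      _ = _ := by rw [← h1.eq]; simp only [mul_assoc]
  · rw [W_eq hi, mul_assoc, (sB_comm (show i + 2 ≤ l + 1 by omega)).eq, ← mul_assoc,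
      ih (by omega), mul_assoc]

theorem W_sq {m i : ℕ} (hi : i < m) : W (m + 1) m (i + 1) * sB (m + 1) i ^ 2 =
    jB m (X m i) * W (m + 1) m (i + 1) := by
  refine desc_induction (n := m) (P := fun i => W (m + 1) m (i + 1) * sB (m + 1) i ^ 2 =
    jB m (X m i) * W (m + 1) m (i + 1)) ?_ ?_ i hi
  · rintro i rfl
    rw [X_last rfl, jB_last rfl]; simp
  · intro i hi ih
    rw [X_eq hi, map_mul, map_mul, map_inv, jB_sB hi, W_eq hi]
    have h1 := W_comm (n := m + 1) (l := i) (i + 1 + 1) hi (by omega)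
    have h2 := sB_braid (n := m + 1) (i := i) (by omega)
    symm
    calc _ = (sB (m + 1) i)⁻¹ * jB m (X m (i + 1)) * (sB (m + 1) i * W (m + 1) m (i + 1 + 1)) *
          sB (m + 1) (i + 1) := by group
      _ = (sB (m + 1) i)⁻¹ * (jB m (X m (i + 1)) * W (m + 1) m (i + 1 + 1)) * sB (m + 1) i *
          sB (m + 1) (i + 1) := by rw [h1.eq]; group
      _ = ((sB (m + 1) i)⁻¹ * W (m + 1) m (i + 1 + 1)) * sB (m + 1) (i + 1) *
            (sB (m + 1) (i + 1) * sB (m + 1) i * sB (m + 1) (i + 1)) := by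
          rw [← ih]; simp only [mul_assoc, sq]
      _ = W (m + 1) m (i + 1 + 1) * ((sB (m + 1) i)⁻¹ * (sB (m + 1) (i + 1) * sB (m + 1) i *
            sB (m + 1) (i + 1)) * sB (m + 1) i) := by
          rw [h1.inv_left.eq, ← h2]
          simp only [mul_assoc]
          rw [← mul_assoc (sB (m + 1) (i + 1)) (sB (m + 1) i) (sB (m + 1) (i + 1) * _),
            ← mul_assoc (sB (m + 1) (i + 1) * sB (m + 1) i), ← h2]
          simp only [mul_assoc]
      _ = _ := by rw [← h2]; simp [mul_assoc, sq]

theorem prm_W {n k : ℕ} (hk : k < n) : ∀ i, i ≤ k → prm n (W n k i) i = k := by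
  refine W_induction (by simp) fun i hi ih => ?_
  rw [W_eq hi, map_mul, prm_sB (by omega), Equiv.Perm.mul_apply, Equiv.swap_apply_left, ih]

theorem exists_coset {m : ℕ} (g : ArtinB (m + 1)) :
    ∃ h i, i ≤ m ∧ eB (m + 1) g = jB m h * W (m + 1) m i := by
  let Q : ArtinB (m + 1) → Prop := fun g => ∀ h i, i ≤ m → ∃ h' i', i' ≤ m ∧
    jB m h * W (m + 1) m i * eB (m + 1) g = jB m h' * W (m + 1) m i'
  have key : Q g ∧ Q g⁻¹ := by
    refine sB_induction (P := fun g => Q g ∧ Q g⁻¹) ?_ ?_ ?_ ?_ g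
    · constructor <;> exact fun h i hi => ⟨h, i, hi, by simp⟩
    · intro k hk
      by_cases h : k + 1 < m + 1
      · have e := eB_sB h
        have hcase : ∀ h' i, i ≤ m → i ≠ k → i ≠ k + 1 → ∃ l, ∀ ε : ℤ,
            jB m h' * W (m + 1) m i * sB (m + 1) k ^ ε = jB m (h' * sB m l ^ ε) *
              W (m + 1) m i := by
          intro h' i hi h1 h2
          rcases lt_or_gt_of_ne h1 with h3 | h3
          · refine ⟨k - 1, fun ε => ?_⟩
            have h4 := W_shift (n := m + 1) (k := m) (l := k - 1) (by omega) (by omega) i hi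
              (by omega)
            rw [show k - 1 + 1 = k by omega] at h4
            have h5 : W (m + 1) m i * sB (m + 1) k ^ ε = sB (m + 1) (k - 1) ^ ε * W (m + 1) m i :=
              (SemiconjBy.zpow_right (show SemiconjBy (W (m + 1) m i) (sB (m + 1) k)
                (sB (m + 1) (k - 1)) from h4) ε).eq
            rw [mul_assoc, h5, map_mul, map_zpow, jB_sB (by omega)]; group
          · refine ⟨k, fun ε => ?_⟩
            have h4 := (W_comm (n := m + 1) (k := m) (l := k) i hi (by omega)).zpow_left ε
            rw [mul_assoc, ← h4.eq, map_mul, map_zpow, jB_sB (by omega)]; group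
        constructor
        · intro h' i hi
          rw [e]
          by_cases h1 : i = k
          · subst h1
            refine ⟨h' * X m i, i + 1, by omega, ?_⟩
            rw [map_mul, mul_assoc (jB m h') (jB m _), ← W_sq (by omega),
              W_eq (show i < m by omega)]
            simp only [mul_assoc, sq]
          by_cases h2 : i = k + 1
          · subst h2
            exact ⟨h', k, by omega, by rw [W_eq (show k < m by omega)]; group⟩
          obtain ⟨l, hl⟩ := hcase h' i hi h1 h2
          exact ⟨_, i, hi, by rw [← hl 1, zpow_one]⟩
        · intro h' i hi
          rw [map_inv, e]
          by_cases h1 : i = k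
          · subst h1
            exact ⟨h', i + 1, by omega, by rw [W_eq (show i < m by omega)]; group⟩
          by_cases h2 : i = k + 1
          · subst h2
            refine ⟨h' * (X m k)⁻¹, k, by omega, ?_⟩
            have := W_sq (show k < m by omega)
            rw [map_mul, map_inv, W_eq (show k < m by omega)]
            rw [mul_assoc, mul_assoc]
            congr 1
            rw [eq_inv_mul_iff_mul_eq, ← mul_assoc, ← this]; group
          obtain ⟨l, hl⟩ := hcase h' i hi h1 h2
          exact ⟨_, i, hi, by rw [← hl (-1), zpow_neg_one]⟩
      · constructor <;> exact fun h' i hi => ⟨h', i, hi, by simp [eB_last (show k + 1 = m + 1 by omega)]⟩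
    · rintro g h ⟨hg1, hg2⟩ ⟨hh1, hh2⟩
      constructor
      · intro h' i hi
        obtain ⟨h2, i2, hi2, e2⟩ := hg1 h' i hi
        obtain ⟨h3, i3, hi3, e3⟩ := hh1 h2 i2 hi2
        exact ⟨h3, i3, hi3, by rw [map_mul, ← mul_assoc, e2, e3]⟩
      · intro h' i hi
        obtain ⟨h2, i2, hi2, e2⟩ := hh2 h' i hi
        obtain ⟨h3, i3, hi3, e3⟩ := hg2 h2 i2 hi2
        exact ⟨h3, i3, hi3, by rw [mul_inv_rev, map_mul, ← mul_assoc, e2, e3]⟩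
    · rintro g ⟨h1, h2⟩
      exact ⟨h2, by rwa [inv_inv]⟩
  obtain ⟨h, i, hi, e⟩ := key.1 1 m le_rfl
  exact ⟨h, i, hi, by simpa using e⟩

theorem exists_jB_of_prm {m : ℕ} {g : ArtinB (m + 1)} (h : prm (m + 1) g m = m) :
    ∃ h, eB (m + 1) g = jB m h := by
  obtain ⟨x, i, hi, e⟩ := exists_coset g
  have h1 : prm (m + 1) (eB (m + 1) g) i = m := by
    rw [e, map_mul, prm_jB, Equiv.Perm.mul_apply, prm_W (by omega) i hi, prm_of_le le_rfl]
  rw [prm_eB] at h1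
  obtain rfl : i = m := (prm (m + 1) g).injective (h1.trans h.symm)
  exact ⟨x, by simpa using e⟩

theorem Xh_eq_one_of_commute {m : ℕ} {ω : FreeGroup ℕ} (h : ω * of m * ω⁻¹ = of m) :
    Xh m ω = 1 := by
  have : Commute (of m) ω := by
    rw [mul_inv_eq_iff_eq_mul] at h; exact h.symm
  obtain ⟨k, rfl⟩ := Subgroup.mem_zpowers_iff.1 (FreeGroup.mem_zpowers_of_commute this)
  rw [map_zpow, Xh_of, X_of_le le_rfl, one_zpow]

theorem prm_eq_one_of_act {n : ℕ} {g : ArtinB n} (h : act n g = 1) : prm n g = 1 := by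
  ext i
  exact prm_eq_of_isConj (by rw [h]; exact IsConj.refl _)

/-- Artin's representation is faithful. -/
theorem eB_eq_one_of_act {n : ℕ} {g : ArtinB n} (h : act n (eB n g) = 1) : eB n g = 1 := by
  induction n with
  | zero => exact sB_induction (P := fun g => eB 0 g = 1) (by simp) (by omega)
              (by intro g h hg hh; simp [hg, hh]) (by intro g hg; simp [hg]) g
  | succ m ih =>
    obtain _ | m := m
    · exact sB_induction (P := fun g => eB 1 g = 1) (by simp)
        (by intro i hi; exact eB_last (by omega))
        (by intro g h hg hh; simp [hg, hh]) (by intro g hg; simp [hg]) g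
    · obtain ⟨x, hx⟩ := exists_jB_of_prm (g := g)
        (by rw [← prm_eB, prm_eq_one_of_act h]; rfl)
      obtain ⟨ω, h1, h2⟩ := act_jB_of (by omega) x
      rw [← hx, h] at h1
      rw [Xh_eq_one_of_commute h1.symm] at h2
      have h3 : eB (m + 1) x = x := mul_inv_eq_one.1 h2.symm
      have h4 := act_jB_eB x
      rw [h3, ← hx, h] at h4
      have h5 := ih (g := x) (by rw [h3]; exact h4.symm)
      rw [hx, ← h3, h5, map_one]

theorem jB_injective {m : ℕ} (hm : 0 < m) {x : ArtinB m} (h : jB m x = 1) : x = 1 := by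
  obtain ⟨ω, h1, h2⟩ := act_jB_of hm x
  rw [h, map_one] at h1
  rw [Xh_eq_one_of_commute h1.symm] at h2
  have h3 : eB m x = x := mul_inv_eq_one.1 h2.symm
  rw [← h3]
  apply eB_eq_one_of_act
  rw [← act_jB_eB, h3, h, map_one]

theorem act_cB_pow_of_kap {n : ℕ} {f : FreeGroup ℕ} (hf : kap n f = f) :
    act n (cB n ^ n) f = (D n)⁻¹ * f * D n := by
  rw [← hf]
  have : (act n (cB n ^ n)).toMonoidHom.comp (kap n) = (MulAut.conj (D n)⁻¹).toMonoidHom.comp (kap n) := by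
    refine FreeGroup.ext_hom _ _ fun i => ?_
    by_cases hi : i < n
    · simp only [MonoidHom.comp_apply, kap_of_lt hi]
      simpa using act_cB_pow hi
    · simp [kap_of_le (not_lt.1 hi)]
  simpa using DFunLike.congr_fun this f

theorem cB_pow_commute {n : ℕ} (hn : 0 < n) (g : ArtinB n) :
    Commute (cB n ^ n) (eB n g) := by
  have h1 : eB n (cB n ^ n) = cB n ^ n := by rw [map_pow, eB_cB hn]
  have h2 : eB n (cB n ^ n * g * (cB n ^ n)⁻¹ * g⁻¹) = 1 := by
    apply eB_eq_one_of_act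
    have : act n (cB n ^ n) * act n (eB n g) = act n (eB n g) * act n (cB n ^ n) := by
      refine FreeGroup.mulAut_ext fun i => ?_
      simp only [MulAut.mul_apply]
      by_cases hi : i < n
      · rw [act_cB_pow hi, act_cB_pow_of_kap (by rw [kap_act, kap_of_lt hi]), map_mul, map_mul,
          map_inv, act_eB_D]
      · rw [act_eB_of_le (by omega), ← h1, act_eB_of_le (by omega), act_eB_of_le (by omega)]
    simp only [map_mul, map_inv]
    rw [h1, this]; group
  simp only [map_mul, map_inv, h1] at h2
  rw [mul_inv_eq_one, mul_inv_eq_iff_eq_mul] at h2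
  exact h2

theorem Delta_commute {n : ℕ} (hn : 0 < n) (g : ArtinB n) : Commute (ΔB n) g := by
  obtain ⟨f, -, hf⟩ := exists_Xh_mul_eB g
  rw [hf]
  refine Commute.mul_right ?_ ?_
  · have : act n (ΔB n) (kap n f) = kap n f := by
      have : (act n (ΔB n)).toMonoidHom.comp (kap n) = kap n := by
        refine FreeGroup.ext_hom _ _ fun i => ?_
        by_cases hi : i < n
        · simp only [MonoidHom.comp_apply, kap_of_lt hi]
          simpa using act_Delta hi
        · simp [kap_of_le (not_lt.1 hi)]
      simpa using DFunLike.congr_fun this f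
    have h := conj_Xh (ΔB n) (kap n f)
    rw [this, Xh_kap, mul_inv_eq_iff_eq_mul] at h
    exact h
  · rw [Delta_eq hn]
    refine Commute.mul_left ?_ (cB_pow_commute hn g)
    have h := conj_Xh (eB n g) (D n)
    rw [act_eB_D, mul_inv_eq_iff_eq_mul] at h
    exact h.symm

theorem act_of_commute {n i : ℕ} {g : ArtinB n} (hi : i < n) (h : Commute g (X n i)) :
    act n g (of i) = of i := by
  have h1 := conj_Xh g (of i)
  rw [Xh_of, h.eq, mul_inv_cancel_right, ← Xh_of] at h1
  have := kap_eq_of_Xh_eq h1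
  rwa [kap_act, kap_of_lt hi, eq_comm] at this

/-- An element commuting with all free generators is a power of the central element. -/
theorem exists_zpow_Delta {n : ℕ} (hn : 0 < n) {g : ArtinB n}
    (h : ∀ i, i < n → Commute g (X n i)) : ∃ k : ℤ, g = ΔB n ^ k := by
  obtain ⟨f, hf1, hf⟩ := exists_Xh_mul_eB g
  have h1 : ∀ i, i < n → act n (eB n g) (of i) = f⁻¹ * of i * f := by
    intro i hi
    have := act_of_commute hi (h i hi)
    rw [hf, map_mul, act_Xh, hf1, MulAut.mul_apply, MulAut.conj_apply, mul_inv_eq_iff_eq_mul] at this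
    rw [mul_assoc, ← this]; group
  have h2 : ∀ k, k ≤ n → act n (eB n g) (D k) = f⁻¹ * D k * f := by
    intro k
    induction k with
    | zero => simp
    | succ k ih => intro hk; rw [D_succ, map_mul, ih (by omega), h1 k (by omega)]; group
  have h3 := h2 n le_rfl
  rw [act_eB_D] at h3
  obtain ⟨k, rfl⟩ := eq_zpow_D hn (f := f) (by
    show f * D n = D n * f
    nth_rw 1 [h3]; group)
  refine ⟨k, ?_⟩
  have hc : Commute (Xh n (D n)) (cB n ^ n) := by
    have := conj_Xh (eB n (cB n ^ n)) (D n)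
    rw [act_eB_D, mul_inv_eq_iff_eq_mul, map_pow, eB_cB hn] at this
    exact Eq.symm this
  have h4 : g * (ΔB n ^ k)⁻¹ = eB n (g * (ΔB n ^ k)⁻¹) := by
    have h5 : ΔB n ^ k = Xh n (D n ^ k) * (cB n ^ n) ^ k := by
      rw [Delta_eq hn, hc.mul_zpow, map_zpow]
    have h6 : eB n (ΔB n ^ k) = (cB n ^ n) ^ k := by
      rw [h5, map_mul, eB_Xh, one_mul, map_zpow, map_pow, eB_cB hn]
    rw [map_mul, map_inv, h6, ((Delta_commute hn g).zpow_left k).symm.inv_right.eq, h5]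
    conv_lhs => rw [hf]
    rw [(((cB_pow_commute hn g).zpow_left k).symm.inv_right).eq]
    group
  have h7 : g * (ΔB n ^ k)⁻¹ = 1 := by
    rw [h4]
    apply eB_eq_one_of_act
    refine FreeGroup.mulAut_ext fun i => ?_
    by_cases hi : i < n
    · rw [← h4]
      exact act_of_commute hi ((h i hi).mul_left ((Delta_commute hn _).zpow_left k).inv_left)
    · rw [act_eB_of_le (by omega)]; rfl
  exact mul_inv_eq_one.1 h7

theorem ext_of_conj_X {n : ℕ} (hn : 0 < n) {g h : ArtinB n}
    (H : ∀ i, i < n → g * X n i * g⁻¹ = h * X n i * h⁻¹) : ∃ k : ℤ, g = h * ΔB n ^ k := by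
  obtain ⟨k, hk⟩ := exists_zpow_Delta hn (g := h⁻¹ * g) fun i hi => by
    have := H i hi
    rw [mul_inv_eq_iff_eq_mul] at this
    show _ = _
    rw [mul_assoc, this]; group
  exact ⟨k, by rw [← hk]; group⟩

end Braid

namespace Braid
open FreeGroup (of)

/-- Finitely supported integer functions on ordered pairs. -/
abbrev PV := ℕ × ℕ →₀ ℤ

/-- The permutation action on functions of pairs. -/
def mv (σ : Equiv.Perm ℕ) : PV ≃+ PV := Finsupp.domCongr (Equiv.prodCongr σ σ)

theorem mv_apply (σ : Equiv.Perm ℕ) (v : PV) (a b : ℕ) :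
    mv σ v (a, b) = v (σ⁻¹ a, σ⁻¹ b) := rfl

theorem mv_single (σ : Equiv.Perm ℕ) (a b : ℕ) (c : ℤ) :
    mv σ (Finsupp.single (a, b) c) = Finsupp.single (σ a, σ b) c := by
  simp [mv]

theorem mv_mul (σ τ : Equiv.Perm ℕ) (v : PV) : mv (σ * τ) v = mv σ (mv τ v) := by
  ext ⟨a, b⟩; simp [mv_apply]

@[simp] theorem mv_one (v : PV) : mv 1 v = v := by ext ⟨a, b⟩; simp [mv_apply]

/-- An affine permutation. -/
noncomputable def affP (σ : Equiv.Perm ℕ) (a : PV) : Equiv.Perm PV := (mv σ).toEquiv.trans (Equiv.addLeft a)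

theorem affP_apply (σ : Equiv.Perm ℕ) (a v : PV) : affP σ a v = a + mv σ v := rfl

theorem affP_mul (σ τ : Equiv.Perm ℕ) (a b : PV) :
    affP σ a * affP τ b = affP (σ * τ) (a + mv σ b) := by
  ext v : 1
  simp [affP_apply, mv_mul, add_assoc]

/-- The affine action recording linking numbers of ordered pairs of strands. -/
noncomputable def Lh (n : ℕ) : ArtinB n →* Equiv.Perm PV :=
  ArtinB.lift n (fun i => if i + 1 < n then affP (prm n (sB n i)) (Finsupp.single (i, i + 1) 1)
      else affP (prm n (sB n i)) (Finsupp.single (i, i) 1))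
    (by
      intro i hi
      simp only [if_pos (show i + 1 < n by omega), if_pos (show i + 1 + 1 < n by omega), affP_mul,
        ← map_mul, sB_braid hi]
      congr 1
      simp only [Equiv.Perm.mul_apply, map_mul, mv_single, prm_sB (show i + 1 < n by omega),
        prm_sB (show i + 1 + 1 < n by omega), Equiv.swap_apply_left, Equiv.swap_apply_right,
        Equiv.swap_apply_of_ne_of_ne (show i + 1 + 1 ≠ i by omega)
          (show i + 1 + 1 ≠ i + 1 by omega),
        Equiv.swap_apply_of_ne_of_ne (show i ≠ i + 1 by omega) (show i ≠ i + 1 + 1 by omega)]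
      abel)
    (by
      intro i hi
      simp only [if_pos (show i + 1 < n by omega), if_neg (show ¬ i + 1 + 1 < n by omega), affP_mul,
        ← map_mul, sB_four hi]
      congr 1
      simp only [Equiv.Perm.mul_apply, map_mul, mv_single, prm_sB (show i + 1 < n by omega),
        prm_last (show i + 1 + 1 = n by omega), Equiv.swap_apply_left, Equiv.swap_apply_right,
        Equiv.Perm.one_apply]
      abel)
    (by
      intro i j h1 h2
      rw [if_pos (show i + 1 < n by omega)]
      split <;> rename_i h <;> simp only [affP_mul, ← map_mul, (sB_comm h1).eq] <;> congr 1
      · simp only [mv_single, prm_sB h, prm_sB (show i + 1 < n by omega),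
          Equiv.swap_apply_of_ne_of_ne (show i ≠ j by omega) (show i ≠ j + 1 by omega),
          Equiv.swap_apply_of_ne_of_ne (show i + 1 ≠ j by omega) (show i + 1 ≠ j + 1 by omega),
          Equiv.swap_apply_of_ne_of_ne (show j ≠ i by omega) (show j ≠ i + 1 by omega),
          Equiv.swap_apply_of_ne_of_ne (show j + 1 ≠ i by omega) (show j + 1 ≠ i + 1 by omega)]
        abel
      · simp only [mv_single, prm_last (show j + 1 = n by omega), Equiv.Perm.one_apply,
          prm_sB (show i + 1 < n by omega),
          Equiv.swap_apply_of_ne_of_ne (show j ≠ i by omega) (show j ≠ i + 1 by omega)]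
        abel)

/-- The linking cocycle. -/
noncomputable def L (n : ℕ) (g : ArtinB n) : PV := Lh n g 0

theorem Lh_apply {n : ℕ} (g : ArtinB n) : Lh n g = affP (prm n g) (L n g) := by
  have : ∃ a, Lh n g = affP (prm n g) a := by
    refine sB_induction (P := fun g => ∃ a, Lh n g = affP (prm n g) a) ?_ ?_ ?_ ?_ g
    · exact ⟨0, by ext v : 1; simp [affP_apply]⟩
    · intro i hi
      rw [Lh, ArtinB.lift_sB hi]
      split
      · exact ⟨_, rfl⟩
      · exact ⟨_, rfl⟩
    · rintro g h ⟨a, ha⟩ ⟨b, hb⟩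
      exact ⟨_, by rw [map_mul, ha, hb, affP_mul, map_mul]⟩
    · rintro g ⟨a, ha⟩
      refine ⟨- mv (prm n g⁻¹) a, ?_⟩
      rw [map_inv, ha, inv_eq_iff_mul_eq_one, affP_mul, ← map_mul, mul_inv_cancel]
      ext v : 1
      simp [affP_apply, ← mv_mul]
  obtain ⟨a, ha⟩ := this
  rw [L, ha]
  simp [affP_apply]

theorem L_mul {n : ℕ} (g h : ArtinB n) : L n (g * h) = L n g + mv (prm n g) (L n h) := by
  conv_lhs => rw [L, map_mul, Equiv.Perm.mul_apply, Lh_apply g, affP_apply]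
  rfl

@[simp] theorem L_one (n : ℕ) : L n 1 = 0 := by simp [L]

theorem L_sB {n i : ℕ} (h : i + 1 < n) : L n (sB n i) = Finsupp.single (i, i + 1) 1 := by
  rw [L, Lh, ArtinB.lift_sB (by omega), if_pos h, affP_apply]; simp

theorem L_last {n i : ℕ} (h : i + 1 = n) : L n (sB n i) = Finsupp.single (i, i) 1 := by
  rw [L, Lh, ArtinB.lift_sB (by omega), if_neg (by omega), affP_apply]; simp

theorem L_inv {n : ℕ} (g : ArtinB n) : L n g⁻¹ = - mv (prm n g⁻¹) (L n g) := by
  have := L_mul g⁻¹ g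
  rw [inv_mul_cancel, L_one] at this
  exact eq_neg_of_add_eq_zero_left this.symm

theorem L_mul_pure {n : ℕ} {g : ArtinB n} (hg : prm n g = 1) (h : ArtinB n) :
    L n (g * h) = L n g + L n h := by rw [L_mul, hg, mv_one]

theorem L_inv_pure {n : ℕ} {g : ArtinB n} (hg : prm n g = 1) : L n g⁻¹ = - L n g := by
  rw [L_inv, map_inv, hg, inv_one, mv_one]

theorem L_conj {n : ℕ} (g : ArtinB n) {p : ArtinB n} (hp : prm n p = 1) :
    L n (g * p * g⁻¹) = mv (prm n g) (L n p) := by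
  rw [L_mul, L_mul, map_mul, hp, mul_one, L_inv, map_neg, ← mv_mul, ← map_mul, mul_inv_cancel,
    map_one, mv_one]
  abel

theorem L_zpow_pure {n : ℕ} {g : ArtinB n} (hg : prm n g = 1) (k : ℤ) :
    L n (g ^ k) = k • L n g := by
  induction k with
  | zero => simp
  | succ k ih =>
    rw [zpow_add_one, L_mul_pure (by rw [map_zpow, hg, one_zpow]), ih, add_smul, one_smul]
  | pred k ih =>
    rw [zpow_sub_one, L_mul_pure (by rw [map_zpow, hg, one_zpow]), ih, L_inv_pure hg, sub_smul,
      one_smul, sub_eq_add_neg]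

theorem L_asymm {n : ℕ} (g : ArtinB n) : ∀ a b : ℕ, L n g (a, b) - L n g (b, a) =
    (if a < b then 1 else 0)
      - (if (prm n g)⁻¹ a < (prm n g)⁻¹ b then 1 else 0) := by
  refine sB_induction (P := fun g => ∀ a b : ℕ, L n g (a, b) - L n g (b, a) =
    (if a < b then 1 else 0) - (if (prm n g)⁻¹ a < (prm n g)⁻¹ b then 1 else 0))
    ?_ ?_ ?_ ?_ g
  · intro a b; simp
  · intro i hi a b
    by_cases h : i + 1 < n
    · rw [L_sB h, prm_sB h, Equiv.swap_inv]
      have key : ∀ c, (c = i ∧ Equiv.swap i (i + 1) c = i + 1) ∨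
          (c = i + 1 ∧ Equiv.swap i (i + 1) c = i) ∨
          (c ≠ i ∧ c ≠ i + 1 ∧ Equiv.swap i (i + 1) c = c) := by
        intro c
        rw [Equiv.swap_apply_def]
        split_ifs <;> omega
      have ha := key a
      have hb := key b
      generalize Equiv.swap i (i + 1) a = a' at *
      generalize Equiv.swap i (i + 1) b = b' at *
      clear hi h key
      simp only [Finsupp.single_apply, Prod.mk.injEq]
      rcases eq_or_ne a b with h | h
      · subst h
        have : a' = b' := by omega
        subst this
        simp
      rcases ha with ha | ha | ha <;> rcases hb with hb | hb | hb <;> split_ifs <;> omega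
    · rw [L_last (by omega), prm_last (by omega)]
      simp only [Finsupp.single_apply, Prod.mk.injEq, inv_one, Equiv.Perm.one_apply]
      split_ifs <;> omega
  · intro g h hg hh a b
    have h1 := hg a b
    have h2 := hh ((prm n g)⁻¹ a) ((prm n g)⁻¹ b)
    simp only [L_mul, Finsupp.add_apply, mv_apply, map_mul, mul_inv_rev, Equiv.Perm.mul_apply]
    linarith
  · intro g hg a b
    have h1 := hg ((prm n g) a) ((prm n g) b)
    simp only [Equiv.Perm.inv_def, Equiv.symm_apply_apply] at h1
    simp only [L_inv, Finsupp.neg_apply, mv_apply, map_inv, inv_inv]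
    linarith

theorem L_symm {n : ℕ} {p : ArtinB n} (hp : prm n p = 1) (a b : ℕ) :
    L n p (a, b) = L n p (b, a) := by
  have := L_asymm p a b
  rw [hp] at this
  simp only [inv_one, Equiv.Perm.one_apply] at this
  linarith

end Braid

namespace Braid
open FreeGroup (of)

theorem L_of_le {n a b : ℕ} (h : n ≤ a ∨ n ≤ b) (g : ArtinB n) : L n g (a, b) = 0 := by
  refine sB_induction (P := fun g => ∀ a b : ℕ, (n ≤ a ∨ n ≤ b) → L n g (a, b) = 0)
    ?_ ?_ ?_ ?_ g a b h
  · intro a b _; simp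
  · intro i hi a b hab
    by_cases h : i + 1 < n
    · rw [L_sB h, Finsupp.single_apply, if_neg]
      rw [Prod.mk.injEq]; omega
    · rw [L_last (by omega), Finsupp.single_apply, if_neg]
      rw [Prod.mk.injEq]; omega
  · intro g h hg hh a b hab
    rw [L_mul, Finsupp.add_apply, mv_apply, hg _ _ hab, ← map_inv, hh, add_zero]
    exact hab.imp (fun h => (prm_of_le h g⁻¹).ge.trans' h) (fun h => (prm_of_le h g⁻¹).ge.trans' h)
  · intro g hg a b hab
    rw [L_inv, Finsupp.neg_apply, mv_apply, map_inv, inv_inv, hg, neg_zero]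
    exact hab.imp (fun h => (prm_of_le h g).ge.trans' h) (fun h => (prm_of_le h g).ge.trans' h)

theorem L_X {n : ℕ} : ∀ i, i < n → L n (X n i) = Finsupp.single (i, i) 1 := by
  refine desc_induction ?_ ?_
  · intro i h
    rw [X_last h, L_last h]
  · intro i h ih
    have := L_conj (sB n i)⁻¹ (prm_X n (i + 1))
    rw [inv_inv, ← X_eq h, ih, map_inv, prm_sB h, mv_single] at this
    simpa using this

theorem L_Xh {n : ℕ} (f : FreeGroup ℕ) (a b : ℕ) :
    L n (Xh n f) (a, b) = if a = b ∧ a < n then ex a f else 0 := by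
  have hX : ∀ i, L n (X n i) (a, b) = if a = b ∧ a < n then ex a (of i) else 0 := by
    intro i
    by_cases hi : i < n
    · rw [L_X i hi, Finsupp.single_apply, ex_of]
      simp only [Prod.mk.injEq]
      split_ifs <;> omega
    · rw [X_of_le (by omega), L_one, ex_of]
      simp only [Finsupp.coe_zero, Pi.zero_apply]
      split_ifs <;> omega
  induction f using FreeGroup.induction_on with
  | C1 => simp
  | of i => rw [Xh_of, hX]
  | inv_of i _ =>
    rw [map_inv, Xh_of, L_inv_pure (prm_X n i), Finsupp.neg_apply, hX, ex_inv]
    split_ifs <;> simp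
  | mul f g hf hg =>
    rw [map_mul, L_mul_pure (prm_Xh f), Finsupp.add_apply, hf, hg, ex_mul]
    split_ifs <;> simp

theorem L_eB {n : ℕ} (g : ArtinB n) : ∀ a b : ℕ,
    L n (eB n g) (a, b) = if a = b then 0 else L n g (a, b) := by
  refine sB_induction (P := fun g => ∀ a b : ℕ,
    L n (eB n g) (a, b) = if a = b then 0 else L n g (a, b)) ?_ ?_ ?_ ?_ g
  · intro a b; simp
  · intro i hi a b
    by_cases h : i + 1 < n
    · simp only [eB_sB h, L_sB h, Finsupp.single_apply, Prod.mk.injEq]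
      split_ifs <;> omega
    · rw [eB_last (by omega), L_last (by omega), L_one]
      simp only [Finsupp.single_apply, Prod.mk.injEq, Finsupp.coe_zero, Pi.zero_apply]
      split_ifs <;> omega
  · intro g h hg hh a b
    simp only [map_mul, L_mul, Finsupp.add_apply, mv_apply, hg, hh, prm_eB,
      EmbeddingLike.apply_eq_iff_eq]
    split_ifs <;> simp
  · intro g hg a b
    simp only [map_inv, L_inv, Finsupp.neg_apply, mv_apply, hg, prm_eB, inv_inv,
      EmbeddingLike.apply_eq_iff_eq]
    split_ifs <;> simp

theorem L_jB {m : ℕ} (g : ArtinB m) : ∀ a b : ℕ, a ≠ b → L (m + 1) (jB m g) (a, b) =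
    if a = m then L m g (b, b) else if b = m then L m g (a, a) else L m g (a, b) := by
  refine sB_induction (P := fun g => ∀ a b : ℕ, a ≠ b → L (m + 1) (jB m g) (a, b) =
    if a = m then L m g (b, b) else if b = m then L m g (a, a) else L m g (a, b)) ?_ ?_ ?_ ?_ g
  · intro a b _; simp
  · intro i hi a b hab
    by_cases h : i + 1 < m
    · simp only [jB_sB h, L_sB h, L_sB (show i + 1 < m + 1 by omega), Finsupp.single_apply,
        Prod.mk.injEq]
      split_ifs <;> omega
    · rw [jB_last (by omega), sq, L_mul, L_last (show i + 1 = m by omega), L_sB (by omega),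
        prm_sB (by omega), mv_single, Finsupp.add_apply, Equiv.swap_apply_left,
        Equiv.swap_apply_right]
      simp only [Finsupp.single_apply, Prod.mk.injEq]
      split_ifs <;> omega
  · intro g h hg hh a b hab
    have key : ∀ c, (prm m g)⁻¹ c = m ↔ c = m := by
      intro c
      rw [Equiv.Perm.inv_eq_iff_eq, prm_of_le le_rfl]
    simp only [map_mul, L_mul, Finsupp.add_apply, mv_apply, hg a b hab, prm_jB]
    rw [hh _ _ (by simpa using hab)]
    simp only [key]
    split_ifs <;> rfl
  · intro g hg a b hab
    have key : ∀ c, prm m g c = m ↔ c = m := by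
      intro c
      conv_lhs => rhs; rw [← prm_of_le le_rfl g]
      exact EmbeddingLike.apply_eq_iff_eq _
    simp only [map_inv, L_inv, Finsupp.neg_apply, mv_apply, prm_jB, inv_inv]
    rw [hg _ _ (by simpa using hab)]
    simp only [key]
    split_ifs <;> rfl

theorem prm_pr_self {n k : ℕ} (hk : k < n) : prm n (pr n k) k = 0 := by
  refine prm_eq_of_isConj ?_
  rw [act_pr_self hk, isConj_iff]
  exact ⟨D (k + 1), by group⟩

theorem prm_pr_of_lt {n k i : ℕ} (hk : k < n) (hi : i < k) : prm n (pr n k) i = i + 1 :=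
  prm_eq_of_isConj (by rw [act_pr_of_lt hk hi])

theorem prm_pr_of_gt {n k i : ℕ} (hk : k < n) (hi : k < i) : prm n (pr n k) i = i :=
  prm_eq_of_isConj (by rw [act_pr_of_gt hk hi])

theorem L_pr {n : ℕ} : ∀ k, k < n → ∀ a b,
    L n (pr n k) (a, b) = if a = 0 ∧ 0 < b ∧ b ≤ k then 1 else 0 := by
  intro k
  induction k with
  | zero => intro _ a b; simp; omega
  | succ k ih =>
    intro hk a b
    rw [pr_succ, L_mul, L_sB hk, mv_single, prm_pr_self (by omega), prm_pr_of_gt (by omega)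
      (by omega), Finsupp.add_apply, ih (by omega)]
    simp only [Finsupp.single_apply, Prod.mk.injEq]
    split_ifs <;> omega

theorem prm_rho {m : ℕ} : prm (m + 1) (ρB (m + 1)) = prm (m + 1) (pr (m + 1) m) := by
  rw [rhoB_eq, pr_succ, map_mul, prm_last rfl, mul_one]

theorem L_rho {m : ℕ} (a b : ℕ) :
    L (m + 1) (ρB (m + 1)) (a, b) = if a = 0 ∧ b ≤ m then 1 else 0 := by
  rw [rhoB_eq, pr_succ, L_mul, L_last rfl, mv_single, prm_pr_self (by omega), Finsupp.add_apply,
    L_pr _ (by omega)]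
  simp only [Finsupp.single_apply, Prod.mk.injEq]
  split_ifs <;> omega

theorem L_rho_pow {m : ℕ} : ∀ k, k ≤ m + 1 → ∀ a b,
    L (m + 1) (ρB (m + 1) ^ k) (a, b) = if a < k ∧ b ≤ m then 1 else 0 := by
  intro k
  induction k with
  | zero => intro _ a b; simp
  | succ k ih =>
    intro hk a b
    have key : ∀ c, ((prm (m + 1) (ρB (m + 1)))⁻¹ c = m ∧ c = 0) ∨
        (c ≤ m ∧ (prm (m + 1) (ρB (m + 1)))⁻¹ c + 1 = c) ∨
        (m < c ∧ (prm (m + 1) (ρB (m + 1)))⁻¹ c = c) := by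
      intro c
      rw [prm_rho]
      simp only [Equiv.Perm.inv_eq_iff_eq]
      rcases Nat.eq_zero_or_pos c with rfl | hc
      · exact Or.inl ⟨(prm_pr_self (by omega)).symm, rfl⟩
      · rcases Nat.lt_or_ge m c with h | h
        · exact Or.inr (Or.inr ⟨h, (prm_pr_of_gt (by omega) h).symm⟩)
        · refine Or.inr (Or.inl ⟨h, ?_⟩)
          have : (prm (m + 1) (pr (m + 1) m))⁻¹ c = c - 1 := by
            rw [Equiv.Perm.inv_eq_iff_eq, prm_pr_of_lt (by omega) (by omega)]
            omega
          omega
    rw [pow_succ', L_mul, Finsupp.add_apply, mv_apply, L_rho, ih (by omega)]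
    have ha := key a
    have hb := key b
    generalize (prm (m + 1) (ρB (m + 1)))⁻¹ a = a' at *
    generalize (prm (m + 1) (ρB (m + 1)))⁻¹ b = b' at *
    clear key
    rcases ha with ha | ha | ha <;> split_ifs <;> omega

theorem prm_Delta {n : ℕ} : prm n (ΔB n) = 1 := by
  ext i
  rcases Nat.lt_or_ge i n with h | h
  · exact prm_eq_of_isConj (by rw [act_Delta h]; exact IsConj.refl _)
  · exact prm_of_le h _

theorem L_Delta {n : ℕ} (a b : ℕ) : L n (ΔB n) (a, b) = if a < n ∧ b < n then 1 else 0 := by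
  rcases n with _ | m
  · rw [L_of_le (by omega)]; simp
  · rw [ΔB, L_rho_pow _ le_rfl]
    simp only [Nat.lt_succ_iff]

theorem Delta_zpow_injective {n : ℕ} (hn : 0 < n) {k l : ℤ} (h : ΔB n ^ k = ΔB n ^ l) :
    k = l := by
  have := congrArg (fun g => L n g (0, 0)) h
  simpa [L_zpow_pure prm_Delta, L_Delta, hn] using this

end Braid

namespace Braid
open FreeGroup (of)

/-- The standard generators of the pure braid group. -/
def A (n i j : ℕ) : ArtinB n := W n j (i + 1) * sB n i ^ 2 * (W n j (i + 1))⁻¹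

theorem prm_W_of_lt {n k : ℕ} (hk : k < n) : ∀ i, i ≤ k → ∀ l, l < i → prm n (W n k i) l = l := by
  refine W_induction ?_ ?_
  · intro l _; simp
  · intro i hi ih l hl
    rw [W_eq hi, map_mul, Equiv.Perm.mul_apply, prm_sB (by omega),
      Equiv.swap_apply_of_ne_of_ne (by omega) (by omega), ih l (by omega)]

theorem prm_sq {n i : ℕ} (h : i + 1 < n) : prm n (sB n i ^ 2) = 1 := by
  rw [map_pow, prm_sB h, sq, Equiv.swap_mul_self]

theorem L_sq {n i : ℕ} (h : i + 1 < n) :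
    L n (sB n i ^ 2) = Finsupp.single (i, i + 1) 1 + Finsupp.single (i + 1, i) 1 := by
  rw [sq, L_mul, L_sB h, prm_sB h, mv_single, Equiv.swap_apply_left, Equiv.swap_apply_right]

theorem prm_conj_eq_one {n : ℕ} (g : ArtinB n) {p : ArtinB n} (hp : prm n p = 1) :
    prm n (g * p * g⁻¹) = 1 := by rw [map_mul, map_mul, hp, mul_one, ← map_mul, mul_inv_cancel,
      map_one]

theorem prm_A {n i j : ℕ} (hi : i < j) (hj : j < n) : prm n (A n i j) = 1 :=
  prm_conj_eq_one _ (prm_sq (by omega))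

theorem L_A {n i j : ℕ} (hi : i < j) (hj : j < n) :
    L n (A n i j) = Finsupp.single (i, j) 1 + Finsupp.single (j, i) 1 := by
  rw [A, L_conj _ (prm_sq (by omega)), L_sq (by omega), map_add, mv_single, mv_single,
    prm_W hj _ (by omega), prm_W_of_lt hj _ (by omega) _ (by omega)]

theorem jB_W {m k : ℕ} (hk : k < m) : ∀ i, i ≤ k → jB m (W m k i) = W (m + 1) k i := by
  refine W_induction ?_ ?_
  · simp
  · intro i hi ih
    rw [W_eq hi, W_eq hi, map_mul, ih, jB_sB (by omega)]

theorem pure_le : ∀ {n : ℕ} (K : Subgroup (ArtinB n)), (∀ i, i < n → X n i ∈ K) →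
    (∀ i j, i < j → j < n → A n i j ∈ K) → ∀ g, prm n g = 1 → g ∈ K := by
  intro n
  induction n with
  | zero => intro K _ _ g _; exact ArtinB.closure_eq_top (by intro i hi; omega) g
  | succ m ih =>
    intro K hX hA g hg
    obtain ⟨f, -, hf⟩ := exists_Xh_mul_eB g
    have hfK : Xh (m + 1) f ∈ K := by
      clear hf
      have hX' : ∀ i, X (m + 1) i ∈ K := by
        intro i
        rcases Nat.lt_or_ge i (m + 1) with h | h
        · exact hX i h
        · rw [X_of_le h]; exact K.one_mem
      induction f using FreeGroup.induction_on with
      | C1 => rw [map_one]; exact K.one_mem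
      | of i => rw [Xh_of]; exact hX' i
      | inv_of i _ => rw [map_inv, Xh_of]; exact K.inv_mem (hX' i)
      | mul f g hf hg => rw [map_mul]; exact K.mul_mem hf hg
    obtain ⟨h, hh⟩ := exists_jB_of_prm (g := g) (by rw [hg]; rfl)
    rw [hf, hh]
    refine K.mul_mem hfK ?_
    refine ih (K.comap (jB m)) ?_ ?_ h ?_
    · intro i hi
      have : jB m (X m i) = A (m + 1) i m := by rw [A, W_sq hi, mul_inv_cancel_right]
      rw [Subgroup.mem_comap, this]
      exact hA i m hi (by omega)
    · intro i j hij hj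
      have : jB m (A m i j) = A (m + 1) i j := by
        rw [A, A, map_mul, map_mul, map_inv, map_pow, jB_W hj _ (by omega), jB_sB (by omega)]
      rw [Subgroup.mem_comap, this]
      exact hA i j hij (by omega)
    · rw [← prm_jB, ← hh, prm_eB, hg]

theorem kap_one_commute {f : FreeGroup ℕ} (h : kap 1 f = f) : Commute (of 0) f := by
  rw [← h]
  clear h
  induction f using FreeGroup.induction_on with
  | C1 => rw [map_one]; exact Commute.one_right _
  | of i =>
    rcases Nat.eq_zero_or_pos i with rfl | h
    · rw [kap_of_lt (by omega)]
    · rw [kap_of_le h]; exact Commute.one_right _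
  | inv_of i h => rw [map_inv]; exact h.inv_right
  | mul f g hf hg => rw [map_mul]; exact hf.mul_right hg

theorem Xh_commute {n : ℕ} {f g : FreeGroup ℕ} (hf : kap n f = f) (hg : kap n g = g)
    (h : Commute (Xh n f) (Xh n g)) : Commute f g := by
  have := kap_eq_of_Xh_eq (n := n) (f := f * g) (g := g * f) (by rw [map_mul, map_mul, h.eq])
  rwa [map_mul, map_mul, hf, hg] at this

theorem eq_one_of_centralizing : ∀ {m : ℕ} (Y : Set (ArtinB (m + 1))),
    (∀ y ∈ Y, eB (m + 1) y = y) → (∀ y ∈ Y, prm (m + 1) y = 1) →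
    (∀ y ∈ Y, ∀ a b, a ≠ b → L (m + 1) y (a, b) = 0) →
    (∀ p, eB (m + 1) p = p → prm (m + 1) p = 1 → ∀ y ∈ Y,
      ∃ ν ∈ Subgroup.closure Y, Commute (ν⁻¹ * p) y) → ∀ y ∈ Y, y = 1 := by
  intro m
  induction m with
  | zero =>
    intro Y hB _ _ _ y hy
    rw [← hB y hy]
    have : eB (0 + 1) = 1 := ArtinB.hom_ext (by
      intro i hi
      rw [eB_last (by omega), MonoidHom.one_apply])
    rw [this, MonoidHom.one_apply]
  | succ m ih =>
    intro Y hB hP hL h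
    have hcP : ∀ y ∈ Subgroup.closure Y, prm (m + 1 + 1) y = 1 := by
      intro y hy
      exact (Subgroup.closure_le (prm (m + 1 + 1)).ker).2 (fun y hy => hP y hy) hy
    have hcB : ∀ y ∈ Subgroup.closure Y, eB (m + 1 + 1) y = y := by
      intro y hy
      induction hy using Subgroup.closure_induction with
      | mem y hy => exact hB y hy
      | one => simp
      | mul x y _ _ hx hy => rw [map_mul, hx, hy]
      | inv x _ hx => rw [map_inv, hx]
    have hcL : ∀ y ∈ Subgroup.closure Y, ∀ a b, a ≠ b → L (m + 1 + 1) y (a, b) = 0 := by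
      intro y hy
      induction hy using Subgroup.closure_induction with
      | mem y hy => exact hL y hy
      | one => simp
      | mul x y hx' _ hx hy =>
        intro a b hab
        rw [L_mul_pure (hcP x hx'), Finsupp.add_apply, hx a b hab, hy a b hab, add_zero]
      | inv x hx' hx =>
        intro a b hab
        rw [L_inv_pure (hcP x hx'), Finsupp.neg_apply, hx a b hab, neg_zero]
    set Y' : Set (ArtinB (m + 1)) := jB (m + 1) ⁻¹' Y with hY'
    have hcl : Subgroup.closure Y = (Subgroup.closure Y').map (jB (m + 1)) := by
      rw [MonoidHom.map_closure, hY', Set.image_preimage_eq_of_subset]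
      intro y hy
      obtain ⟨z, hz⟩ := exists_jB_of_prm (g := y) (by rw [hP y hy]; rfl)
      exact ⟨z, by rw [← hz, hB y hy]⟩
    have hmem : ∀ y, y ∈ Subgroup.closure Y' → jB (m + 1) y ∈ Subgroup.closure Y := by
      intro y hy
      rw [hcl]
      exact Subgroup.mem_map_of_mem _ hy
    have hP' : ∀ y ∈ Subgroup.closure Y', prm (m + 1) y = 1 := by
      intro y hy
      rw [← prm_jB]
      exact hcP _ (hmem y hy)
    have hL' : ∀ y ∈ Subgroup.closure Y', ∀ a b, L (m + 1) y (a, b) = 0 := by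
      intro y hy a b
      rcases Nat.lt_or_ge a (m + 1) with ha | ha
      · rcases Nat.lt_or_ge b (m + 1) with hb | hb
        · rcases eq_or_ne a b with rfl | hab
          · have := hcL _ (hmem y hy) a (m + 1) (by omega)
            rwa [L_jB y a (m + 1) (by omega), if_neg (by omega), if_pos rfl] at this
          · have := hcL _ (hmem y hy) a b hab
            rwa [L_jB y a b hab, if_neg (by omega), if_neg (by omega)] at this
        · exact L_of_le (Or.inr hb) y
      · exact L_of_le (Or.inl ha) y
    have hh : ∀ p, prm (m + 1) p = 1 → ∀ y ∈ Y', ∃ ν ∈ Subgroup.closure Y',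
        Commute (ν⁻¹ * p) y := by
      intro p hp y hy
      obtain ⟨ν, hν, hc⟩ := h (jB (m + 1) p) (eB_jB p) (by rw [prm_jB, hp]) _ hy
      rw [hcl] at hν
      obtain ⟨μ, hμ, rfl⟩ := hν
      refine ⟨μ, hμ, ?_⟩
      rw [commute_iff_eq, ← mul_inv_eq_one]
      refine jB_injective (by omega) ?_
      rw [map_mul, map_inv, mul_inv_eq_one, map_mul, map_mul, map_mul, map_mul, map_inv]
      exact hc.eq
    have hone : ∀ y ∈ Y', eB (m + 1) y = 1 := by
      intro y hy
      refine ih (Set.image (eB (m + 1)) Y') ?_ ?_ ?_ ?_ _ (Set.mem_image_of_mem _ hy)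
      · rintro _ ⟨z, -, rfl⟩
        exact eB_eB z
      · rintro _ ⟨z, hz, rfl⟩
        rw [prm_eB]
        exact hP' z (Subgroup.subset_closure hz)
      · rintro _ ⟨z, hz, rfl⟩ a b hab
        rw [L_eB, if_neg hab]
        exact hL' z (Subgroup.subset_closure hz) a b
      · rintro p hp1 hp2 _ ⟨z, hz, rfl⟩
        obtain ⟨ν, hν, hc⟩ := hh p hp2 z hz
        refine ⟨eB (m + 1) ν, ?_, ?_⟩
        · rw [← MonoidHom.map_closure]
          exact Subgroup.mem_map_of_mem _ hν
        · have := hc.map (eB (m + 1))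
          rwa [map_mul, map_inv, hp1] at this
    have hone' : ∀ y ∈ Subgroup.closure Y', eB (m + 1) y = 1 := fun y hy =>
      (Subgroup.closure_le (eB (m + 1)).ker).2 (fun y hy => hone y hy) hy
    have hfree : ∀ y ∈ Subgroup.closure Y', ∃ f, kap (m + 1) f = f ∧ y = Xh (m + 1) f ∧
        ∀ a, a < m + 1 → ex a f = 0 := by
      intro y hy
      obtain ⟨f, hf, rfl⟩ := exists_Xh_of_eB_eq_one (hone' y hy)
      refine ⟨f, hf, rfl, fun a ha => ?_⟩
      have := hL' _ hy a a
      rwa [L_Xh, if_pos ⟨rfl, ha⟩] at this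
    have hcomm : ∀ f, kap (m + 1) f = f → Xh (m + 1) f ∈ Y' → ∀ i, i < m + 1 →
        ∃ g, (∀ a, a < m + 1 → ex a g = 0) ∧ Commute (g⁻¹ * of i) f := by
      intro f hf hfY i hi
      obtain ⟨ν, hν, hc⟩ := hh (X (m + 1) i) (prm_X _ _) _ hfY
      obtain ⟨g, hg, rfl, hg0⟩ := hfree ν hν
      refine ⟨g, hg0, Xh_commute (n := m + 1) ?_ hf ?_⟩
      · rw [map_mul, map_inv, hg, kap_of_lt hi]
      · rwa [map_mul, map_inv, Xh_of]
    intro y hy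
    obtain ⟨z, hz⟩ := exists_jB_of_prm (g := y) (by rw [hP y hy]; rfl)
    rw [hB y hy] at hz
    subst hz
    obtain ⟨f, hf, rfl, hf0⟩ := hfree z (Subgroup.subset_closure hy)
    suffices f = 1 by rw [this, map_one, map_one]
    rcases Nat.eq_zero_or_pos m with rfl | hm
    · obtain ⟨k, hk⟩ := Subgroup.mem_zpowers_iff.1
        (FreeGroup.mem_zpowers_of_commute (kap_one_commute hf))
      have := hf0 0 (by omega)
      rw [← hk, ex_zpow, ex_of] at this
      simp only [if_true, mul_one] at this
      rw [← hk, this, zpow_zero]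
    · obtain ⟨g, hg0, hg⟩ := hcomm f hf hy 0 (by omega)
      obtain ⟨g', hg0', hg'⟩ := hcomm f hf hy 1 (by omega)
      refine eq_one_of_commute_indep (i := 0) (j := 1) hg.symm hg'.symm ?_ ?_ ?_
      · rw [ex_mul, ex_inv, hg0 0 (by omega), ex_of]; simp
      · rw [ex_mul, ex_inv, hg0 1 (by omega), ex_of]; simp
      · rw [ex_mul, ex_inv, hg0' 1 (by omega), ex_of]; simp

end Braid

namespace Braid
open FreeGroup (of)

/-- The graph Laplacian of a weight function, evaluated at `u` and `a`. -/
noncomputable def lap (u : ℕ → ℤ) (a : ℕ) : PV →+ ℤ :=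
  Finsupp.liftAddHom fun xy =>
    if xy.1 = a then AddMonoidHom.mulRight (u a - u xy.2) else 0

theorem lap_single (u : ℕ → ℤ) (a x y : ℕ) (c : ℤ) :
    lap u a (Finsupp.single (x, y) c) = if x = a then c * (u a - u y) else 0 := by
  rw [lap, Finsupp.liftAddHom_apply_single]
  dsimp only
  split_ifs <;> rfl

theorem lap_mv (σ : Equiv.Perm ℕ) (u : ℕ → ℤ) (a : ℕ) (v : PV) :
    lap u a (mv σ v) = lap (fun k => u (σ k)) (σ⁻¹ a) v := by
  have : (lap u a).comp (mv σ).toAddMonoidHom = lap (fun k => u (σ k)) (σ⁻¹ a) := by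
    refine Finsupp.addHom_ext ?_
    rintro ⟨x, y⟩ c
    have h1 : x = σ⁻¹ a ↔ σ x = a := by rw [eq_comm, Equiv.Perm.inv_eq_iff_eq, eq_comm]
    have h2 : σ (σ⁻¹ a) = a := by simp
    simp only [AddMonoidHom.comp_apply, AddEquiv.coe_toAddMonoidHom, mv_single, lap_single, h1, h2]
  exact DFunLike.congr_fun this v

theorem lap_eq_sum {n : ℕ} {v : PV} (hv : ∀ a b, n ≤ a ∨ n ≤ b → v (a, b) = 0) (u : ℕ → ℤ)
    {a : ℕ} (ha : a < n) : lap u a v = ∑ b ∈ Finset.range n, v (a, b) * (u a - u b) := by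
  rw [lap, Finsupp.liftAddHom_apply,
    Finsupp.sum_of_support_subset v (s := Finset.range n ×ˢ Finset.range n), Finset.sum_product,
    Finset.sum_eq_single a]
  · simp
  · intro b _ hb
    refine Finset.sum_eq_zero fun y _ => ?_
    rw [if_neg hb]; rfl
  · intro h; simp [ha] at h
  · rintro ⟨x, y⟩ h
    rw [Finsupp.mem_support_iff] at h
    simp only [Finset.mem_product, Finset.mem_range]
    by_contra h'
    exact h (hv x y (by omega))
  · intro i _; exact map_zero _

theorem isUnit_one_add_X : IsUnit (1 + PowerSeries.X : PowerSeries ℤ) := by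
  rw [PowerSeries.isUnit_iff_constantCoeff]; simp

/-- The parameter of the Burau representation. -/
noncomputable def tU : (PowerSeries ℤ)ˣ := isUnit_one_add_X.unit

theorem tU_val : (tU : PowerSeries ℤ) = 1 + PowerSeries.X := isUnit_one_add_X.unit_spec

/-- The Burau generator. -/
noncomputable def bg (i : ℕ) : (ℕ → PowerSeries ℤ) ≃ₗ[PowerSeries ℤ] (ℕ → PowerSeries ℤ) where
  toFun v k := if k = i then (1 - tU) * v i + tU * v (i + 1) else if k = i + 1 then v i else v k
  invFun v k := if k = i then v (i + 1) else
    if k = i + 1 then (tU⁻¹ : (PowerSeries ℤ)ˣ) * (v i - (1 - tU) * v (i + 1)) else v k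
  map_add' v w := by
    ext1 k; simp only [Pi.add_apply]; split_ifs <;> ring
  map_smul' c v := by
    ext1 k; simp only [Pi.smul_apply, smul_eq_mul, RingHom.id_apply]; split_ifs <;> ring
  left_inv v := by
    have a1 : ¬ i + 1 = i := by omega
    have : ((tU⁻¹ : (PowerSeries ℤ)ˣ) : PowerSeries ℤ) * tU = 1 := by simp
    ext1 k
    rcases eq_or_ne k i with rfl | h1
    · simp
    · rcases eq_or_ne k (i + 1) with rfl | h2
      · simp only [a1, if_true, if_false]
        linear_combination (v (i + 1)) * this
      · simp [h1, h2]
  right_inv v := by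
    have a1 : ¬ i + 1 = i := by omega
    have : ((tU⁻¹ : (PowerSeries ℤ)ˣ) : PowerSeries ℤ) * tU = 1 := by simp
    ext1 k
    rcases eq_or_ne k i with rfl | h1
    · simp only [a1, if_true, if_false]
      linear_combination (v k - (1 - tU) * v (k + 1)) * this
    · rcases eq_or_ne k (i + 1) with rfl | h2
      · simp
      · simp [h1, h2]

theorem bg_apply (i : ℕ) (v : ℕ → PowerSeries ℤ) (k : ℕ) : bg i v k =
    if k = i then (1 - tU) * v i + tU * v (i + 1) else if k = i + 1 then v i else v k := rfl

/-- The Burau representation. -/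
noncomputable def bur (n : ℕ) :
    ArtinB n →* ((ℕ → PowerSeries ℤ) ≃ₗ[PowerSeries ℤ] (ℕ → PowerSeries ℤ)) :=
  ArtinB.lift n (fun i => if i + 1 < n then bg i else 1)
    (by
      intro i hi
      rw [if_pos (by omega), if_pos (by omega)]
      ext v k : 2
      simp only [LinearEquiv.mul_apply, bg_apply]
      generalize (tU : PowerSeries ℤ) = t
      have a1 : ¬ i + 1 = i := by omega
      have a2 : ¬ i + 1 + 1 = i := by omega
      have a3 : ¬ i + 1 + 1 = i + 1 := by omega
      have a4 : ¬ i = i + 1 := by omega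
      have a5 : ¬ i = i + 1 + 1 := by omega
      have a6 : ¬ i + 1 = i + 1 + 1 := by omega
      rcases eq_or_ne k i with rfl | h1
      · simp only [a1, a2, a3, a4, a5, a6, if_true, if_false]; ring
      · rcases eq_or_ne k (i + 1) with rfl | h2
        · simp only [a1, a2, a3, a4, a5, a6, if_true, if_false]
        · rcases eq_or_ne k (i + 1 + 1) with rfl | h3
          · simp only [a1, a2, a3, a4, a5, a6, if_true, if_false]
          · simp only [h1, h2, h3, if_false])
    (by
      intro i hi
      rw [if_pos (by omega), if_neg (by omega), mul_one, one_mul, mul_one])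
    (by
      intro i j h1 h2
      rw [if_pos (by omega)]
      split
      · ext v k : 2
        simp only [LinearEquiv.mul_apply, bg_apply]
        split_ifs <;> first | omega | rfl
      · rw [mul_one, one_mul])

theorem bur_coeff {n : ℕ} (g : ArtinB n) : ∀ (v : ℕ → PowerSeries ℤ) (k : ℕ),
    PowerSeries.coeff 0 (bur n g v k) = PowerSeries.coeff 0 (v ((prm n g)⁻¹ k)) ∧
    PowerSeries.coeff 1 (bur n g v k) = PowerSeries.coeff 1 (v ((prm n g)⁻¹ k)) +
      lap (fun j => PowerSeries.coeff 0 (v ((prm n g)⁻¹ j))) k (L n g) := by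
  refine sB_induction (P := fun g => ∀ (v : ℕ → PowerSeries ℤ) (k : ℕ),
    PowerSeries.coeff 0 (bur n g v k) = PowerSeries.coeff 0 (v ((prm n g)⁻¹ k)) ∧
    PowerSeries.coeff 1 (bur n g v k) = PowerSeries.coeff 1 (v ((prm n g)⁻¹ k)) +
      lap (fun j => PowerSeries.coeff 0 (v ((prm n g)⁻¹ j))) k (L n g)) ?_ ?_ ?_ ?_ g
  · intro v k
    simp
  · intro i hi v k
    rw [bur, ArtinB.lift_sB hi]
    split_ifs with h
    · rw [prm_sB h, L_sB h, lap_single, bg_apply, Equiv.swap_inv, tU_val]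
      rcases eq_or_ne k i with rfl | h1
      · have e : ∀ v : PowerSeries ℤ, PowerSeries.coeff 1 (PowerSeries.X * v) =
            PowerSeries.coeff 0 v := fun v => PowerSeries.coeff_succ_X_mul 0 v
        have e0 : ∀ v : PowerSeries ℤ, PowerSeries.coeff 0 (PowerSeries.X * v) = 0 :=
          PowerSeries.coeff_zero_X_mul
        rw [if_pos rfl, if_pos rfl, Equiv.swap_apply_left, Equiv.swap_apply_right,
          show (1 - (1 + PowerSeries.X)) * v k + (1 + PowerSeries.X) * v (k + 1) =
            v (k + 1) + PowerSeries.X * v (k + 1) - PowerSeries.X * v k by ring]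
        simp only [map_add, map_sub, e, e0]
        constructor <;> ring
      · rcases eq_or_ne k (i + 1) with rfl | h2
        · simp
        · simp [h1, h1.symm, h2, Equiv.swap_apply_of_ne_of_ne]
    · rw [prm_last (by omega), L_last (by omega), lap_single]
      simp only [inv_one, Equiv.Perm.one_apply]
      rcases eq_or_ne i k with rfl | h1
      · simp
      · simp [h1]
  · intro g h hg hh v k
    have hg1 := hg (bur n h v) k
    have hh1 := hh v ((prm n g)⁻¹ k)
    rw [map_mul, LinearEquiv.mul_apply, map_mul, L_mul, map_add, lap_mv]
    simp only [mul_inv_rev, Equiv.Perm.mul_apply]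
    refine ⟨hg1.1.trans hh1.1, ?_⟩
    rw [hg1.2, hh1.2, add_assoc, add_comm (lap _ _ (L n h))]
    congr 2
    · congr 2
      funext j
      exact (hh v _).1
    · simp
  · intro g hg v k
    have key := fun k => hg (bur n g⁻¹ v) k
    have e : ∀ v, bur n g (bur n g⁻¹ v) = v := by
      intro v
      rw [← LinearEquiv.mul_apply, ← map_mul, mul_inv_cancel, map_one]; rfl
    rw [e v] at key
    have e2 : (prm n g)⁻¹ (prm n g k) = k := by simp
    have k1 := key (prm n g k)
    rw [e2] at k1
    rw [map_inv (prm n), inv_inv]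
    simp only [L_inv, map_inv (prm n), inv_inv, map_neg, lap_mv]
    refine ⟨k1.1.symm, ?_⟩
    have e3 : ∀ x, prm n g ((prm n g)⁻¹ x) = x := by simp
    have : lap (fun j => PowerSeries.coeff 0 (bur n g⁻¹ v ((prm n g)⁻¹ j))) (prm n g k) (L n g)
        = lap (fun j => PowerSeries.coeff 0 (v j)) (prm n g k) (L n g) := by
      congr 2
      funext j
      exact (key j).1.symm
    rw [this] at k1
    simp only [e3]
    linarith [k1.2]

theorem bur_coeff_two {n : ℕ} {p q : ArtinB n} (hp : prm n p = 1) (hq : prm n q = 1)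
    (v : ℕ → PowerSeries ℤ) (a : ℕ) :
    PowerSeries.coeff 2 (bur n (p * q) v a) = PowerSeries.coeff 2 (bur n p v a) +
      PowerSeries.coeff 2 (bur n q v a) - PowerSeries.coeff 2 (v a) +
      lap (fun k => lap (fun j => PowerSeries.coeff 0 (v j)) k (L n q)) a (L n p) := by
  have h0 : ∀ k, ∃ U, bur n q v k - v k = PowerSeries.X * U := by
    intro k
    have := (bur_coeff q v k).1
    rw [hq, inv_one, Equiv.Perm.one_apply] at this
    refine PowerSeries.X_dvd_iff.2 ?_
    rw [← PowerSeries.coeff_zero_eq_constantCoeff_apply, map_sub, this, sub_self]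
  choose U hU using h0
  have hqv : bur n q v = v + (PowerSeries.X : PowerSeries ℤ) • U := by
    ext1 k
    rw [Pi.add_apply, Pi.smul_apply, smul_eq_mul, ← hU, add_sub_cancel]
  have hU0 : ∀ k, PowerSeries.coeff 0 (U k) =
      lap (fun j => PowerSeries.coeff 0 (v j)) k (L n q) := by
    intro k
    have h1 := (bur_coeff q v k).2
    have h2 := PowerSeries.coeff_succ_X_mul 0 (U k)
    rw [← hU, map_sub, zero_add, h1, hq] at h2
    simp only [inv_one, Equiv.Perm.one_apply] at h2
    rw [← h2]
    ring
  have h3 : bur n (p * q) v = bur n p v + (PowerSeries.X : PowerSeries ℤ) • bur n p U := by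
    rw [map_mul, LinearEquiv.mul_apply, hqv, map_add, map_smul]
  have h4 := (bur_coeff p U a).2
  simp only [hp, inv_one, Equiv.Perm.one_apply, hU0] at h4
  have h5 := hU a
  have h6 := congrArg (PowerSeries.coeff 2) h5
  rw [map_sub, PowerSeries.coeff_succ_X_mul 1] at h6
  rw [h3, Pi.add_apply, Pi.smul_apply, smul_eq_mul, map_add, PowerSeries.coeff_succ_X_mul 1, h4]
  linarith

theorem lap_comm {n : ℕ} {p q : ArtinB n} (hp : prm n p = 1) (hq : prm n q = 1)
    (h : Commute p q) (u : ℕ → ℤ) (a : ℕ) :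
    lap (fun k => lap u k (L n q)) a (L n p) = lap (fun k => lap u k (L n p)) a (L n q) := by
  have h1 := bur_coeff_two hp hq (fun k => PowerSeries.C (u k)) a
  have h2 := bur_coeff_two hq hp (fun k => PowerSeries.C (u k)) a
  rw [h.eq, h2] at h1
  simp only [PowerSeries.coeff_zero_C] at h1
  linarith

end Braid

namespace Braid
open FreeGroup (of)

/-- The palindromes `s_{k-1} ⋯ s_0 s_0 ⋯ s_{k-1}`. -/
def dl (n : ℕ) : ℕ → ArtinB n
  | 0 => 1
  | k + 1 => sB n k * dl n k * sB n k

theorem dl_comm_of_lt {n k j : ℕ} (h : k < j) : Commute (sB n j) (dl n k) := by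
  induction k with
  | zero => exact Commute.one_right _
  | succ k ih =>
    have := (sB_comm (n := n) (show k + 2 ≤ j by omega)).symm
    exact (this.mul_right (ih (by omega))).mul_right this

theorem dl_comm {n k i : ℕ} (h : i + 1 < k) (hk : k < n) : Commute (sB n i) (dl n k) := by
  induction k with
  | zero => omega
  | succ k ih =>
    rcases Nat.lt_or_ge (i + 1) k with h1 | h1
    · have := sB_comm (n := n) (show i + 2 ≤ k by omega)
      exact (this.mul_right (ih h1 (by omega))).mul_right this
    · obtain rfl : k = i + 1 := by omega
      have b := sB_braid (n := n) (i := i) (by omega)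
      have c := (dl_comm_of_lt (n := n) (k := i) (j := i + 1) (by omega)).eq
      change sB n i * (sB n (i + 1) * (sB n i * dl n i * sB n i) * sB n (i + 1)) =
        sB n (i + 1) * (sB n i * dl n i * sB n i) * sB n (i + 1) * sB n i
      generalize sB n i = s at *
      generalize sB n (i + 1) = t at *
      generalize dl n i = d at *
      calc s * (t * (s * d * s) * t) = (s * t * s) * d * s * t := by group
        _ = t * s * (t * d) * s * t := by rw [b]; group
        _ = t * s * d * (t * s * t) := by rw [c]; group
        _ = t * (s * d * s) * t * s := by rw [← b]; group

theorem dl_comm_dl {n k l : ℕ} (h : l < k) (hk : k < n) : Commute (dl n l) (dl n k) := by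
  induction l with
  | zero => exact Commute.one_left _
  | succ l ih =>
    have := dl_comm (n := n) (show l + 1 < k by omega) hk
    exact (this.mul_left (ih (by omega))).mul_left this

/-- The automorphism inverting every `t_i` and fixing `ρ`. -/
def iB (n : ℕ) : ArtinB n →* ArtinB n :=
  ArtinB.lift n (fun i => if i + 1 < n then (sB n i)⁻¹ else dl n i * sB n i)
    (by
      intro i hi
      rw [if_pos (by omega), if_pos (by omega)]
      have := congrArg (·⁻¹) (sB_braid hi)
      simpa [mul_assoc] using this)
    (by
      intro i hi
      rw [if_pos (by omega), if_neg (by omega)]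
      have f := sB_four hi
      have c := (dl_comm_of_lt (n := n) (k := i) (j := i + 1) (by omega)).eq
      have d : dl n i * (sB n i * dl n i * sB n i) = sB n i * dl n i * sB n i * dl n i :=
        (dl_comm_dl (n := n) (show i < i + 1 by omega) (by omega)).eq
      have e : dl n (i + 1) = sB n i * dl n i * sB n i := rfl
      rw [e]
      generalize dl n i = δ at *
      generalize sB n i = a at *
      generalize sB n (i + 1) = b at *
      have f' : b * a * b = a * b * a * b * a⁻¹ := by rw [f]; group
      calc a⁻¹ * (a * δ * a * b) * a⁻¹ * (a * δ * a * b) = δ * a * (b * δ) * a * b := by group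
        _ = δ * a * δ * (b * a * b) := by rw [c]; group
        _ = (δ * (a * δ * a)) * b * a * b * a⁻¹ := by rw [f']; group
        _ = a * δ * a * (δ * b) * a * b * a⁻¹ := by rw [d]; group
        _ = a * δ * a * b * a⁻¹ * (a * δ * a * b) * a⁻¹ := by rw [← c]; group)
    (by
      intro i j h1 h2
      rw [if_pos (by omega)]
      split
      · exact ((sB_comm h1).inv_inv).eq
      · exact ((dl_comm (by omega) h2).mul_right (sB_comm h1)).inv_left.eq)

theorem iB_sB {n i : ℕ} (h : i + 1 < n) : iB n (sB n i) = (sB n i)⁻¹ := by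
  rw [iB, ArtinB.lift_sB (by omega), if_pos h]

theorem iB_last {n i : ℕ} (h : i + 1 = n) : iB n (sB n i) = dl n i * sB n i := by
  rw [iB, ArtinB.lift_sB (by omega), if_neg (by omega)]

theorem iB_pr {n : ℕ} : ∀ k, k < n → iB n (pr n k) * dl n k = pr n k := by
  intro k
  induction k with
  | zero => intro _; simp [dl]
  | succ k ih =>
    intro hk
    rw [pr_succ, map_mul, iB_sB hk, dl]
    conv_rhs => rw [← ih (by omega)]
    group

theorem rho_succ {m : ℕ} : ρB (m + 1) = pr (m + 1) m * sB (m + 1) m := by rw [rhoB_eq, pr_succ]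

theorem iB_rho {m : ℕ} : iB (m + 1) (ρB (m + 1)) = ρB (m + 1) := by
  rw [rho_succ, map_mul, iB_last rfl, ← mul_assoc, iB_pr _ (by omega)]

theorem hom_ext_rho {m : ℕ} {H : Type*} [Group H] {f g : ArtinB (m + 1) →* H}
    (h : ∀ i, i < m → f (sB (m + 1) i) = g (sB (m + 1) i))
    (hρ : f (ρB (m + 1)) = g (ρB (m + 1))) : f = g := by
  have hp : ∀ k, k ≤ m → f (pr (m + 1) k) = g (pr (m + 1) k) := by
    intro k
    induction k with
    | zero => simp
    | succ k ih =>
      intro hk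
      rw [pr_succ, map_mul, map_mul, ih (by omega), h k (by omega)]
  refine ArtinB.hom_ext fun i hi => ?_
  rcases Nat.lt_or_ge i m with h1 | h1
  · exact h i h1
  · obtain rfl : i = m := by omega
    rw [rho_succ, map_mul, map_mul, hp i le_rfl] at hρ
    exact mul_left_cancel hρ

theorem iB_iB {m : ℕ} (g : ArtinB (m + 1)) : iB (m + 1) (iB (m + 1) g) = g := by
  have : (iB (m + 1)).comp (iB (m + 1)) = MonoidHom.id _ := by
    refine hom_ext_rho (fun i hi => ?_) ?_
    · simp [iB_sB (show i + 1 < m + 1 by omega)]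
    · simp [iB_rho]
  exact DFunLike.congr_fun this g

theorem prm_dl {n k : ℕ} (hk : k < n) : prm n (dl n k) = 1 := by
  induction k with
  | zero => simp [dl]
  | succ k ih =>
    rw [dl, map_mul, map_mul, ih (by omega), mul_one, prm_sB hk, Equiv.swap_mul_self]

theorem L_dl {n : ℕ} : ∀ k, k < n → ∀ a b, L n (dl n k) (a, b) =
    if b = k ∧ a < k ∨ a = k ∧ b < k then 1 else 0 := by
  intro k
  induction k with
  | zero => intro _ a b; simp [dl]
  | succ k ih =>
    intro hk a b
    have key : ∀ c, (c = k ∧ Equiv.swap k (k + 1) c = k + 1) ∨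
        (c = k + 1 ∧ Equiv.swap k (k + 1) c = k) ∨
        (c ≠ k ∧ c ≠ k + 1 ∧ Equiv.swap k (k + 1) c = c) := by
      intro c
      rw [Equiv.swap_apply_def]
      split_ifs <;> omega
    have ha := key a
    have hb := key b
    rw [dl, L_mul, L_mul, L_sB hk, map_mul, prm_dl (by omega), mul_one, prm_sB hk, mv_single,
      Equiv.swap_apply_left, Equiv.swap_apply_right, Finsupp.add_apply, Finsupp.add_apply,
      mv_apply, ih (by omega), Equiv.swap_inv]
    generalize Equiv.swap k (k + 1) a = a' at *
    generalize Equiv.swap k (k + 1) b = b' at *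
    clear key ih
    simp only [Finsupp.single_apply, Prod.mk.injEq]
    rcases ha with ha | ha | ha <;> rcases hb with hb | hb | hb <;> split_ifs <;> omega

theorem prm_iB {n : ℕ} (g : ArtinB n) : prm n (iB n g) = prm n g := by
  have : (prm n).comp (iB n) = prm n := by
    refine ArtinB.hom_ext fun i hi => ?_
    rcases Nat.lt_or_ge (i + 1) n with h | h
    · rw [MonoidHom.comp_apply, iB_sB h, map_inv, prm_sB h, Equiv.swap_inv]
    · rw [MonoidHom.comp_apply, iB_last (by omega), map_mul, prm_dl hi, one_mul]
  exact DFunLike.congr_fun this g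

theorem L_iB {n : ℕ} (g : ArtinB n) : ∀ a b, a < n → b < n → L n (iB n g) (a, b) =
    if a = b then L n g (a, a) else L n g (a, a) + L n g (b, b) - L n g (b, a) := by
  refine sB_induction (P := fun g => ∀ a b, a < n → b < n → L n (iB n g) (a, b) =
    if a = b then L n g (a, a) else L n g (a, a) + L n g (b, b) - L n g (b, a)) ?_ ?_ ?_ ?_ g
  · intro a b _ _; simp
  · intro i hi a b ha hb
    rcases Nat.lt_or_ge (i + 1) n with h | h
    · rw [iB_sB h, L_inv, L_sB h, map_inv, prm_sB h, Equiv.swap_inv, mv_single,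
        Equiv.swap_apply_left, Equiv.swap_apply_right]
      simp only [Finsupp.neg_apply, Finsupp.single_apply, Prod.mk.injEq]
      split_ifs <;> omega
    · rw [iB_last (by omega), L_mul_pure (prm_dl hi), L_last (by omega), Finsupp.add_apply,
        L_dl i hi]
      simp only [Finsupp.single_apply, Prod.mk.injEq]
      split_ifs <;> omega
  · intro g h hg hh a b ha hb
    have e := hh _ _ (prm_lt ha g⁻¹) (prm_lt hb g⁻¹)
    rw [map_inv] at e
    simp only [map_mul, L_mul, Finsupp.add_apply, mv_apply, hg a b ha hb, e, prm_iB,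
      EmbeddingLike.apply_eq_iff_eq]
    split_ifs <;> ring
  · intro g hg a b ha hb
    have e := hg _ _ (prm_lt ha g) (prm_lt hb g)
    simp only [map_inv, L_inv, Finsupp.neg_apply, mv_apply, e, prm_iB, inv_inv,
      EmbeddingLike.apply_eq_iff_eq]
    split_ifs <;> ring

end Braid

namespace Braid
open FreeGroup (of)

theorem sB_comm_Xh_D {n i : ℕ} (h : i + 1 < n) : Commute (sB n i) (Xh n (D n)) := by
  have := conj_Xh (sB n i) (D n)
  rw [act_sB h, ht_D (by omega)] at this
  exact mul_inv_eq_iff_eq_mul.1 this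

/-- The images of the generators under the automorphism inverting `ρ`. -/
def nuGen (n i : ℕ) : ArtinB n :=
  if i + 1 < n then (sB n (n - 2 - i))⁻¹ else Xh n ((D n)⁻¹ * (of 0)⁻¹ * D n)

theorem four_X_zero {n : ℕ} (h : 1 < n) : sB n 0 * X n 0 * sB n 0 * X n 0 =
    X n 0 * sB n 0 * X n 0 * sB n 0 := by
  have e1 := sB_conj_X (n := n) (i := 0) h
  have e2 := sB_conj_X_succ (n := n) (i := 0) h
  rw [zero_add] at e1 e2
  generalize sB n 0 = s at *
  generalize X n 0 = x at *
  rw [← e1] at e2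
  have e3 : x * s * x * s = x * (s * x * s⁻¹) * (s * s) := by group
  have e4 : s * x * s * x = (s * x * s⁻¹) * (s * (s * x * s⁻¹) * s⁻¹) * (s * s) := by group
  rw [e3, e4, e2]
  group

/-- The automorphism reversing the indices and inverting `ρ`. -/
def nB (n : ℕ) : ArtinB n →* ArtinB n :=
  ArtinB.lift n (nuGen n)
    (by
      intro i hi
      rw [nuGen, nuGen, if_pos (by omega), if_pos (by omega)]
      obtain ⟨j, hj⟩ : ∃ j, n = i + j + 3 := ⟨n - i - 3, by omega⟩
      rw [show n - 2 - i = j + 1 by omega, show n - 2 - (i + 1) = j by omega]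
      have := congrArg (·⁻¹) (sB_braid (n := n) (i := j) (by omega))
      simpa [mul_assoc] using this.symm)
    (by
      intro i hi
      rw [nuGen, nuGen, if_pos (by omega), if_neg (by omega), show n - 2 - i = 0 by omega]
      have c := (sB_comm_Xh_D (n := n) (i := 0) (by omega)).eq
      have f := congrArg (fun g => (Xh n (D n))⁻¹ * g⁻¹ * Xh n (D n))
        (four_X_zero (n := n) (by omega))
      rw [map_mul, map_mul, map_inv, map_inv, Xh_of]
      generalize Xh n (D n) = d at *
      generalize sB n 0 = s at *
      generalize X n 0 = x at *
      have c' : s⁻¹ = d⁻¹ * s⁻¹ * d := by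
        rw [eq_comm, mul_assoc, inv_mul_eq_iff_eq_mul, eq_mul_inv_iff_mul_eq, mul_assoc,
          inv_mul_eq_iff_eq_mul]
        exact c.symm
      rw [c']
      simp only [mul_inv_rev] at f
      calc _ = d⁻¹ * (s⁻¹ * (x⁻¹ * (s⁻¹ * x⁻¹))) * d := by group
        _ = d⁻¹ * (x⁻¹ * (s⁻¹ * (x⁻¹ * s⁻¹))) * d := f.symm
        _ = _ := by group)
    (by
      intro i j h1 h2
      rw [nuGen, nuGen, if_pos (by omega)]
      split
      · exact ((sB_comm (n := n) (show n - 2 - j + 2 ≤ n - 2 - i by omega)).inv_inv).symm.eq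
      · have c := sB_comm_Xh_D (n := n) (i := n - 2 - i) (by omega)
        have d := sB_comm_X_of_gt (n := n) (i := n - 2 - i) (k := 0) (by omega) (by omega)
        rw [map_mul, map_mul, map_inv, map_inv, Xh_of]
        exact (((c.inv_right).mul_right d.inv_right).mul_right c).inv_left.eq)

theorem nB_sB {n i : ℕ} (h : i + 1 < n) : nB n (sB n i) = (sB n (n - 2 - i))⁻¹ := by
  rw [nB, ArtinB.lift_sB (by omega), nuGen, if_pos h]

theorem nB_last {n i : ℕ} (h : i + 1 = n) :
    nB n (sB n i) = Xh n ((D n)⁻¹ * (of 0)⁻¹ * D n) := by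
  rw [nB, ArtinB.lift_sB (by omega), nuGen, if_neg (by omega)]

theorem nB_pr {n : ℕ} : ∀ k, k < n → pr n (n - 1 - k) * (nB n (pr n k))⁻¹ = cB n := by
  intro k
  induction k with
  | zero => intro _; simp [cB]
  | succ k ih =>
    intro hk
    rw [← ih (by omega), pr_succ, map_mul, nB_sB hk, show n - 1 - k = n - 1 - (k + 1) + 1 by omega,
      pr_succ, show n - 2 - k = n - 1 - (k + 1) by omega]
    group

theorem nB_cB {n : ℕ} (hn : 0 < n) : nB n (cB n) = (cB n)⁻¹ := by
  have := nB_pr (n := n) (n - 1) (by omega)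
  rw [Nat.sub_self, pr_zero, one_mul] at this
  rw [inv_eq_iff_eq_inv, ← cB] at this
  exact this

theorem nB_rho {n : ℕ} (hn : 0 < n) : nB n (ρB n) = (ρB n)⁻¹ := by
  have h := conj_Xh (pr n (n - 1)) (of (n - 1))
  rw [act_pr_self (by omega), show n - 1 + 1 = n by omega, ← cB, Xh_of] at h
  rw [rho_eq_cB hn, map_mul, nB_cB hn, X_last (by omega), nB_last (by omega),
    show (D n)⁻¹ * (of 0)⁻¹ * D n = ((D n)⁻¹ * of 0 * D n)⁻¹ by group, map_inv, ← h,
    X_last (by omega)]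
  group

theorem nB_nB {m : ℕ} (g : ArtinB (m + 1)) : nB (m + 1) (nB (m + 1) g) = g := by
  have : (nB (m + 1)).comp (nB (m + 1)) = MonoidHom.id _ := by
    refine hom_ext_rho (fun i hi => ?_) ?_
    · rw [MonoidHom.comp_apply, nB_sB (by omega), map_inv, nB_sB (by omega), inv_inv,
        show m + 1 - 2 - (m + 1 - 2 - i) = i by omega, MonoidHom.id_apply]
    · simp [nB_rho]
  exact DFunLike.congr_fun this g

theorem nB_Delta {n : ℕ} (hn : 0 < n) : nB n (ΔB n) = (ΔB n)⁻¹ := by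
  rw [ΔB, map_pow, nB_rho hn, inv_pow]

theorem iB_Delta {m : ℕ} : iB (m + 1) (ΔB (m + 1)) = ΔB (m + 1) := by
  rw [ΔB, map_pow, iB_rho]

theorem nB_Xh_D {n : ℕ} (hn : 0 < n) : nB n (Xh n (D n)) = (Xh n (D n))⁻¹ := by
  have h := Delta_eq hn
  have h' : Xh n (D n) = ΔB n * (cB n ^ n)⁻¹ := by rw [h]; group
  rw [h', map_mul, nB_Delta hn, map_inv, map_pow, nB_cB hn, mul_inv_rev, inv_pow, inv_inv]
  exact ((Delta_commute hn _).inv_left).eq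

theorem nB_X {n : ℕ} : ∀ i, i < n →
    nB n (X n i) = Xh n ((D n)⁻¹ * (of (n - 1 - i))⁻¹ * D n) := by
  refine desc_induction (fun i hi => ?_) (fun i hi ih => ?_)
  · rw [X_last hi, nB_last hi, show n - 1 - i = 0 by omega]
  · rw [X_eq hi, map_mul, map_mul, map_inv, nB_sB hi, inv_inv, ih, conj_Xh, act_sB (by omega)]
    simp only [map_mul, map_inv]
    rw [ht_D (by omega), show n - 1 - (i + 1) = n - 2 - i by omega, ht_self,
      show n - 2 - i + 1 = n - 1 - i by omega]

theorem tB_succ {n i : ℕ} (h : i + 1 < n) : tB n (i + 1) = sB n i := by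
  rw [tB, Nat.mod_eq_of_lt h, if_neg (by omega)]; rfl

theorem tB_zero {m : ℕ} : tB (m + 2) 0 = ρB (m + 2) * sB (m + 2) m * (ρB (m + 2))⁻¹ := rfl

theorem tB_self {n : ℕ} : tB n n = tB n 0 := by simp [tB]

theorem iB_tB {m i : ℕ} (h : i < m + 2) : iB (m + 2) (tB (m + 2) i) = (tB (m + 2) i)⁻¹ := by
  rcases i with _ | i
  · rw [tB_zero, map_mul, map_mul, map_inv, iB_rho, iB_sB (by omega)]
    group
  · rw [tB_succ h, iB_sB h]

theorem rho_pow_conj {n : ℕ} (k : ℕ) (hk : k + 1 < n) :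
    ρB n ^ k * sB n 0 = sB n k * ρB n ^ k := by
  induction k with
  | zero => simp
  | succ k ih =>
    rw [pow_succ', mul_assoc, ih (by omega), ← mul_assoc, rho_shift hk, mul_assoc]

theorem nB_tB {m i : ℕ} (h : i < m + 2) :
    nB (m + 2) (tB (m + 2) i) = (tB (m + 2) (m + 2 - i))⁻¹ := by
  rcases i with _ | i
  · rw [Nat.sub_zero, tB_self, tB_zero, map_mul, map_mul, map_inv, nB_rho (by omega),
      nB_sB (by omega), show m + 2 - 2 - m = 0 by omega]
    have h1 := rho_pow_conj (n := m + 2) m (by omega)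
    have h2 := (Delta_commute (n := m + 2) (by omega) (sB (m + 2) 0)).eq
    rw [ΔB] at h2
    generalize ρB (m + 2) = r at *
    rw [show sB (m + 2) m = r ^ m * sB (m + 2) 0 * (r ^ m)⁻¹ from eq_mul_inv_of_mul_eq h1.symm]
    generalize sB (m + 2) 0 = s at *
    rw [← mul_inv_eq_iff_eq_mul] at h2
    rw [← inv_inj]
    simp only [mul_inv_rev, inv_inv]
    calc r⁻¹ * (s * r) = r⁻¹ * (r ^ (m + 2) * s * (r ^ (m + 2))⁻¹) * r := by rw [h2]; group
      _ = _ := by rw [pow_add]; simp only [pow_two, mul_inv_rev]; group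
  · rw [tB_succ h, nB_sB h, show m + 2 - (i + 1) = m - i + 1 by omega, tB_succ (by omega),
      show m + 2 - 2 - i = m - i by omega]

end Braid

namespace Braid

/-- A sequence of elements satisfying the braid relations on `N` strands,
adjacent ones not commuting. -/
structure BraidSeq {Q : Type*} [Group Q] (N : ℕ) (s : ℕ → Q) : Prop where
  braid : ∀ i, i + 2 < N → s i * s (i + 1) * s i = s (i + 1) * s i * s (i + 1)
  comm : ∀ i j, i + 2 ≤ j → j + 1 < N → Commute (s i) (s j)
  not_comm : ∀ i, i + 2 < N → ¬ Commute (s i) (s (i + 1))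

/-- The band generators. -/
def band {Q : Type*} [Group Q] (s : ℕ → Q) (i : ℕ) : ℕ → Q
  | 0 => s i
  | d + 1 => s (i + 1 + d) * band s i d * (s (i + 1 + d))⁻¹

theorem commute_conj_iff {G : Type*} [Group G] {a g x : G} (h : Commute a g) :
    Commute a (g * x * g⁻¹) ↔ Commute a x := by
  rw [← Commute.conj_iff g⁻¹]
  have e1 : g⁻¹ * a * g⁻¹⁻¹ = a := by
    rw [inv_inv, mul_assoc, h.eq, inv_mul_cancel_left]
  rw [e1, show g⁻¹ * (g * x * g⁻¹) * g⁻¹⁻¹ = x by group]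

theorem commute_conj_iff' {G : Type*} [Group G] {a g x : G} (h : Commute a g) :
    Commute a (g⁻¹ * x * g) ↔ Commute a x := by
  have := commute_conj_iff (x := x) h.inv_right
  rwa [inv_inv] at this

namespace BraidSeq
variable {Q : Type*} [Group Q] {N : ℕ} {s : ℕ → Q}

theorem comm_gt (hs : BraidSeq N s) {m i d : ℕ} (h : i + d + 1 < m) (hm : m + 1 < N) :
    Commute (s m) (band s i d) := by
  induction d with
  | zero => exact (hs.comm i m (by omega) hm).symm
  | succ d ih =>
    rw [band, commute_conj_iff (hs.comm _ _ (by omega) hm).symm]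
    exact ih (by omega)

theorem comm_lt (hs : BraidSeq N s) {m i d : ℕ} (h : m + 1 < i) (hd : i + d + 1 < N) :
    Commute (s m) (band s i d) := by
  induction d with
  | zero => exact hs.comm m i (by omega) (by omega)
  | succ d ih =>
    rw [band, commute_conj_iff (hs.comm _ _ (by omega) (by omega))]
    exact ih (by omega)

theorem band_left (hs : BraidSeq N s) {i d : ℕ} (hd : i + d + 2 < N) :
    band s i (d + 1) = (s i)⁻¹ * band s (i + 1) d * s i := by
  induction d with
  | zero =>
    have := hs.braid i (by omega)
    rw [band, band, band, add_zero, mul_inv_eq_iff_eq_mul]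
    rw [mul_assoc, mul_assoc, eq_inv_mul_iff_mul_eq, ← mul_assoc, this, mul_assoc]
  | succ d ih =>
    rw [band, ih (by omega), band, show i + 1 + (d + 1) = i + 1 + 1 + d by omega]
    have := hs.comm i (i + 1 + 1 + d) (by omega) (by omega)
    generalize s i = a at *
    generalize s (i + 1 + 1 + d) = t at *
    have e1 : t * a⁻¹ = a⁻¹ * t := this.inv_left.eq.symm
    have e2 : a * t⁻¹ = t⁻¹ * a := this.inv_right.eq
    calc _ = (t * a⁻¹) * band s (i + 1) d * (a * t⁻¹) := by group
      _ = _ := by rw [e1, e2]; group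

theorem not_comm_right (hs : BraidSeq N s) {m i d : ℕ} (h : m = i + d + 1) (hm : m + 1 < N) :
    ¬ Commute (s m) (band s i d) := by
  induction d generalizing i with
  | zero => subst h; exact fun h => hs.not_comm i (by omega) h.symm
  | succ d ih =>
    rw [hs.band_left (by omega), commute_conj_iff' (hs.comm i m (by omega) hm).symm]
    exact ih (by omega)

theorem not_comm_left (hs : BraidSeq N s) {m i d : ℕ} (h : m + 1 = i) (hd : i + d + 1 < N) :
    ¬ Commute (s m) (band s i d) := by
  induction d with
  | zero => subst h; exact hs.not_comm m (by omega)
  | succ d ih =>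
    rw [band, commute_conj_iff (hs.comm _ _ (by omega) (by omega))]
    exact ih (by omega)

theorem not_comm_right' (hs : BraidSeq N s) {m i d : ℕ} (h : m = i + d + 1) (hm : m + 1 < N) :
    ¬ Commute (s m) (band s i (d + 1)) := by
  rw [band, show i + 1 + d = m by omega, commute_conj_iff (Commute.refl _)]
  exact hs.not_comm_right h hm

theorem not_comm_left' (hs : BraidSeq N s) {i d : ℕ} (hd : i + d + 2 < N) :
    ¬ Commute (s i) (band s i (d + 1)) := by
  rw [hs.band_left hd, commute_conj_iff' (Commute.refl _)]
  exact hs.not_comm_left rfl (by omega)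

theorem comm_mid (hs : BraidSeq N s) {m i d : ℕ} (h : i < m) (h' : m < i + d)
    (hd : i + d + 1 < N) : Commute (s m) (band s i d) := by
  induction d with
  | zero => omega
  | succ d ih =>
    rcases Nat.lt_or_ge m (i + d) with h1 | h1
    · rw [band, commute_conj_iff (hs.comm _ _ (by omega) (by omega))]
      exact ih h1 (by omega)
    · obtain ⟨e, rfl⟩ : ∃ e, d = e + 1 := ⟨d - 1, by omega⟩
      obtain rfl : m = i + 1 + e := by omega
      have c := hs.comm_gt (m := i + 1 + (e + 1)) (i := i) (d := e) (by omega) (by omega)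
      have b := hs.braid (i + 1 + e) (by omega)
      rw [band, band]
      rw [show i + 1 + (e + 1) = i + 1 + e + 1 by omega] at *
      generalize s (i + 1 + e + 1) = u at *
      generalize s (i + 1 + e) = t at *
      have e1 : u * (t * band s i e * t⁻¹) * u⁻¹ = (u * t) * band s i e * (u * t)⁻¹ := by group
      have e2 : t = (u * t) * u * (u * t)⁻¹ := by
        rw [eq_mul_inv_iff_mul_eq, ← mul_assoc, b]
      rw [e1]
      conv => enter [1]; rw [e2]
      exact (Commute.conj_iff _).2 c

/-- The band generator exchanging strands `i` and `j`. -/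
theorem comm_iff (hs : BraidSeq N s) {m i j : ℕ} (hij : i < j) (hj : j < N) (hm : m + 1 < N) :
    Commute (s m) (band s i (j - i - 1)) ↔
      m + 1 < i ∨ (i < m ∧ m + 1 < j) ∨ j < m ∨ (m = i ∧ j = i + 1) := by
  constructor
  · intro h
    by_contra hc
    have : m + 1 = i ∨ m = j ∨ (m + 1 = j ∧ i < m) ∨ (m = i ∧ i + 1 < j) := by omega
    rcases this with h1 | h1 | h1 | h1
    · exact hs.not_comm_left h1 (by omega) h
    · exact hs.not_comm_right (by omega) hm h
    · rw [show j - i - 1 = j - i - 2 + 1 by omega] at h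
      exact hs.not_comm_right' (by omega) hm h
    · rw [show j - i - 1 = j - i - 2 + 1 by omega, h1.1] at h
      exact hs.not_comm_left' (by omega) h
  · rintro (h | h | h | ⟨rfl, rfl⟩)
    · exact hs.comm_lt h (by omega)
    · exact hs.comm_mid h.1 (by omega) (by omega)
    · exact hs.comm_gt (by omega) hm
    · rw [show m + 1 - m - 1 = 0 by omega]; exact Commute.refl _

theorem eq_or_compl (hs : BraidSeq N s) (hN : 3 ≤ N) {i j k l : ℕ} (hij : i < j) (hj : j < N)
    (hkl : k < l) (hl : l < N) (h : band s i (j - i - 1) = band s k (l - k - 1)) :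
    (i = k ∧ j = l) ∨ (N = 4 ∧ ((i = 0 ∧ k ≠ 0) ∨ (k = 0 ∧ i ≠ 0)) ∧ i ≠ k ∧ i ≠ l ∧ j ≠ k ∧ j ≠ l) := by
  have key : ∀ m, m + 1 < N → ((m + 1 < i ∨ (i < m ∧ m + 1 < j) ∨ j < m ∨ (m = i ∧ j = i + 1)) ↔
      (m + 1 < k ∨ (k < m ∧ m + 1 < l) ∨ l < m ∨ (m = k ∧ l = k + 1))) := by
    intro m hm
    rw [← hs.comm_iff hij hj hm, ← hs.comm_iff hkl hl hm, h]
  have step : ∀ m, m + 1 < N → (((m = i ∨ m = j) ↔ (m = k ∨ m = l)) ↔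
      ((m + 1 = i ∨ m + 1 = j) ↔ (m + 1 = k ∨ m + 1 = l))) := by
    intro m hm
    have h1 : (m + 1 < i ∨ (i < m ∧ m + 1 < j) ∨ j < m ∨ (m = i ∧ j = i + 1)) ↔
        ((m = i ∨ m = j) ↔ (m + 1 = i ∨ m + 1 = j)) := by omega
    have h2 : (m + 1 < k ∨ (k < m ∧ m + 1 < l) ∨ l < m ∨ (m = k ∧ l = k + 1)) ↔
        ((m = k ∨ m = l) ↔ (m + 1 = k ∨ m + 1 = l)) := by omega
    have h3 := key m hm
    rw [h1, h2] at h3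
    generalize (m = i ∨ m = j) = a at *
    generalize (m + 1 = i ∨ m + 1 = j) = b at *
    generalize (m = k ∨ m = l) = c at *
    generalize (m + 1 = k ∨ m + 1 = l) = d at *
    clear key h1 h2
    tauto
  have all : ∀ m, m < N → (((m = i ∨ m = j) ↔ (m = k ∨ m = l)) ↔
      ((0 = i ∨ 0 = j) ↔ (0 = k ∨ 0 = l))) := by
    intro m
    induction m with
    | zero => exact fun _ => Iff.rfl
    | succ m ih => exact fun hm => (step m hm).symm.trans (ih (by omega))
  clear step key h
  by_cases h0 : (0 = i ∨ 0 = j) ↔ (0 = k ∨ 0 = l)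
  · left
    have h1 := (all i (by omega)).2 h0
    have h2 := (all j (by omega)).2 h0
    have h3 := (all k (by omega)).2 h0
    have h4 := (all l (by omega)).2 h0
    clear all h0
    omega
  · right
    have c : ∀ m, m < N → ((m = i ∨ m = j) ↔ ¬ (m = k ∨ m = l)) := fun m hm => by
      have := (all m hm).not.2 h0
      tauto
    have hN4 : N = 4 := by
      by_contra hne
      have h1 := c 0 (by omega)
      have h2 := c 1 (by omega)
      have h3 := c 2 (by omega)
      clear all h0
      rcases Nat.lt_or_ge N 4 with h4 | h4
      · clear c; omega
      · have h5 := c 3 (by omega)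
        have h6 := c 4 (by omega)
        clear c
        omega
    have h1 := c i (by omega)
    have h2 := c j (by omega)
    clear all c
    refine ⟨hN4, ?_, ?_⟩ <;> omega

end BraidSeq
end Braid

namespace Braid

namespace BraidSeq
variable {Q : Type*} [Group Q] {N : ℕ} {s : ℕ → Q}

theorem exists_conj (hs : BraidSeq N s) {i : ℕ} (d : ℕ) (hi : i + 1 < N) :
    ∃ g, g * s 0 * g⁻¹ = band s i d := by
  have h0 : ∀ i, i + 1 < N → ∃ g, g * s 0 * g⁻¹ = s i := by
    intro i
    induction i with
    | zero => exact fun _ => ⟨1, by group⟩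
    | succ i ih =>
      intro hi
      obtain ⟨g, hg⟩ := ih (by omega)
      refine ⟨s i * s (i + 1) * g, ?_⟩
      have b := hs.braid i hi
      rw [show s i * s (i + 1) * g * s 0 * (s i * s (i + 1) * g)⁻¹ =
        s i * s (i + 1) * (g * s 0 * g⁻¹) * (s i * s (i + 1))⁻¹ by group, hg, b]
      group
  induction d with
  | zero => exact h0 i hi
  | succ d ih =>
    obtain ⟨g, hg⟩ := ih
    refine ⟨s (i + 1 + d) * g, ?_⟩
    rw [band, ← hg]
    group

theorem card_class [Finite Q] (hs : BraidSeq N s) (hN : 3 ≤ N)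
    (h4 : N = 4 → s 0 ≠ s 2 ∧ band s 0 1 ≠ band s 1 1 ∧ band s 0 2 ≠ s 1) :
    N.choose 2 * Nat.card (Subgroup.centralizer {s 0}) ≤ Nat.card Q := by
  have inj : ∀ i j k l, i < j → j < N → k < l → l < N →
      band s i (j - i - 1) = band s k (l - k - 1) → i = k ∧ j = l := by
    intro i j k l hij hj hkl hl h
    rcases hs.eq_or_compl hN hij hj hkl hl h with h1 | ⟨rfl, h1, h2⟩
    · exact h1
    · exfalso
      have main : ∀ i j k l, i < j → j < 4 → k < l → l < 4 → i = 0 → k ≠ 0 → i ≠ l → j ≠ k →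
          j ≠ l → band s i (j - i - 1) ≠ band s k (l - k - 1) := by
        intro i j k l hij hj hkl hl hi hk hil hjk hjl
        obtain ⟨n1, n2, n3⟩ := h4 rfl
        have hj' : j = 1 ∨ j = 2 ∨ j = 3 := by omega
        subst hi
        rcases hj' with rfl | rfl | rfl
        · obtain rfl : k = 2 := by omega
          obtain rfl : l = 3 := by omega
          exact n1
        · obtain rfl : k = 1 := by omega
          obtain rfl : l = 3 := by omega
          exact n2
        · obtain rfl : k = 1 := by omega
          obtain rfl : l = 2 := by omega
          exact n3
      obtain ⟨-, h4, h5, h6⟩ := h2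
      rcases h1 with h1 | h1
      · exact main i j k l hij hj hkl hl h1.1 h1.2 h4 h5 h6 h
      · exact main k l i j hkl hl hij hj h1.1 h1.2 (Ne.symm h5) (Ne.symm h4) (Ne.symm h6) h.symm
  have hg : ∀ p : Σ j : Fin N, Fin j, ∃ g, g * s 0 * g⁻¹ = band s p.2 (p.1 - p.2 - 1) :=
    fun p => hs.exists_conj _ (by have := p.1.2; have := p.2.2; omega)
  choose g hg using hg
  let F : (Σ j : Fin N, Fin j) × Subgroup.centralizer {s 0} → Q := fun x => g x.1 * x.2
  have hF : Function.Injective F := by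
    rintro ⟨p, c⟩ ⟨q, d⟩ h
    change g p * c = g q * d at h
    have e : ∀ (p : Σ j : Fin N, Fin j) (c : Subgroup.centralizer {s 0}),
        (g p * c) * s 0 * (g p * c)⁻¹ = band s p.2 (p.1 - p.2 - 1) := by
      intro p c
      have hc := Subgroup.mem_centralizer_singleton_iff.1 c.2
      rw [← hg p, mul_inv_rev, mul_assoc (g p), hc]
      group
    have h1 := e p c
    rw [h, e q d] at h1
    have h2 := inj _ _ _ _ p.2.2 p.1.2 q.2.2 q.1.2 h1.symm
    obtain ⟨⟨j, hj⟩, ⟨i, hi⟩⟩ := p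
    obtain ⟨⟨l, hl⟩, ⟨k, hk⟩⟩ := q
    simp only at h2
    obtain ⟨rfl, rfl⟩ := h2
    have := mul_left_cancel h
    rw [Prod.mk.injEq]
    exact ⟨rfl, Subtype.ext this⟩
  have hc := Nat.card_le_card_of_injective F hF
  rwa [Nat.card_prod, Nat.card_sigma, show (∑ a : Fin N, Nat.card (Fin a)) = N.choose 2 by
    simp only [Nat.card_fin]
    rw [Fin.sum_univ_eq_sum_range (fun i => i), Finset.sum_range_id, Nat.choose_two_right]] at hc

theorem ne_one (hs : BraidSeq N s) (hN : 3 ≤ N) : s 0 ≠ 1 :=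
  fun h => hs.not_comm 0 (by omega) (h ▸ Commute.one_left _)

end BraidSeq

variable {Q : Type*} [Group Q] {N : ℕ} {s : ℕ → Q}

/-- The cyclic central subgroup generated by an element in its centralizer. -/
def zc (s : Q) : Subgroup (Subgroup.centralizer {s}) :=
  Subgroup.zpowers ⟨s, Subgroup.mem_centralizer_singleton_iff.2 rfl⟩

instance (s : Q) : (zc s).Normal := by
  refine ⟨?_⟩
  rintro n hn g
  obtain ⟨k, rfl⟩ := Subgroup.mem_zpowers_iff.1 hn
  have : Commute (⟨s, Subgroup.mem_centralizer_singleton_iff.2 rfl⟩ :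
      Subgroup.centralizer {s}) g :=
    Subtype.ext (Subgroup.mem_centralizer_singleton_iff.1 g.2).symm
  rw [← (this.zpow_left k).eq, mul_inv_cancel_right]
  exact hn

theorem mem_zc {s : Q} {g : Subgroup.centralizer {s}} : g ∈ zc s ↔ ∃ k : ℤ, (g : Q) = s ^ k := by
  rw [zc, Subgroup.mem_zpowers_iff]
  constructor
  · rintro ⟨k, rfl⟩
    exact ⟨k, by simp⟩
  · rintro ⟨k, hk⟩
    exact ⟨k, Subtype.ext (by simp [hk])⟩

open Classical in
/-- The class of an element modulo `s` if it commutes with `s`. -/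
noncomputable def toQ (s x : Q) : Subgroup.centralizer {s} ⧸ zc s :=
  if h : x * s = s * x then
    QuotientGroup.mk ⟨x, Subgroup.mem_centralizer_singleton_iff.2 h⟩ else 1

theorem toQ_mul {s x y : Q} (hx : Commute s x) (hy : Commute s y) :
    toQ s (x * y) = toQ s x * toQ s y := by
  rw [toQ, toQ, toQ, dif_pos hx.eq.symm, dif_pos hy.eq.symm, dif_pos (hx.mul_right hy).eq.symm]
  rfl

theorem toQ_inv {s x : Q} (hx : Commute s x) : toQ s x⁻¹ = (toQ s x)⁻¹ := by
  rw [toQ, toQ, dif_pos hx.eq.symm, dif_pos hx.inv_right.eq.symm]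
  rfl

theorem toQ_eq {s x y : Q} (hx : Commute s x) (hy : Commute s y) (h : toQ s x = toQ s y) :
    ∃ k : ℤ, x = y * s ^ k := by
  rw [toQ, toQ, dif_pos hx.eq.symm, dif_pos hy.eq.symm, eq_comm, QuotientGroup.eq, mem_zc] at h
  obtain ⟨k, hk⟩ := h
  refine ⟨k, ?_⟩
  rw [← hk]
  simp

theorem card_toQ [Finite Q] (s : Q) : Nat.card (Subgroup.centralizer {s}) =
    Nat.card (Subgroup.centralizer {s} ⧸ zc s) * orderOf s := by
  rw [Subgroup.card_eq_card_quotient_mul_card_subgroup (zc s)]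
  congr 1
  rw [zc, Nat.card_zpowers, ← Subgroup.orderOf_coe]

theorem BraidSeq.toQ (hs : BraidSeq (N + 2) s) :
    BraidSeq N (fun i => Braid.toQ (s 0) (s (i + 2))) := by
  have c : ∀ i, i + 1 < N → Commute (s 0) (s (i + 2)) :=
    fun i hi => hs.comm 0 (i + 2) (by omega) (by omega)
  refine ⟨fun i hi => ?_, fun i j h hj => ?_, fun i hi h => ?_⟩
  · have c1 := c i (by omega)
    have c2 := c (i + 1) (by omega)
    change Braid.toQ (s 0) (s (i + 2)) * Braid.toQ (s 0) (s (i + 1 + 2)) * _ =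
      Braid.toQ (s 0) (s (i + 1 + 2)) * Braid.toQ (s 0) (s (i + 2)) * _
    rw [← toQ_mul c1 c2, ← toQ_mul c2 c1, ← toQ_mul (c1.mul_right c2) c1,
      ← toQ_mul (c2.mul_right c1) c2]
    congr 1
    exact hs.braid (i + 2) (by omega)
  · have c1 := c i (by omega)
    have c2 := c j (by omega)
    change Braid.toQ (s 0) (s (i + 2)) * Braid.toQ (s 0) (s (j + 2)) =
      Braid.toQ (s 0) (s (j + 2)) * Braid.toQ (s 0) (s (i + 2))
    rw [← toQ_mul c1 c2, ← toQ_mul c2 c1, (hs.comm (i + 2) (j + 2) (by omega) (by omega)).eq]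
  · have c1 := c i (by omega)
    have c2 := c (i + 1) (by omega)
    change Braid.toQ (s 0) (s (i + 2)) * Braid.toQ (s 0) (s (i + 1 + 2)) =
      Braid.toQ (s 0) (s (i + 1 + 2)) * Braid.toQ (s 0) (s (i + 2)) at h
    have b : Braid.toQ (s 0) (s (i + 2)) * Braid.toQ (s 0) (s (i + 1 + 2)) *
        Braid.toQ (s 0) (s (i + 2)) =
        Braid.toQ (s 0) (s (i + 1 + 2)) * Braid.toQ (s 0) (s (i + 2)) *
        Braid.toQ (s 0) (s (i + 1 + 2)) := by
      rw [← toQ_mul c1 c2, ← toQ_mul c2 c1, ← toQ_mul (c1.mul_right c2) c1,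
        ← toQ_mul (c2.mul_right c1) c2]
      congr 1
      exact hs.braid (i + 2) (by omega)
    rw [h] at b
    obtain ⟨k, hk⟩ := toQ_eq c1 c2 (mul_left_cancel b)
    refine hs.not_comm (i + 2) (by omega) ?_
    rw [hk]
    exact (Commute.refl _).mul_left (c2.zpow_left k)

end Braid

namespace Braid

namespace BraidSeq
variable {Q : Type*} [Group Q] {N : ℕ} {s : ℕ → Q}

theorem central_of_conj_eq (hs : BraidSeq 6 s) {h b : Q} {k : ℤ}
    (hh : h ∈ Subgroup.closure {s 3, s 4}) (hb : b ∈ Subgroup.closure {s 3, s 4})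
    (e : h * s 2 * h⁻¹ = b * s 0 ^ k) : Commute b (s 3) ∧ Commute b (s 4) := by
  set K := Subgroup.closure {s 3, s 4} with hK
  have hc : ∀ y, Commute y (s 3) → Commute y (s 4) → ∀ x ∈ K, Commute y x := by
    intro y h3 h4 x hx
    have : K ≤ Subgroup.centralizer {y} := by
      rw [hK, Subgroup.closure_le]
      rintro z (rfl | rfl)
      · exact Subgroup.mem_centralizer_singleton_iff.2 h3.eq.symm
      · exact Subgroup.mem_centralizer_singleton_iff.2 h4.eq.symm
    exact (Subgroup.mem_centralizer_singleton_iff.1 (this hx)).symm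
  have c0 := hc (s 0) (hs.comm 0 3 (by omega) (by omega)) (hs.comm 0 4 (by omega) (by omega))
  have c1 := hc (s 1) (hs.comm 1 3 (by omega) (by omega)) (hs.comm 1 4 (by omega) (by omega))
  obtain ⟨b', hb'⟩ : ∃ b', b' = h⁻¹ * b * h := ⟨_, rfl⟩
  have hb'K : b' ∈ K := by
    rw [hb']; exact K.mul_mem (K.mul_mem (K.inv_mem hh) hb) hh
  obtain ⟨z, hz⟩ : ∃ z, z = s 0 ^ k := ⟨_, rfl⟩
  have cz : ∀ x ∈ K, Commute z x := fun x hx => by rw [hz]; exact (c0 x hx).zpow_left k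
  have e2 : s 2 = b' * z := by
    rw [← hz] at e
    have : s 2 = h⁻¹ * (b * z) * h := by rw [← e]; group
    rw [this, hb']
    simp only [mul_assoc]
    rw [(cz h hh).eq]
  have br := hs.braid 1 (by omega)
  have d1 := (c1 b' hb'K).eq
  have d2 := (cz b' hb'K).eq
  simp only [Nat.reduceAdd] at br
  rw [e2] at br
  have e3 : b' = s 1 * z * s 1 * (z * s 1 * z)⁻¹ := by
    have l : s 1 * (b' * z) * s 1 = b' * (s 1 * z * s 1) := by
      rw [← mul_assoc, d1]; group
    have r : b' * z * s 1 * (b' * z) = b' * (b' * (z * s 1 * z)) := by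
      calc _ = b' * (z * (s 1 * b') * z) := by group
        _ = b' * ((z * b') * s 1 * z) := by rw [d1]; group
        _ = _ := by rw [d2]; group
    rw [l, r] at br
    exact eq_mul_inv_of_mul_eq (mul_left_cancel br).symm
  have cb : ∀ x ∈ K, Commute b' x := by
    intro x hx
    rw [e3]
    have := c1 x hx
    have hz' := cz x hx
    exact ((this.mul_left hz').mul_left this).mul_left ((hz'.mul_left this).mul_left hz').inv_left
  have hbb : b = b' := by
    have : b = h * b' * h⁻¹ := by rw [hb']; group
    rw [this, ← (cb h hh).eq, mul_inv_cancel_right]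
  rw [hbb]
  exact ⟨cb _ (Subgroup.subset_closure (by simp)), cb _ (Subgroup.subset_closure (by simp))⟩

theorem card_four [Finite Q] (hs : BraidSeq 4 s) (h1 : s 0 ≠ s 2) (h2 : s 0 ≠ (s 2)⁻¹)
    (h3 : band s 0 1 ≠ band s 1 1) (h4 : band s 0 2 ≠ s 1) : 24 ≤ Nat.card Q := by
  have hc := hs.card_class (by omega) (fun _ => ⟨h1, h3, h4⟩)
  have c : Commute (s 0) (s 2) := hs.comm 0 2 (by omega) (by omega)
  have n0 := hs.ne_one (by omega)
  have n2 : s 2 ≠ 1 := by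
    intro h
    exact hs.not_comm 1 (by omega) (by simp only [Nat.reduceAdd, h]; exact Commute.one_right _)
  have m0 : s 0 ∈ Subgroup.centralizer {s 0} := Subgroup.mem_centralizer_singleton_iff.2 rfl
  have m2 : s 2 ∈ Subgroup.centralizer {s 0} := Subgroup.mem_centralizer_singleton_iff.2 c.eq.symm
  have h4 : 4 ≤ Nat.card (Subgroup.centralizer {s 0}) := by
    classical
    change 4 ≤ Nat.card ((Subgroup.centralizer {s 0} : Subgroup Q) : Set Q)
    rw [Nat.card_coe_set_eq]
    have : ∃ F : Finset Q, F.card = 4 ∧ (F : Set Q) ⊆ (Subgroup.centralizer {s 0} : Subgroup Q) := by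
      by_cases hi : s 0 = (s 0)⁻¹
      · refine ⟨{1, s 0, s 2, s 0 * s 2}, ?_, ?_⟩
        · rw [Finset.card_insert_of_notMem, Finset.card_insert_of_notMem, Finset.card_pair]
          · simpa using n0
          · simpa [h1] using n2
          · simp only [Finset.mem_insert, Finset.mem_singleton, not_or]
            refine ⟨n0.symm, n2.symm, fun h => h2 ?_⟩
            exact eq_inv_of_mul_eq_one_left h.symm
        · intro x hx
          simp only [Finset.coe_insert, Finset.coe_singleton, Set.mem_insert_iff,
            Set.mem_singleton_iff] at hx
          rcases hx with rfl | rfl | rfl | rfl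
          exacts [one_mem _, m0, m2, mul_mem m0 m2]
      · refine ⟨{1, s 0, (s 0)⁻¹, s 2}, ?_, ?_⟩
        · rw [Finset.card_insert_of_notMem, Finset.card_insert_of_notMem, Finset.card_pair]
          · exact fun h => h2 (by rw [← h, inv_inv])
          · simp only [Finset.mem_insert, Finset.mem_singleton, not_or]
            exact ⟨hi, h1⟩
          · simp only [Finset.mem_insert, Finset.mem_singleton, not_or]
            exact ⟨n0.symm, fun h => n0 (inv_eq_one.1 h.symm), n2.symm⟩
        · intro x hx
          simp only [Finset.coe_insert, Finset.coe_singleton, Set.mem_insert_iff,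
            Set.mem_singleton_iff] at hx
          rcases hx with rfl | rfl | rfl | rfl
          exacts [one_mem _, m0, inv_mem m0, m2]
    obtain ⟨F, hF, hsub⟩ := this
    rw [← hF, ← Set.ncard_coe_finset]
    exact Set.ncard_le_ncard hsub (Set.toFinite _)
  rw [show Nat.choose 4 2 = 6 from rfl] at hc
  omega

theorem card_quot_six [Finite Q] (hs : BraidSeq 6 s) :
    24 ≤ Nat.card (Subgroup.centralizer {s 0} ⧸ zc (s 0)) := by
  have hn := hs.not_comm 3 (by omega)
  simp only [Nat.reduceAdd] at hn
  have c2 : Commute (s 0) (s 2) := hs.comm 0 2 (by omega) (by omega)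
  have c3 : Commute (s 0) (s 3) := hs.comm 0 3 (by omega) (by omega)
  have c4 : Commute (s 0) (s 4) := hs.comm 0 4 (by omega) (by omega)
  have k3 : s 3 ∈ Subgroup.closure {s 3, s 4} := Subgroup.subset_closure (by simp)
  have k4 : s 4 ∈ Subgroup.closure {s 3, s 4} := Subgroup.subset_closure (by simp)
  have q := BraidSeq.toQ (N := 4) hs
  refine card_four q ?_ ?_ ?_ ?_
  · intro h
    obtain ⟨k, hk⟩ := toQ_eq c2 c4 h
    have := hs.central_of_conj_eq (one_mem _) k4 (by rw [← hk]; group)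
    exact hn this.1.symm
  · intro h
    simp only [zero_add, Nat.reduceAdd] at h
    rw [← toQ_inv c4] at h
    obtain ⟨k, hk⟩ := toQ_eq c2 c4.inv_right h
    have := hs.central_of_conj_eq (one_mem _) (inv_mem k4) (by rw [← hk]; group)
    exact hn (by simpa using this.1.inv_left.symm)
  · intro h
    simp only [band, zero_add, add_zero, Nat.reduceAdd] at h
    rw [← toQ_mul c3 c2, ← toQ_mul c4 c3, ← toQ_inv c3, ← toQ_inv c4,
      ← toQ_mul (c3.mul_right c2) c3.inv_right, ← toQ_mul (c4.mul_right c3) c4.inv_right] at h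
    obtain ⟨k, hk⟩ := toQ_eq ((c3.mul_right c2).mul_right c3.inv_right)
      ((c4.mul_right c3).mul_right c4.inv_right) h
    have := (hs.central_of_conj_eq k3 (mul_mem (mul_mem k4 k3) (inv_mem k4)) hk).2.symm
    rw [commute_conj_iff (Commute.refl _)] at this
    exact hn this.symm
  · intro h
    simp only [band, zero_add, add_zero, Nat.reduceAdd] at h
    rw [← toQ_mul c3 c2, ← toQ_inv c3, ← toQ_inv c4,
      ← toQ_mul (c3.mul_right c2) c3.inv_right,
      ← toQ_mul c4 ((c3.mul_right c2).mul_right c3.inv_right),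
      ← toQ_mul (c4.mul_right ((c3.mul_right c2).mul_right c3.inv_right)) c4.inv_right] at h
    obtain ⟨k, hk⟩ := toQ_eq ((c4.mul_right ((c3.mul_right c2).mul_right c3.inv_right)).mul_right
      c4.inv_right) c3 h
    have := hs.central_of_conj_eq (mul_mem k4 k3) k3 (by rw [← hk]; group)
    exact hn this.2

theorem card_ge : ∀ (N : ℕ) {Q : Type*} [Group Q] [Finite Q] {s : ℕ → Q}, BraidSeq N s →
    (N = 3 ∨ 5 ≤ N) → N.choose 2 * ((N - 2).factorial * orderOf (s 0)) ≤ Nat.card Q := by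
  intro N
  induction N using Nat.strong_induction_on with
  | _ N ih =>
    intro Q _ _ s hs hN
    have h1 := hs.card_class (by omega) (by omega)
    rw [card_toQ] at h1
    refine le_trans (Nat.mul_le_mul_left _ (Nat.mul_le_mul_right _ ?_)) h1
    obtain ⟨M, rfl⟩ : ∃ M, N = M + 2 := ⟨N - 2, by omega⟩
    rw [Nat.add_sub_cancel]
    have q := hs.toQ
    have hcases : M = 1 ∨ M = 4 ∨ (M = 3 ∨ 5 ≤ M) := by omega
    rcases hcases with rfl | rfl | hM
    · exact Nat.card_pos
    · exact card_quot_six hs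
    · have := ih M (by omega) q hM
      refine le_trans ?_ this
      have h2 : 2 ≤ orderOf (Braid.toQ (s 0) (s (0 + 2))) := by
        have h3 := orderOf_pos (Braid.toQ (s 0) (s (0 + 2)))
        have h4 : orderOf (Braid.toQ (s 0) (s (0 + 2))) ≠ 1 := fun h =>
          q.ne_one (by omega) (orderOf_eq_one_iff.1 h)
        omega
      refine le_trans ?_ (Nat.mul_le_mul_left _ (Nat.mul_le_mul_left _ h2))
      obtain ⟨m, rfl⟩ : ∃ m, M = m + 2 := ⟨M - 2, by omega⟩
      rw [Nat.add_sub_cancel, Nat.factorial_succ, Nat.factorial_succ]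
      have : Nat.choose (m + 2) 2 * 2 = (m + 2) * (m + 1) := by
        rw [Nat.choose_two_right]
        have h2 := Nat.div_mul_cancel (Nat.even_mul_pred_self (m + 2)).two_dvd
        simpa using h2
      nlinarith [Nat.factorial_pos m]

theorem factorial_mul_le [Finite Q] (hs : BraidSeq N s) (hN : 5 ≤ N) :
    N.factorial * orderOf (s 0) ≤ 2 * Nat.card Q := by
  have h := card_ge N hs (Or.inr hN)
  obtain ⟨m, rfl⟩ : ∃ m, N = m + 2 := ⟨N - 2, by omega⟩
  rw [Nat.add_sub_cancel] at h
  rw [Nat.factorial_succ, Nat.factorial_succ]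
  have : Nat.choose (m + 2) 2 * 2 = (m + 2) * (m + 1) := by
    rw [Nat.choose_two_right]
    have h2 := Nat.div_mul_cancel (Nat.even_mul_pred_self (m + 2)).two_dvd
    simpa using h2
  calc _ = (m + 2) * (m + 1) * (m.factorial * orderOf (s 0)) := by ring
    _ = 2 * (Nat.choose (m + 2) 2 * (m.factorial * orderOf (s 0))) := by rw [← this]; ring
    _ ≤ _ := Nat.mul_le_mul_left _ h

end BraidSeq
end Braid

namespace Braid
open FreeGroup (of)

/-- The permutation of the `n` strands underlying an element. -/
def prmF (n : ℕ) : ArtinB n →* Equiv.Perm (Fin n) where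
  toFun g :=
    { toFun := fun i => ⟨prm n g i, prm_lt i.2 g⟩
      invFun := fun i => ⟨prm n g⁻¹ i, prm_lt i.2 g⁻¹⟩
      left_inv := fun i => Fin.ext (by simp)
      right_inv := fun i => Fin.ext (by simp) }
  map_one' := by ext i; simp
  map_mul' g h := by ext i; simp

@[simp] theorem prmF_apply {n : ℕ} (g : ArtinB n) (i : Fin n) : (prmF n g i : ℕ) = prm n g i := rfl

theorem prmF_eq_iff {n : ℕ} {g h : ArtinB n} : prmF n g = prmF n h ↔ prm n g = prm n h := by
  constructor
  · intro e
    ext i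
    rcases Nat.lt_or_ge i n with hi | hi
    · have := congrArg Fin.val (DFunLike.congr_fun e ⟨i, hi⟩)
      simpa using this
    · rw [prm_of_le hi, prm_of_le hi]
  · intro e
    ext i
    simp [e]

theorem prmF_sB {n i : ℕ} (h : i + 1 < n) :
    prmF n (sB n i) = Equiv.swap ⟨i, by omega⟩ ⟨i + 1, h⟩ := by
  ext k
  rw [prmF_apply, prm_sB h, Equiv.swap_apply_def, Equiv.swap_apply_def]
  simp only [Fin.ext_iff]
  split_ifs <;> rfl

theorem prmF_surjective {n : ℕ} : Function.Surjective (prmF n) := by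
  rcases n with _ | m
  · intro σ
    exact ⟨1, Subsingleton.elim _ _⟩
  · intro σ
    have h : (⊤ : Submonoid (Equiv.Perm (Fin (m + 1)))) ≤ MonoidHom.mrange (prmF (m + 1)) := by
      rw [← Equiv.Perm.mclosure_swap_castSucc_succ, Submonoid.closure_le]
      rintro _ ⟨i, rfl⟩
      exact ⟨sB (m + 1) i, prmF_sB (by omega)⟩
    exact h (Submonoid.mem_top σ)

theorem pr_conj_sB {n i : ℕ} (h : i + 2 < n) : cB n * sB n i * (cB n)⁻¹ = sB n (i + 1) := by
  rw [cB, pr_shift (by omega) (by omega), mul_inv_cancel_right]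

theorem braidSeq_of_surjective {n : ℕ} (hn : 5 ≤ n) {θ : ArtinB n →* Equiv.Perm (Fin n)}
    (hθ : Function.Surjective θ) : BraidSeq n (fun i => θ (sB n i)) := by
  refine ⟨fun i hi => ?_, fun i j h hj => ?_, fun i hi h => ?_⟩
  · simp only [← map_mul, sB_braid hi]
  · exact (sB_comm h).map θ
  · have h' : θ (sB n i) * θ (sB n (i + 1)) = θ (sB n (i + 1)) * θ (sB n i) := h
    have b := congrArg θ (sB_braid hi)
    simp only [map_mul] at b
    rw [h'] at b
    have e : θ (sB n i) = θ (sB n (i + 1)) := mul_left_cancel b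
    clear b h h'
    have sh : ∀ k, k + 2 < n → θ (cB n) * θ (sB n k) * (θ (cB n))⁻¹ = θ (sB n (k + 1)) := by
      intro k hk
      rw [← map_inv, ← map_mul, ← map_mul, pr_conj_sB hk]
    have h0 : ∀ i, i + 2 < n → θ (sB n i) = θ (sB n (i + 1)) → θ (sB n 0) = θ (sB n 1) := by
      intro i
      induction i with
      | zero => exact fun _ h => h
      | succ i ih =>
        intro hi h
        refine ih (by omega) ?_
        rw [← sh i (by omega), ← sh (i + 1) hi, mul_left_inj, mul_right_inj] at h
        exact h
    have h1 := h0 i hi e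
    have h2 : ∀ k, k + 2 < n → θ (sB n k) = θ (sB n (k + 1)) := by
      intro k
      induction k with
      | zero => exact fun _ => h1
      | succ k ih =>
        intro hk
        rw [← sh k (by omega), ← sh (k + 1) hk, ih (by omega)]
    have h3 : ∀ k, k + 1 < n → θ (sB n k) = θ (sB n 0) := by
      intro k
      induction k with
      | zero => exact fun _ => rfl
      | succ k ih =>
        intro hk
        rw [← h2 k hk, ih (by omega)]
    have c : ∀ k l, k < n → l < n → Commute (θ (sB n k)) (θ (sB n l)) := by
      intro k l hk hl
      have l0 := (sB_comm (n := n) (show 0 + 2 ≤ n - 1 by omega)).map θ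
      have : ∀ k, k < n → θ (sB n k) = θ (sB n 0) ∨ θ (sB n k) = θ (sB n (n - 1)) := by
        intro k hk
        rcases Nat.lt_or_ge (k + 1) n with h | h
        · exact Or.inl (h3 k h)
        · exact Or.inr (by rw [show k = n - 1 by omega])
      rcases this k hk with e1 | e1 <;> rcases this l hl with e2 | e2 <;> rw [e1, e2]
      exacts [l0, l0.symm]
    have c2 : ∀ g h, Commute (θ g) (θ h) := by
      intro g h
      have c3 : ∀ k, k < n → Commute (θ (sB n k)) (θ h) := by
        intro k hk
        refine sB_induction (P := fun h => Commute (θ (sB n k)) (θ h)) ?_ (fun l => c k l hk) ?_ ?_ h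
        · rw [map_one]; exact Commute.one_right _
        · intro a b ha hb; rw [map_mul]; exact ha.mul_right hb
        · intro a ha; rw [map_inv]; exact ha.inv_right
      refine sB_induction (P := fun g => Commute (θ g) (θ h)) ?_ c3 ?_ ?_ g
      · rw [map_one]; exact Commute.one_left _
      · intro a b ha hb; rw [map_mul]; exact ha.mul_left hb
      · intro a ha; rw [map_inv]; exact ha.inv_left
    have : IsMulCommutative (Equiv.Perm (Fin n)) := ⟨⟨fun a b => by
      obtain ⟨g, rfl⟩ := hθ a
      obtain ⟨h, rfl⟩ := hθ b
      exact c2 g h⟩⟩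
    rw [Equiv.Perm.isMulCommutative_iff_card_le_two] at this
    simp at this
    omega

theorem sq_eq_one_of_surjective {n : ℕ} (hn : 5 ≤ n) {θ : ArtinB n →* Equiv.Perm (Fin n)}
    (hθ : Function.Surjective θ) {i : ℕ} (hi : i + 1 < n) : θ (sB n i) * θ (sB n i) = 1 := by
  have hs := braidSeq_of_surjective hn hθ
  have h := hs.factorial_mul_le hn
  rw [Nat.card_perm, Nat.card_fin] at h
  have h2 : orderOf (θ (sB n 0)) ≤ 2 := by
    by_contra h3
    have := Nat.factorial_pos n
    have : n.factorial * 3 ≤ n.factorial * orderOf (θ (sB n 0)) := Nat.mul_le_mul_left _ (by omega)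
    omega
  have h3 := orderOf_pos (θ (sB n 0))
  have h4 : orderOf (θ (sB n 0)) ≠ 1 := fun h =>
    hs.ne_one (by omega) (orderOf_eq_one_iff.1 h)
  have h5 : orderOf (θ (sB n 0)) = 2 := by omega
  have h6 := pow_orderOf_eq_one (θ (sB n 0))
  rw [h5] at h6
  induction i with
  | zero => rw [← pow_two, h6]
  | succ i ih =>
    have := ih (by omega)
    rw [← pr_conj_sB (by omega), map_mul, map_mul, map_inv]
    calc _ = θ (cB n) * (θ (sB n i) * θ (sB n i)) * (θ (cB n))⁻¹ := by group
      _ = 1 := by rw [this]; group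

theorem map_X_eq_one {n : ℕ} (hn : 5 ≤ n) {θ : ArtinB n →* Equiv.Perm (Fin n)}
    (hθ : Function.Surjective θ) : ∀ i, i < n → θ (X n i) = 1 := by
  have sq := fun i hi => sq_eq_one_of_surjective hn hθ (i := i) hi
  have inv : ∀ i, i + 1 < n → (θ (sB n i))⁻¹ = θ (sB n i) := fun i hi =>
    inv_eq_of_mul_eq_one_left (sq i hi)
  have up : ∀ i, i + 1 < n → θ (sB n i) * θ (X n i) * (θ (sB n i))⁻¹ = θ (X n (i + 1)) := by
    intro i hi
    rw [← sB_conj_X hi]; simp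
  have down : ∀ i, i + 1 < n → θ (sB n i) * θ (X n (i + 1)) * (θ (sB n i))⁻¹ = θ (X n i) := by
    intro i hi
    rw [← up i hi]
    calc _ = (θ (sB n i) * θ (sB n i)) * θ (X n i) * (θ (sB n i) * θ (sB n i))⁻¹ := by group
      _ = _ := by rw [sq i hi]; group
  have adj : ∀ i, i + 1 < n → Commute (θ (X n i)) (θ (X n (i + 1))) := by
    intro i hi
    have h1 := down i hi
    have h2 := congrArg θ (sB_conj_X_succ hi)
    simp only [map_mul, map_inv] at h2
    rw [h1, mul_assoc, eq_inv_mul_iff_mul_eq] at h2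
    exact h2.symm
  have fixl : ∀ i k, i + 2 ≤ k → k < n → Commute (θ (sB n i)) (θ (X n k)) :=
    fun i k h hk => (sB_comm_X_of_lt h hk).map θ
  have fixg : ∀ i k, k < i → i + 1 < n → Commute (θ (sB n i)) (θ (X n k)) :=
    fun i k h hk => (sB_comm_X_of_gt h hk).map θ
  have com : ∀ i d, i + d + 1 < n → Commute (θ (X n i)) (θ (X n (i + d + 1))) := by
    intro i d
    induction d with
    | zero => exact fun h => adj i h
    | succ d ih =>
      intro h
      have h1 := ih (by omega)
      rw [← Commute.conj_iff (θ (sB n (i + d + 1))), up _ (by omega),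
        (fixg _ i (by omega) (by omega)).eq, mul_inv_cancel_right] at h1
      exact h1
  have com' : ∀ i j, i < n → j < n → Commute (θ (X n i)) (θ (X n j)) := by
    intro i j hi hj
    rcases lt_trichotomy i j with h | rfl | h
    · obtain ⟨d, rfl⟩ : ∃ d, j = i + d + 1 := ⟨j - i - 1, by omega⟩
      exact com i d hj
    · exact Commute.refl _
    · obtain ⟨d, rfl⟩ : ∃ d, i = j + d + 1 := ⟨i - j - 1, by omega⟩
      exact (com j d hi).symm
  set S : Set (Equiv.Perm (Fin n)) := {x | ∃ i, i < n ∧ θ (X n i) = x} with hS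
  have cl : ∀ j, j < n → ∀ x ∈ S, θ (sB n j) * x * (θ (sB n j))⁻¹ ∈ S := by
    rintro j hj _ ⟨i, hi, rfl⟩
    rcases Nat.lt_or_ge (j + 1) n with hj' | hj'
    · rcases lt_trichotomy i j with h | rfl | h
      · rw [(fixg j i h hj').eq, mul_inv_cancel_right]; exact ⟨i, hi, rfl⟩
      · rw [up i hj']; exact ⟨i + 1, hj', rfl⟩
      · rcases Nat.lt_or_ge (j + 1) i with h2 | h2
        · rw [(fixl j i h2 hi).eq, mul_inv_cancel_right]; exact ⟨i, hi, rfl⟩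
        · obtain rfl : i = j + 1 := by omega
          rw [down j hj']; exact ⟨j, hj, rfl⟩
    · rw [← X_last (show j + 1 = n by omega), (com' j i hj hi).eq, mul_inv_cancel_right]
      exact ⟨i, hi, rfl⟩
  have cl' : ∀ j, j < n → ∀ x ∈ S, (θ (sB n j))⁻¹ * x * θ (sB n j) ∈ S := by
    intro j hj x hx
    rcases Nat.lt_or_ge (j + 1) n with hj' | hj'
    · have := cl j hj x hx
      rwa [inv j hj'] at this ⊢
    · obtain ⟨i, hi, rfl⟩ := hx
      rw [← X_last (show j + 1 = n by omega), mul_assoc, ← (com' j i hj hi).eq, inv_mul_cancel_left]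
      exact ⟨i, hi, rfl⟩
  have key : ∀ g, (∀ x ∈ S, θ g * x * (θ g)⁻¹ ∈ S) ∧ (∀ x ∈ S, (θ g)⁻¹ * x * θ g ∈ S) := by
    intro g
    refine sB_induction (P := fun g => (∀ x ∈ S, θ g * x * (θ g)⁻¹ ∈ S) ∧
      (∀ x ∈ S, (θ g)⁻¹ * x * θ g ∈ S)) ?_ (fun i hi => ⟨cl i hi, cl' i hi⟩) ?_ ?_ g
    · simp
    · intro a b ha hb
      refine ⟨fun x hx => ?_, fun x hx => ?_⟩
      · have := ha.1 _ (hb.1 _ hx)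
        simpa [mul_assoc] using this
      · have := hb.2 _ (ha.2 _ hx)
        simpa [mul_assoc] using this
    · intro a ha
      refine ⟨fun x hx => ?_, fun x hx => ?_⟩
      · simpa using ha.2 x hx
      · simpa using ha.1 x hx
  have hN : (Subgroup.closure S).Normal := by
    refine ⟨fun x hx g => ?_⟩
    obtain ⟨g, rfl⟩ := hθ g
    have : Subgroup.closure S ≤ (Subgroup.closure S).comap (MulAut.conj (θ g)).toMonoidHom := by
      rw [Subgroup.closure_le]
      intro y hy
      exact Subgroup.subset_closure ((key g).1 y hy)
    exact this hx
  by_contra hne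
  push Not at hne
  obtain ⟨i, hi, hx⟩ := hne
  have hnt : Nontrivial (Subgroup.closure S) :=
    ⟨1, ⟨θ (X n i), Subgroup.subset_closure ⟨i, hi, rfl⟩⟩, fun h => hx (congrArg Subtype.val h).symm⟩
  have hle := Equiv.Perm.alternatingGroup_le_of_normal (α := Fin n) (by simpa using hn) hnt
  have hcomm : ∀ x ∈ Subgroup.closure S, ∀ y ∈ Subgroup.closure S, x * y = y * x := by
    intro x hx y hy
    refine Subgroup.closure_induction₂ (p := fun x y _ _ => x * y = y * x) ?_ ?_ ?_ ?_ ?_ ?_ ?_ hx hy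
    · rintro _ _ ⟨i, hi, rfl⟩ ⟨j, hj, rfl⟩; exact com' i j hi hj
    · intro x _; simp
    · intro x _; simp
    · intro x y z _ _ _ h1 h2; exact Commute.mul_left h1 h2
    · intro x y z _ _ _ h1 h2; exact Commute.mul_right h1 h2
    · intro x y _ _ h; exact Commute.inv_left h
    · intro x y _ _ h; exact Commute.inv_right h
  have : IsMulCommutative (alternatingGroup (Fin n)) := ⟨⟨fun a b =>
    Subtype.ext (hcomm _ (hle a.2) _ (hle b.2))⟩⟩
  rw [alternatingGroup.isMulCommutative_iff_card_le_three] at this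
  simp at this
  omega

theorem map_pure_eq_one {n : ℕ} (hn : 5 ≤ n) {θ : ArtinB n →* Equiv.Perm (Fin n)}
    (hθ : Function.Surjective θ) {p : ArtinB n} (hp : prm n p = 1) : θ p = 1 := by
  refine pure_le θ.ker (map_X_eq_one hn hθ) (fun i j hi hj => ?_) p hp
  rw [MonoidHom.mem_ker, A, map_mul, map_mul, map_pow, map_inv, pow_two,
    sq_eq_one_of_surjective hn hθ (by omega)]
  group

end Braid

namespace Braid
open FreeGroup (of)

theorem ncard_fixedPoints_eq {ι : Type*} [Fintype ι] [DecidableEq ι] {f g : Equiv.Perm ι}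
    {M N : Matrix ι ι ℚ} (h : M * N = 1) (hM : ∀ e e', M (f e) (g e') = M e e') :
    (Function.fixedPoints f).ncard = (Function.fixedPoints g).ncard := by
  have h1 : f.permMatrix ℚ * M = M * (g⁻¹)⁻¹.permMatrix ℚ * 1 := by
    rw [Equiv.Perm.permMatrix, PEquiv.toMatrix_toPEquiv_mul, Matrix.mul_one,
      Equiv.Perm.permMatrix, PEquiv.mul_toMatrix_toPEquiv]
    ext e e'
    have := hM e (g⁻¹ e')
    simpa using this
  have h2 : Matrix.trace (f.permMatrix ℚ) = Matrix.trace (g.permMatrix ℚ) := by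
    calc Matrix.trace (f.permMatrix ℚ) = Matrix.trace (f.permMatrix ℚ * M * N) := by
          rw [Matrix.mul_assoc, h, Matrix.mul_one]
      _ = Matrix.trace (M * g.permMatrix ℚ * N) := by rw [h1, inv_inv, Matrix.mul_one]
      _ = Matrix.trace (N * M * g.permMatrix ℚ) := by
          rw [Matrix.trace_mul_comm, Matrix.mul_assoc]
      _ = _ := by rw [mul_eq_one_comm.1 h, Matrix.one_mul]
  rw [Matrix.trace_permutation, Matrix.trace_permutation] at h2
  exact_mod_cast h2

theorem sum_sym2 {α : Type*} [Fintype α] [DecidableEq α] (h : Sym2 α → ℕ) :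
    (∑ p : α × α, h s(p.1, p.2)) + ∑ a : α, h s(a, a) = 2 * ∑ e, h e := by
  rw [← Finset.sum_fiberwise (Finset.univ : Finset (α × α)) (fun p => s(p.1, p.2)),
    ← Finset.sum_fiberwise (Finset.univ : Finset α) (fun a => s(a, a)),
    ← Finset.sum_add_distrib, Finset.mul_sum]
  refine Finset.sum_congr rfl fun e _ => ?_
  have h1 : ∀ p ∈ Finset.univ.filter (fun p : α × α => s(p.1, p.2) = e), h s(p.1, p.2) = h e :=
    fun p hp => by rw [(Finset.mem_filter.1 hp).2]
  have h2 : ∀ a ∈ Finset.univ.filter (fun a : α => s(a, a) = e), h s(a, a) = h e :=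
    fun p hp => by rw [(Finset.mem_filter.1 hp).2]
  rw [Finset.sum_congr rfl h1, Finset.sum_congr rfl h2,
    Finset.sum_const, Finset.sum_const, ← add_smul, smul_eq_mul]
  congr 1
  induction e using Sym2.ind with
  | _ x y =>
    by_cases hxy : x = y
    · subst hxy
      have e1 : (Finset.univ.filter fun p : α × α => s(p.1, p.2) = s(x, x)) = {(x, x)} := by
        ext p; simp [Prod.ext_iff]
      have e2 : (Finset.univ.filter fun a : α => s(a, a) = s(x, x)) = {x} := by
        ext p; simp
      rw [e1, e2]; rfl
    · have e1 : (Finset.univ.filter fun p : α × α => s(p.1, p.2) = s(x, y)) = {(x, y), (y, x)} := by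
        ext p; simp [Prod.ext_iff]
      have e2 : (Finset.univ.filter fun a : α => s(a, a) = s(x, y)) = ∅ := by
        ext a
        simp only [Finset.mem_filter, Finset.mem_univ, true_and, Sym2.eq_iff, Finset.notMem_empty,
          iff_false]
        rintro (⟨h1, h2⟩ | ⟨h1, h2⟩)
        · exact hxy (h1.symm.trans h2)
        · exact hxy (h2.symm.trans h1)
      rw [e1, e2, Finset.card_pair (by simp [Prod.ext_iff, hxy])]; rfl

theorem two_mul_ncard_fixedPoints_sym2 {α : Type*} [Fintype α] [DecidableEq α]
    {σ : Equiv.Perm α} (h : σ * σ = 1) :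
    2 * (Function.fixedPoints (Sym2.map σ)).ncard =
      (Finset.univ.filter fun a => σ a = a).card ^ 2 + Fintype.card α := by
  have hσ : ∀ a, σ (σ a) = a := fun a => by rw [← Equiv.Perm.mul_apply, h]; rfl
  have e : (Function.fixedPoints (Sym2.map σ)) =
      ((Finset.univ.filter fun e => Sym2.map σ e = e : Finset (Sym2 α)) : Set (Sym2 α)) := by
    ext e; simp [Function.fixedPoints, Function.IsFixedPt]
  rw [e, Set.ncard_coe_finset, Finset.card_filter, ← sum_sym2]
  have e2 : (∑ a : α, if Sym2.map σ s(a, a) = s(a, a) then 1 else 0) =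
      ∑ p : α × α, if p.1 = p.2 ∧ σ p.1 = p.1 then 1 else 0 := by
    rw [Fintype.sum_prod_type]
    refine Finset.sum_congr rfl fun a _ => ?_
    rw [Finset.sum_eq_single a]
    · simp
    · intro b _ hb
      rw [if_neg (fun h => hb h.1.symm)]
    · simp
  have e3 : (Finset.univ.filter fun a => σ a = a).card ^ 2 =
      ∑ p : α × α, if σ p.1 = p.1 ∧ σ p.2 = p.2 then 1 else 0 := by
    rw [sq, Finset.card_filter, Finset.sum_mul_sum, Fintype.sum_prod_type]
    refine Finset.sum_congr rfl fun a _ => Finset.sum_congr rfl fun b _ => ?_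
    by_cases h1 : σ a = a <;> by_cases h2 : σ b = b <;> simp [h1, h2]
  have e4 : Fintype.card α = ∑ p : α × α, if σ p.1 = p.2 then 1 else 0 := by
    rw [Fintype.sum_prod_type]
    simp [Finset.card_univ]
  rw [e2, e3, e4, ← Finset.sum_add_distrib, ← Finset.sum_add_distrib]
  refine Finset.sum_congr rfl fun ⟨a, b⟩ _ => ?_
  simp only [Sym2.map_mk, Sym2.eq_iff]
  have := hσ a
  have := hσ b
  by_cases h1 : σ a = a <;> by_cases h2 : σ b = b <;> by_cases h3 : σ a = b <;>
    by_cases h4 : σ b = a <;> by_cases h5 : a = b <;> simp_all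

/-- The symmetrized entry of an integer vector at an unordered pair. -/
def ent {n : ℕ} (v : PV) (e : Sym2 (Fin n)) : ℤ :=
  Sym2.lift ⟨fun a b : Fin n => v ((a : ℕ), (b : ℕ)) + v ((b : ℕ), (a : ℕ)), fun _ _ => add_comm _ _⟩ e

theorem ent_mk {n : ℕ} (v : PV) (a b : Fin n) :
    ent v s(a, b) = v ((a : ℕ), (b : ℕ)) + v ((b : ℕ), (a : ℕ)) := rfl

theorem ent_add {n : ℕ} (v w : PV) (e : Sym2 (Fin n)) : ent (v + w) e = ent v e + ent w e := by
  induction e using Sym2.ind with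
  | _ a b => simp only [ent_mk, Finsupp.add_apply]; ring

theorem ent_neg {n : ℕ} (v : PV) (e : Sym2 (Fin n)) : ent (-v) e = -ent v e := by
  induction e using Sym2.ind with
  | _ a b => simp only [ent_mk, Finsupp.neg_apply]; ring

theorem ent_zero {n : ℕ} (e : Sym2 (Fin n)) : ent 0 e = 0 := by
  induction e using Sym2.ind with
  | _ a b => simp [ent_mk]

theorem ent_mv {n : ℕ} (g : ArtinB n) (v : PV) (e : Sym2 (Fin n)) :
    ent (mv (prm n g) v) (Sym2.map (prmF n g) e) = ent v e := by
  induction e using Sym2.ind with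
  | _ a b => simp [ent_mk, mv_apply]

/-- The standard generators of the pure subgroup, indexed by unordered pairs. -/
def gen {n : ℕ} (e : Sym2 (Fin n)) : ArtinB n :=
  if e.inf = e.sup then X n e.inf else A n e.inf e.sup

theorem prm_gen {n : ℕ} (e : Sym2 (Fin n)) : prm n (gen e) = 1 := by
  rw [gen]
  split_ifs with h
  · exact prm_X _ _
  · have : e.inf < e.sup := lt_of_le_of_ne (Sym2.inf_le_sup e) fun h' => h h'
    exact prm_A this e.sup.2

theorem gen_diag {n : ℕ} (a : Fin n) : gen s(a, a) = X n a := by simp [gen]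

theorem gen_of_lt {n : ℕ} {a b : Fin n} (h : a < b) : gen s(a, b) = A n a b := by
  simp [gen, h.le, h.ne]

theorem sym2_cases {n : ℕ} {P : Sym2 (Fin n) → Prop} (h1 : ∀ a, P s(a, a))
    (h2 : ∀ a b, a < b → P s(a, b)) (e : Sym2 (Fin n)) : P e := by
  induction e using Sym2.ind with
  | _ a b =>
    rcases lt_trichotomy a b with h | rfl | h
    · exact h2 a b h
    · exact h1 a
    · rw [Sym2.eq_swap]; exact h2 b a h

theorem ent_gen {n : ℕ} (e e' : Sym2 (Fin n)) :
    ent (L n (gen e)) e' = if e = e' then 2 else 0 := by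
  induction e using sym2_cases with
  | h1 a =>
    rw [gen_diag, L_X _ a.2]
    induction e' using Sym2.ind with
    | _ c d =>
      simp only [ent_mk, Finsupp.single_apply, Prod.mk.injEq, Sym2.eq_iff, Fin.ext_iff]
      split_ifs <;> first | rfl | omega
  | h2 a b hab =>
    rw [gen_of_lt hab, L_A hab b.2]
    induction e' using Sym2.ind with
    | _ c d =>
      have : (a : ℕ) < b := hab
      simp only [ent_mk, Finsupp.add_apply, Finsupp.single_apply, Prod.mk.injEq, Sym2.eq_iff,
        Fin.ext_iff]
      split_ifs <;> first | rfl | omega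

section
variable {n : ℕ} {φ : ArtinB n →* ArtinB n} (hφ : ∀ p, prm n p = 1 → prm n (φ p) = 1)
include hφ

theorem two_mul_ent_map {p : ArtinB n} (hp : prm n p = 1) (e : Sym2 (Fin n)) :
    2 * ent (L n (φ p)) e = ∑ e', ent (L n p) e' * ent (L n (φ (gen e'))) e := by
  let K : Subgroup (ArtinB n) :=
    { carrier := {p | prm n p = 1 ∧
        2 * ent (L n (φ p)) e = ∑ e', ent (L n p) e' * ent (L n (φ (gen e'))) e}
      one_mem' := by simp [L_one, ent_zero]
      mul_mem' := by
        rintro a b ⟨ha, ha'⟩ ⟨hb, hb'⟩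
        refine ⟨by rw [map_mul, ha, hb, mul_one], ?_⟩
        rw [map_mul, L_mul_pure (hφ a ha), L_mul_pure ha, ent_add, mul_add, ha', hb',
          ← Finset.sum_add_distrib]
        exact Finset.sum_congr rfl fun e' _ => by rw [ent_add, add_mul]
      inv_mem' := by
        rintro a ⟨ha, ha'⟩
        refine ⟨by rw [map_inv, ha, inv_one], ?_⟩
        rw [map_inv, L_inv_pure (hφ a ha), L_inv_pure ha, ent_neg, mul_neg, ha',
          ← Finset.sum_neg_distrib]
        exact Finset.sum_congr rfl fun e' _ => by rw [ent_neg, neg_mul] }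
  have hK : ∀ e', gen e' ∈ K := fun e' => ⟨prm_gen e', by simp [ent_gen]⟩
  refine (pure_le K (fun i hi => ?_) (fun i j hij hj => ?_) p hp).2
  · have := hK s(⟨i, hi⟩, ⟨i, hi⟩)
    rwa [gen_diag] at this
  · have := hK s(⟨i, hij.trans hj⟩, ⟨j, hj⟩)
    rwa [gen_of_lt hij] at this

theorem ent_map_congr {p p' : ArtinB n} (hp : prm n p = 1) (hp' : prm n p' = 1)
    (h : ∀ e : Sym2 (Fin n), ent (L n p) e = ent (L n p') e) (e : Sym2 (Fin n)) :
    ent (L n (φ p)) e = ent (L n (φ p')) e := by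
  have := two_mul_ent_map hφ hp e
  simp only [h] at this
  rw [← two_mul_ent_map hφ hp' e] at this
  omega

theorem ent_map_conj (g : ArtinB n) (e e' : Sym2 (Fin n)) :
    ent (L n (φ (gen (Sym2.map (prmF n g) e')))) (Sym2.map (prmF n (φ g)) e) =
      ent (L n (φ (gen e'))) e := by
  rw [← ent_mv (φ g) (L n (φ (gen e'))) e, ← L_conj (φ g) (hφ _ (prm_gen e')), ← map_inv, ← map_mul,
    ← map_mul]
  refine ent_map_congr hφ (prm_gen _) (prm_conj_eq_one g (prm_gen e')) (fun f => ?_) _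
  rw [L_conj g (prm_gen e')]
  obtain ⟨f, rfl⟩ : ∃ f', f = Sym2.map (prmF n g) f' :=
    
    ⟨Sym2.map (prmF n g).symm f, by
      rw [Sym2.map_map, Equiv.self_comp_symm, Sym2.map_id, id]⟩
  rw [ent_mv, ent_gen, ent_gen]
  simp only [(Sym2.map.injective (prmF n g).injective).eq_iff]

theorem exists_ent_inverse (hs : Function.Surjective φ) :
    ∃ N : Matrix (Sym2 (Fin n)) (Sym2 (Fin n)) ℚ,
    (Matrix.of fun e e' : Sym2 (Fin n) => (ent (L n (φ (gen e'))) e : ℚ)) * N = 1 := by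
  have key : ∀ e : Sym2 (Fin n), ∃ c : Sym2 (Fin n) → ℚ, ∀ f,
      ∑ e', (ent (L n (φ (gen e'))) f : ℚ) * c e' = if f = e then 1 else 0 := by
    intro e
    obtain ⟨g, hg⟩ := hs (gen e)
    set k := orderOf (prmF n g) with hk
    have hk0 : 0 < k := orderOf_pos _
    have hp : prm n (g ^ k) = 1 := by
      have : prmF n (g ^ k) = prmF n 1 := by rw [map_pow, pow_orderOf_eq_one, map_one]
      rw [prmF_eq_iff.1 this, map_one]
    have hL : ∀ m : ℕ, L n (gen e ^ m) = m • L n (gen e) := by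
      intro m
      have := L_zpow_pure (prm_gen e) m
      simpa using this
    have hk' : (k : ℚ) ≠ 0 := by exact_mod_cast hk0.ne'
    refine ⟨fun e' => ent (L n (g ^ k)) e' / (4 * k), fun f => ?_⟩
    have h2 := two_mul_ent_map hφ hp f
    have h3 : ∀ m : ℕ, ent (L n (gen e ^ m)) f = if f = e then 2 * (m : ℤ) else 0 := by
      intro m
      induction m with
      | zero => simp [L_one, ent_zero]
      | succ m ih =>
        rw [pow_succ, L_mul_pure (by rw [map_pow, prm_gen, one_pow]), ent_add, ih, ent_gen]
        by_cases h : f = e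
        · subst h; simp; ring
        · simp [h, Ne.symm h]
    rw [map_pow, hg, h3] at h2
    have h4 : ∑ e', (ent (L n (φ (gen e'))) f : ℚ) * ((ent (L n (g ^ k)) e' : ℚ) / (4 * k)) =
        ((∑ e', ent (L n (g ^ k)) e' * ent (L n (φ (gen e'))) f : ℤ) : ℚ) / (4 * k) := by
      push_cast
      rw [Finset.sum_div]
      exact Finset.sum_congr rfl fun e' _ => by ring
    rw [h4, ← h2]
    split_ifs
    · push_cast; field_simp; norm_num
    · simp
  choose c hc using key
  refine ⟨Matrix.of fun e' e => c e e', ?_⟩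
  ext f e
  rw [Matrix.mul_apply, Matrix.one_apply]
  exact hc e f

end

/-- The permutation of unordered pairs induced by a permutation. -/
def symPerm {α : Type*} (σ : Equiv.Perm α) : Equiv.Perm (Sym2 α) where
  toFun := Sym2.map σ
  invFun := Sym2.map σ.symm
  left_inv e := by rw [Sym2.map_map, Equiv.symm_comp_self, Sym2.map_id, id]
  right_inv e := by rw [Sym2.map_map, Equiv.self_comp_symm, Sym2.map_id, id]

theorem isSwap_map {n : ℕ} (hn : 5 ≤ n) {φ : ArtinB n →* ArtinB n} (hs : Function.Surjective φ) :
    (prmF n (φ (sB n 0))).IsSwap := by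
  have hθ : Function.Surjective ((prmF n).comp φ) := prmF_surjective.comp hs
  have hφ : ∀ p, prm n p = 1 → prm n (φ p) = 1 := fun p hp => by
    have := map_pure_eq_one hn hθ hp
    rw [MonoidHom.comp_apply, ← map_one (prmF n), prmF_eq_iff, map_one] at this
    exact this
  obtain ⟨N, hN⟩ := exists_ent_inverse hφ hs
  have h2 : prmF n (φ (sB n 0)) * prmF n (φ (sB n 0)) = 1 :=
    sq_eq_one_of_surjective hn hθ (by omega : 0 + 1 < n)
  have h3 : prmF n (sB n 0) * prmF n (sB n 0) = 1 := by
    rw [prmF_sB (by omega)]; exact Equiv.swap_mul_self _ _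
  have h1 := ncard_fixedPoints_eq (f := symPerm (prmF n (φ (sB n 0))))
    (g := symPerm (prmF n (sB n 0))) hN
    (fun e e' => by
      simp only [Matrix.of_apply]
      exact_mod_cast ent_map_conj hφ (sB n 0) e e')
  have e1 := two_mul_ncard_fixedPoints_sym2 h2
  have e2 := two_mul_ncard_fixedPoints_sym2 h3
  have e3 : (Finset.univ.filter fun a => prmF n (φ (sB n 0)) a = a).card =
      (Finset.univ.filter fun a => prmF n (sB n 0) a = a).card := by
    have : (Finset.univ.filter fun a => prmF n (φ (sB n 0)) a = a).card ^ 2 =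
      (Finset.univ.filter fun a => prmF n (sB n 0) a = a).card ^ 2 := by
      have h1' : (Function.fixedPoints (Sym2.map (prmF n (φ (sB n 0))))).ncard =
        (Function.fixedPoints (Sym2.map (prmF n (sB n 0)))).ncard := h1
      omega
    exact Nat.pow_left_injective (by norm_num : 2 ≠ 0) this
  have e4 : ∀ σ : Equiv.Perm (Fin n),
      (Finset.univ.filter fun a => σ a = a).card + σ.support.card = n := by
    intro σ
    have := Finset.card_filter_add_card_filter_not (s := (Finset.univ : Finset (Fin n))) (fun a => σ a = a)
    rw [Finset.card_univ, Fintype.card_fin] at this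
    exact this
  rw [← Equiv.Perm.card_support_eq_two]
  have h5 : (prmF n (sB n 0)).support.card = 2 := by
    rw [Equiv.Perm.card_support_eq_two, prmF_sB (by omega : 0 + 1 < n)]
    exact Equiv.Perm.swap_isSwap_iff.2 (by simp [Fin.ext_iff])
  have h6 := e4 (prmF n (sB n 0))
  have h7 := e4 (prmF n (φ (sB n 0)))
  omega

end Braid

namespace Braid
open FreeGroup (of)
open Equiv (swap)

theorem swap_left_ne {α : Type*} [DecidableEq α] {a b c d : α} (hab : a ≠ b) (hcd : c ≠ d)
    (h : Commute (swap a b) (swap c d)) (hne : swap a b ≠ swap c d) : a ≠ c := by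
  rintro rfl
  have hbd : b ≠ d := fun e => hne (by rw [e])
  have := Equiv.congr_fun h.eq a
  simp only [Equiv.Perm.mul_apply, Equiv.swap_apply_left] at this
  rw [Equiv.swap_apply_of_ne_of_ne hcd.symm hbd.symm,
    Equiv.swap_apply_of_ne_of_ne hab.symm hbd] at this
  exact hbd this.symm

theorem swap_ne {α : Type*} [DecidableEq α] {a b c d : α} (hab : a ≠ b) (hcd : c ≠ d)
    (h : Commute (swap a b) (swap c d)) (hne : swap a b ≠ swap c d) :
    a ≠ c ∧ a ≠ d ∧ b ≠ c ∧ b ≠ d := by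
  refine ⟨swap_left_ne hab hcd h hne, swap_left_ne hab hcd.symm ?_ ?_,
    swap_left_ne hab.symm hcd ?_ ?_, swap_left_ne hab.symm hcd.symm ?_ ?_⟩
  all_goals simpa only [Equiv.swap_comm b a, Equiv.swap_comm d c]

theorem swap_eq_of_not_commute {α : Type*} [DecidableEq α] {a b c d : α}
    (h : ¬ Commute (swap a b) (swap c d)) : c = a ∨ c = b ∨ d = a ∨ d = b := by
  by_contra! hc
  obtain ⟨h1, h2, h3, h4⟩ := hc
  apply h
  have := Equiv.swap_apply_apply (swap a b) c d
  rw [Equiv.swap_apply_of_ne_of_ne h1 h2, Equiv.swap_apply_of_ne_of_ne h3 h4] at this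
  exact (eq_mul_inv_iff_mul_eq.1 this).symm

theorem BraidSeq.ne {Q : Type*} [Group Q] {N : ℕ} {s : ℕ → Q} (hs : BraidSeq N s) (hN : 5 ≤ N)
    {i j : ℕ} (hij : i < j) (hj : j + 1 < N) : s i ≠ s j := by
  intro h
  rcases Nat.lt_or_ge (i + 1) j with h1 | h1
  · rcases Nat.eq_zero_or_pos i with rfl | hi
    · rcases Nat.lt_or_ge (j + 2) N with h2 | h2
      · exact hs.not_comm j h2 (h ▸ hs.comm 0 (j + 1) (by omega) h2)
      · have := hs.comm 1 j (by omega) hj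
        rw [← h] at this
        exact hs.not_comm 0 (by omega) this.symm
    · obtain ⟨k, rfl⟩ : ∃ k, i = k + 1 := ⟨i - 1, by omega⟩
      have := hs.comm k j (by omega) hj
      rw [← h] at this
      exact hs.not_comm k (by omega) this
  · obtain rfl : j = i + 1 := by omega
    apply hs.not_comm i (by omega)
    rw [h]

theorem BraidSeq.exists_chain {α : Type*} [DecidableEq α] {N : ℕ} {s : ℕ → Equiv.Perm α}
    (hs : BraidSeq N s) (hN : 5 ≤ N) (hsw : ∀ i, i + 1 < N → (s i).IsSwap) :
    ∀ k, 2 ≤ k → k + 1 ≤ N → ∃ a : ℕ → α, (∀ i j, i < j → j ≤ k → a i ≠ a j) ∧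
      ∀ i, i < k → s i = swap (a i) (a (i + 1)) := by
  intro k hk
  induction k, hk using Nat.le_induction with
  | base =>
    intro _
    obtain ⟨p, q, hpq, h0⟩ := hsw 0 (by omega)
    obtain ⟨r, t, hrt, h1⟩ := hsw 1 (by omega)
    have hn := hs.not_comm 0 (by omega)
    have hne := hs.ne hN (Nat.zero_lt_one) (by omega)
    have key : ∀ p q r t : α, p ≠ q → r ≠ t → s 0 = swap p q → s 1 = swap r t → r = q →
        ∃ a : ℕ → α, (∀ i j, i < j → j ≤ 2 → a i ≠ a j) ∧
          ∀ i, i < 2 → s i = swap (a i) (a (i + 1)) := by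
      intro p q r t hpq hrt h0 h1 e
      subst e
      have hpt : p ≠ t := by
        rintro rfl
        exact hne (by rw [h0, h1, Equiv.swap_comm])
      refine ⟨fun i => if i = 0 then p else if i = 1 then r else t, ?_, ?_⟩
      · intro i j hij hj
        interval_cases j <;> interval_cases i <;> simp [*]
      · intro i hi
        interval_cases i
        · simpa using h0
        · simpa using h1
    simp only [zero_add] at hn
    rw [h0, h1] at hn
    rcases swap_eq_of_not_commute hn with e | e | e | e
    · exact key q p r t hpq.symm hrt (by rw [h0, Equiv.swap_comm]) h1 e
    · exact key p q r t hpq hrt h0 h1 e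
    · exact key q p t r hpq.symm hrt.symm (by rw [h0, Equiv.swap_comm])
        (by rw [h1, Equiv.swap_comm]) e
    · exact key p q t r hpq hrt.symm h0 (by rw [h1, Equiv.swap_comm]) e
  | succ k hk ih =>
    intro hkN
    obtain ⟨a, ha, hsa⟩ := ih (by omega)
    obtain ⟨m, rfl⟩ : ∃ m, k = m + 2 := ⟨k - 2, by omega⟩
    obtain ⟨p, q, hpq, h0⟩ := hsw (m + 2) (by omega)
    have hdis : ∀ i, i ≤ m → a i ≠ p ∧ a i ≠ q ∧ a (i + 1) ≠ p ∧ a (i + 1) ≠ q := by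
      intro i hi
      have hc := hs.comm i (m + 2) (by omega) (by omega)
      have hne := hs.ne hN (i := i) (j := m + 2) (by omega) (by omega)
      rw [hsa i (by omega), h0] at hc hne
      exact swap_ne (ha _ _ (by omega) (by omega)) hpq hc hne
    have hn := hs.not_comm (m + 1) (by omega)
    rw [hsa (m + 1) (by omega), show m + 1 + 1 = m + 2 from rfl, h0] at hn
    have key : ∀ p q, p ≠ q → s (m + 2) = swap p q →
        (∀ i, i ≤ m → a i ≠ p ∧ a i ≠ q ∧ a (i + 1) ≠ p ∧ a (i + 1) ≠ q) → p = a (m + 2) →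
        ∃ a : ℕ → α, (∀ i j, i < j → j ≤ m + 2 + 1 → a i ≠ a j) ∧
          ∀ i, i < m + 2 + 1 → s i = swap (a i) (a (i + 1)) := by
      intro p q hpq h0 hdis e
      subst e
      have hq : ∀ i, i ≤ m + 2 → a i ≠ q := by
        intro i hi
        rcases Nat.lt_or_ge m i with h | h
        · rcases Nat.lt_or_ge (m + 1) i with h' | h'
          · obtain rfl : i = m + 2 := by omega
            exact hpq
          · obtain rfl : i = m + 1 := by omega
            exact (hdis m le_rfl).2.2.2
        · exact (hdis i h).2.1
      refine ⟨fun i => if i = m + 3 then q else a i, ?_, ?_⟩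
      · intro i j hij hj
        simp only [if_neg (show i ≠ m + 3 by omega)]
        split_ifs with h
        · exact hq i (by omega)
        · exact ha i j hij (by omega)
      · intro i hi
        simp only [if_neg (show i ≠ m + 3 by omega)]
        split_ifs with h
        · obtain rfl : i = m + 2 := by omega
          exact h0
        · exact hsa i (by omega)
    have h' := hdis m le_rfl
    rcases swap_eq_of_not_commute hn with e | e | e | e
    · exact absurd e.symm h'.2.2.1
    · exact key p q hpq h0 hdis e
    · exact absurd e.symm h'.2.2.2
    · refine key q p hpq.symm (by rw [h0, Equiv.swap_comm]) (fun i hi => ?_) e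
      have := hdis i hi
      exact ⟨this.2.1, this.1, this.2.2.2, this.2.2.1⟩

theorem exists_conjComp_prm {n : ℕ} (hn : 5 ≤ n) {φ : ArtinB n →* ArtinB n}
    (hs : Function.Surjective φ) : ∃ x, ∀ g, prm n (conjComp x φ g) = prm n g := by
  have hθ : Function.Surjective ((prmF n).comp φ) := prmF_surjective.comp hs
  have hseq := braidSeq_of_surjective hn hθ
  have hsw : ∀ i, i + 1 < n → ((prmF n).comp φ (sB n i)).IsSwap := by
    intro i
    induction i with
    | zero => exact fun _ => isSwap_map hn hs
    | succ i ih =>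
      intro hi
      obtain ⟨a, b, hab, e⟩ := ih (by omega)
      rw [← pr_conj_sB hi, map_mul, map_mul, map_inv, e, ← Equiv.swap_apply_apply]
      exact Equiv.Perm.swap_isSwap_iff.2 fun h => hab (Equiv.injective _ h)
  obtain ⟨m, rfl⟩ : ∃ m, n = m + 1 := ⟨n - 1, by omega⟩
  obtain ⟨a, ha, hsa⟩ := hseq.exists_chain hn hsw m (by omega) le_rfl
  have hinj : Function.Injective (fun i : Fin (m + 1) => a i) := by
    intro i j hij
    by_contra hne
    rcases lt_or_gt_of_ne hne with h | h
    · exact ha i j h (by omega) hij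
    · exact ha j i h (by omega) hij.symm
  obtain ⟨σ, hσ⟩ : ∃ σ : Equiv.Perm (Fin (m + 1)), ∀ i, σ i = a i :=
    ⟨Equiv.ofBijective _ (Finite.injective_iff_bijective.1 hinj), fun _ => rfl⟩
  obtain ⟨x, hx⟩ := prmF_surjective σ⁻¹
  refine ⟨x, fun g => ?_⟩
  rw [← prmF_eq_iff]
  revert g
  refine DFunLike.congr_fun (?_ : (prmF (m + 1)).comp (conjComp x φ) = prmF (m + 1))
  refine ArtinB.hom_ext fun i hi => ?_
  simp only [MonoidHom.comp_apply, conjComp, MulEquiv.coe_toMonoidHom, MulAut.conj_apply, map_mul,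
    map_inv, hx, inv_inv]
  rcases Nat.lt_or_ge i m with h | h
  · have e := hsa i h
    rw [MonoidHom.comp_apply] at e
    have h1 := hσ ⟨i, by omega⟩
    have h2 := hσ ⟨i + 1, by omega⟩
    simp only at h1 h2
    rw [e, ← h1, ← h2, Equiv.swap_apply_apply, prmF_sB (by omega)]
    group
  · obtain rfl : i = m := by omega
    have e := map_X_eq_one hn hθ i (by omega)
    rw [X_last rfl, MonoidHom.comp_apply] at e
    have e' : prmF (i + 1) (sB (i + 1) i) = 1 := by
      rw [← map_one (prmF (i + 1)), prmF_eq_iff, prm_last rfl, map_one]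
    rw [e, e']
    group

end Braid

namespace Braid
open FreeGroup (of)

theorem exists_prm_eq {n : ℕ} {k l i j : ℕ} (hn : 4 ≤ n) (hk : k < n) (hl : l < n) (hi : i < n)
    (hj : j < n) (h1 : k ≠ l) (h2 : k ≠ i) (h3 : k ≠ j) (h4 : l ≠ i) (h5 : l ≠ j) (h6 : i ≠ j) :
    ∃ g, prm n g 0 = k ∧ prm n g 1 = l ∧ prm n g 2 = i ∧ prm n g 3 = j := by
  obtain ⟨σ, hσ⟩ := Equiv.Perm.exists_extending_pair (α := Fin 4)
    (Fin.castLE hn) (![⟨k, hk⟩, ⟨l, hl⟩, ⟨i, hi⟩, ⟨j, hj⟩] : Fin 4 → Fin n)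
    (Fin.castLE_injective hn) (by
      intro a b hab
      fin_cases a <;> fin_cases b <;> simp_all [eq_comm])
  obtain ⟨g, rfl⟩ := prmF_surjective σ
  refine ⟨g, ?_, ?_, ?_, ?_⟩
  · simpa using congrArg Fin.val (hσ 0)
  · simpa using congrArg Fin.val (hσ 1)
  · simpa using congrArg Fin.val (hσ 2)
  · simpa using congrArg Fin.val (hσ 3)

theorem exists_lt_ne {n : ℕ} (hn : 4 ≤ n) (k l i : ℕ) : ∃ j, j < n ∧ k ≠ j ∧ l ≠ j ∧ i ≠ j := by
  obtain ⟨j, hj, hj'⟩ := Finset.exists_mem_notMem_of_card_lt_card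
    (s := {k, l, i}) (t := Finset.range n) (by
      have := Finset.card_le_three (a := k) (b := l) (c := i)
      rw [Finset.card_range]; omega)
  simp only [Finset.mem_insert, Finset.mem_singleton, not_or] at hj'
  exact ⟨j, Finset.mem_range.1 hj, Ne.symm hj'.1, Ne.symm hj'.2.1, Ne.symm hj'.2.2⟩

section
variable {n : ℕ} {φ : ArtinB n →* ArtinB n} (hφ : ∀ g, prm n (φ g) = prm n g)
include hφ

theorem L_map_congr {p p' : ArtinB n} (hp : prm n p = 1) (hp' : prm n p' = 1)
    (h : L n p = L n p') (a b : ℕ) : L n (φ p) (a, b) = L n (φ p') (a, b) := by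
  rcases Nat.lt_or_ge a n with ha | ha
  · rcases Nat.lt_or_ge b n with hb | hb
    · have := ent_map_congr (fun p hp => by rw [hφ, hp]) hp hp' (fun e => by rw [h])
        s(⟨a, ha⟩, ⟨b, hb⟩)
      simp only [ent_mk] at this
      rw [L_symm (by rw [hφ, hp]) b a, L_symm (by rw [hφ, hp']) b a] at this
      omega
    · rw [L_of_le (Or.inr hb), L_of_le (Or.inr hb)]
  · rw [L_of_le (Or.inl ha), L_of_le (Or.inl ha)]

theorem L_map_equivariant (g : ArtinB n) {p p' : ArtinB n} (hp : prm n p = 1) (hp' : prm n p' = 1)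
    (h : L n p' = mv (prm n g) (L n p)) (a b : ℕ) :
    L n (φ p') (prm n g a, prm n g b) = L n (φ p) (a, b) := by
  rw [L_map_congr hφ hp' (prm_conj_eq_one g hp) (by rw [L_conj g hp, h]), map_mul, map_mul,
    map_inv, L_conj _ (by rw [hφ, hp]), mv_apply, hφ]
  simp

end

/-- Linking numbers of the images of the pure braids around one pole. -/
def PoleData {n : ℕ} (φ : ArtinB n →* ArtinB n) (a b c d : ℤ) : Prop :=
  ∀ k, k < n → ∀ P, prm n P = 1 → L n P = Finsupp.single (k, k) 1 →
    L n (φ P) (k, k) = a ∧ ∀ i, i < n → i ≠ k → L n (φ P) (i, i) = b ∧ L n (φ P) (k, i) = c ∧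
      L n (φ P) (i, k) = c ∧ ∀ j, j < n → j ≠ k → j ≠ i → L n (φ P) (i, j) = d

/-- Linking numbers of the images of the pure braids twisting two strands. -/
def TwistData {n : ℕ} (φ : ArtinB n →* ArtinB n) (p q s y z : ℤ) : Prop :=
  ∀ k l, k < n → l < n → k ≠ l → ∀ P, prm n P = 1 →
    L n P = Finsupp.single (k, l) 1 + Finsupp.single (l, k) 1 →
    L n (φ P) (k, l) = p ∧ L n (φ P) (k, k) = y ∧ ∀ i, i < n → i ≠ k → i ≠ l →
      L n (φ P) (i, i) = z ∧ L n (φ P) (k, i) = q ∧ L n (φ P) (i, k) = q ∧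
      ∀ j, j < n → j ≠ k → j ≠ l → j ≠ i → L n (φ P) (i, j) = s

theorem exists_poleData {n : ℕ} (hn : 4 ≤ n) {φ : ArtinB n →* ArtinB n}
    (hφ : ∀ g, prm n (φ g) = prm n g) : ∃ a b c d, PoleData φ a b c d := by
  refine ⟨L n (φ (X n 0)) (0, 0), L n (φ (X n 0)) (1, 1), L n (φ (X n 0)) (0, 1),
    L n (φ (X n 0)) (1, 2), fun k hk P hP hLP => ?_⟩
  have key : ∀ g, prm n g 0 = k → ∀ a b, L n (φ P) (prm n g a, prm n g b) =
      L n (φ (X n 0)) (a, b) := by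
    intro g hg a b
    refine L_map_equivariant hφ g (prm_X n 0) hP ?_ a b
    rw [L_X 0 (by omega), mv_single, hg, hLP]
  have k2 : ∀ i j, i < n → j < n → k ≠ i → k ≠ j → i ≠ j → ∃ g, prm n g 0 = k ∧ prm n g 1 = i ∧
      prm n g 2 = j := by
    intro i j hi hj h1 h2 h3
    obtain ⟨l, hl, h4, h5, h6⟩ := exists_lt_ne hn k i j
    obtain ⟨g, h⟩ := exists_prm_eq hn hk hi hj hl h1 h2 h4 h3 h5 h6
    exact ⟨g, h.1, h.2.1, h.2.2.1⟩
  have k1 : ∀ i, i < n → k ≠ i → ∃ g, prm n g 0 = k ∧ prm n g 1 = i := by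
    intro i hi h1
    obtain ⟨j, hj, h4, h5, h6⟩ := exists_lt_ne hn k i i
    obtain ⟨g, h⟩ := k2 i j hi hj h1 h4 h5
    exact ⟨g, h.1, h.2.1⟩
  refine ⟨?_, fun i hi hik => ⟨?_, ?_, ?_, fun j hj hjk hji => ?_⟩⟩
  · obtain ⟨i, hi, h1, -⟩ := exists_lt_ne hn k k k
    obtain ⟨g, h0, -⟩ := k1 i hi h1
    have := key g h0 0 0
    rwa [h0] at this
  · obtain ⟨g, h0, h1⟩ := k1 i hi hik.symm
    have := key g h0 1 1
    rwa [h1] at this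
  · obtain ⟨g, h0, h1⟩ := k1 i hi hik.symm
    have := key g h0 0 1
    rwa [h0, h1] at this
  · rw [L_symm (by rw [hφ, hP])]
    obtain ⟨g, h0, h1⟩ := k1 i hi hik.symm
    have := key g h0 0 1
    rwa [h0, h1] at this
  · obtain ⟨g, h0, h1, h2⟩ := k2 i j hi hj hik.symm hjk.symm hji.symm
    have := key g h0 1 2
    rwa [h1, h2] at this

theorem exists_twistData {n : ℕ} (hn : 4 ≤ n) {φ : ArtinB n →* ArtinB n}
    (hφ : ∀ g, prm n (φ g) = prm n g) : ∃ p q s y z, TwistData φ p q s y z := by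
  set Q := φ (sB n 0 ^ 2)
  refine ⟨L n Q (0, 1), L n Q (0, 2), L n Q (2, 3), L n Q (0, 0), L n Q (2, 2),
    fun k l hk hl hkl P hP hLP => ?_⟩
  have key : ∀ g, prm n g 0 = k → prm n g 1 = l → ∀ a b, L n (φ P) (prm n g a, prm n g b) =
      L n Q (a, b) := by
    intro g hg hg' a b
    refine L_map_equivariant hφ g (prm_sq (by omega)) hP ?_ a b
    rw [L_sq (by omega), map_add, mv_single, mv_single, zero_add, hg, hg', hLP]
  have k3 : ∀ i j, i < n → j < n → k ≠ i → k ≠ j → l ≠ i → l ≠ j → i ≠ j →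
      ∃ g, prm n g 0 = k ∧ prm n g 1 = l ∧ prm n g 2 = i ∧ prm n g 3 = j :=
    fun i j hi hj h1 h2 h3 h4 h5 => exists_prm_eq hn hk hl hi hj hkl h1 h2 h3 h4 h5
  have k2 : ∀ i, i < n → k ≠ i → l ≠ i → ∃ g, prm n g 0 = k ∧ prm n g 1 = l ∧
      prm n g 2 = i := by
    intro i hi h1 h2
    obtain ⟨j, hj, h4, h5, h6⟩ := exists_lt_ne hn k l i
    obtain ⟨g, h⟩ := k3 i j hi hj h1 h4 h2 h5 h6
    exact ⟨g, h.1, h.2.1, h.2.2.1⟩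
  obtain ⟨g₀, hg0, hg1⟩ : ∃ g, prm n g 0 = k ∧ prm n g 1 = l := by
    obtain ⟨j, hj, h4, h5, h6⟩ := exists_lt_ne hn k l l
    obtain ⟨g, h⟩ := k2 j hj h4 h5
    exact ⟨g, h.1, h.2.1⟩
  refine ⟨?_, ?_, fun i hi hik hil => ⟨?_, ?_, ?_, fun j hj hjk hjl hji => ?_⟩⟩
  · have := key g₀ hg0 hg1 0 1
    rwa [hg0, hg1] at this
  · have := key g₀ hg0 hg1 0 0
    rwa [hg0] at this
  · obtain ⟨g, h0, h1, h2⟩ := k2 i hi hik.symm hil.symm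
    have := key g h0 h1 2 2
    rwa [h2] at this
  · obtain ⟨g, h0, h1, h2⟩ := k2 i hi hik.symm hil.symm
    have := key g h0 h1 0 2
    rwa [h0, h2] at this
  · rw [L_symm (by rw [hφ, hP])]
    obtain ⟨g, h0, h1, h2⟩ := k2 i hi hik.symm hil.symm
    have := key g h0 h1 0 2
    rwa [h0, h2] at this
  · obtain ⟨g, h0, h1, h2, h3⟩ := k3 i j hi hj hik.symm hjk.symm hil.symm hjl.symm hji.symm
    have := key g h0 h1 2 3
    rwa [h2, h3] at this

theorem PoleData.iB {n : ℕ} {φ : ArtinB n →* ArtinB n} {a b c d : ℤ} (h : PoleData φ a b c d) :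
    PoleData ((iB n).comp φ) a b (a + b - c) (2 * b - d) := by
  intro k hk P hP hLP
  obtain ⟨h1, h2⟩ := h k hk P hP hLP
  simp only [MonoidHom.comp_apply]
  refine ⟨by rw [L_iB _ _ _ hk hk, if_pos rfl, h1], fun i hi hik => ?_⟩
  obtain ⟨h3, h4, h4', h5⟩ := h2 i hi hik
  refine ⟨by rw [L_iB _ _ _ hi hi, if_pos rfl, h3],
    by rw [L_iB _ _ _ hk hi, if_neg hik.symm, h1, h3, h4'],
    by rw [L_iB _ _ _ hi hk, if_neg hik, h1, h3, h4]; ring, fun j hj hjk hji => ?_⟩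
  rw [L_iB _ _ _ hi hj, if_neg hji.symm, h3, (h2 j hj hjk).1,
    (h2 j hj hjk).2.2.2 i hi hik hji.symm]
  ring

theorem TwistData.iB {n : ℕ} {φ : ArtinB n →* ArtinB n} {p q s y z : ℤ}
    (h : TwistData φ p q s y z) :
    TwistData ((iB n).comp φ) (2 * y - p) (y + z - q) (2 * z - s) y z := by
  intro k l hk hl hkl P hP hLP
  obtain ⟨h1, h2, h3⟩ := h k l hk hl hkl P hP hLP
  obtain ⟨h1', h2', -⟩ := h l k hl hk hkl.symm P hP (by rw [hLP, add_comm])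
  simp only [MonoidHom.comp_apply]
  refine ⟨by rw [L_iB _ _ _ hk hl, if_neg hkl, h1', h2, h2']; ring,
    by rw [L_iB _ _ _ hk hk, if_pos rfl, h2], fun i hi hik hil => ?_⟩
  obtain ⟨h4, h5, h5', h6⟩ := h3 i hi hik hil
  refine ⟨by rw [L_iB _ _ _ hi hi, if_pos rfl, h4],
    by rw [L_iB _ _ _ hk hi, if_neg hik.symm, h2, h4, h5'],
    by rw [L_iB _ _ _ hi hk, if_neg hik, h2, h4, h5]; ring, fun j hj hjk hjl hji => ?_⟩
  obtain ⟨h7, -, -, h8⟩ := h3 j hj hjk hjl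
  rw [L_iB _ _ _ hi hj, if_neg hji.symm, h4, h7, h8 i hi hik hil hji.symm]
  ring

theorem sum_range_four {n : ℕ} (hn : 4 ≤ n) {F : ℕ → ℤ} {t : ℤ}
    (h : ∀ b, 4 ≤ b → b < n → F b = t) :
    ∑ b ∈ Finset.range n, F b = F 0 + F 1 + F 2 + F 3 + ((n : ℤ) - 4) * t := by
  obtain ⟨m, rfl⟩ : ∃ m, n = m + 4 := ⟨n - 4, by omega⟩
  rw [Finset.sum_range_succ', Finset.sum_range_succ', Finset.sum_range_succ',
    Finset.sum_range_succ', Finset.sum_congr rfl (fun b hb =>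
      h (b + 1 + 1 + 1 + 1) (by omega) (by have := Finset.mem_range.1 hb; omega)),
    Finset.sum_const, Finset.card_range]
  simp only [nsmul_eq_mul, Nat.cast_add, zero_add, Nat.reduceAdd]
  push_cast
  ring

end Braid

namespace Braid
open FreeGroup (of)

theorem TwistData.eq {n : ℕ} (hn : 5 ≤ n) {φ : ArtinB n →* ArtinB n}
    (hφ : ∀ g, prm n (φ g) = prm n g) {p q s y z : ℤ} (h : TwistData φ p q s y z) : q = s := by
  set P := φ (sB n 0 ^ 2) with hP
  set Q := φ (sB n 2 ^ 2) with hQ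
  have hc : Commute P Q := (((sB_comm (by omega : 0 + 2 ≤ 2)).pow_pow 2 2).map φ)
  have e := lap_comm (by rw [hP, hφ, prm_sq (by omega)]) (by rw [hQ, hφ, prm_sq (by omega)]) hc
    (fun k => if k = 2 then 1 else 0) 0
  obtain ⟨a1, -, a3⟩ := h 0 1 (by omega) (by omega) (by omega) _ (prm_sq (by omega))
    (L_sq (by omega))
  obtain ⟨b1, -, b3⟩ := h 1 0 (by omega) (by omega) (by omega) _ (prm_sq (i := 0) (by omega))
    (by rw [L_sq (by omega), add_comm])
  obtain ⟨c1, -, c3⟩ := h 2 3 (by omega) (by omega) (by omega) _ (prm_sq (by omega))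
    (L_sq (by omega))
  obtain ⟨d1, -, d3⟩ := h 3 2 (by omega) (by omega) (by omega) _ (prm_sq (i := 2) (by omega))
    (by rw [L_sq (by omega), add_comm])
  rw [← hP] at a1 a3 b1 b3
  rw [← hQ] at c1 c3 d1 d3
  have vP : ∀ k l, k < 2 → 2 ≤ l → l < n → L n P (k, l) = q ∧ L n P (l, k) = q := by
    intro k l hk hl hln
    interval_cases k
    · exact ⟨(a3 l hln (by omega) (by omega)).2.1, (a3 l hln (by omega) (by omega)).2.2.1⟩
    · exact ⟨(b3 l hln (by omega) (by omega)).2.1, (b3 l hln (by omega) (by omega)).2.2.1⟩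
  have vP' : ∀ k l, 2 ≤ k → 2 ≤ l → k < n → l < n → k ≠ l → L n P (k, l) = s := by
    intro k l hk hl hkn hln hkl
    exact (a3 k hkn (by omega) (by omega)).2.2.2 l hln (by omega) (by omega) hkl.symm
  have vQ : ∀ k l, (k = 2 ∨ k = 3) → l ≠ 2 → l ≠ 3 → l < n →
      L n Q (k, l) = q ∧ L n Q (l, k) = q := by
    rintro k l (rfl | rfl) hl hl' hln
    · exact ⟨(c3 l hln (by omega) (by omega)).2.1, (c3 l hln (by omega) (by omega)).2.2.1⟩
    · exact ⟨(d3 l hln (by omega) (by omega)).2.1, (d3 l hln (by omega) (by omega)).2.2.1⟩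
  have vQ' : ∀ k l, k ≠ 2 → k ≠ 3 → l ≠ 2 → l ≠ 3 → k < n → l < n → k ≠ l →
      L n Q (k, l) = s := by
    intro k l h1 h2 h3 h4 hkn hln hkl
    exact (c3 k hkn (by omega) (by omega)).2.2.2 l hln (by omega) (by omega) hkl.symm
  have zero : ∀ g : ArtinB n, ∀ a b, n ≤ a ∨ n ≤ b → L n g (a, b) = 0 :=
    fun g a b hab => L_of_le hab g
  set f := fun k => lap (fun k => if k = 2 then 1 else 0) k (L n Q) with hf
  set g := fun k => lap (fun k => if k = 2 then 1 else 0) k (L n P) with hg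
  have f2 : f 2 = 2 * q + p + ((n : ℤ) - 4) * q := by
    simp only [hf]
    rw [lap_eq_sum (zero Q) _ (by omega), sum_range_four (by omega) (t := q)
      (fun b hb hbn => by
        rw [(vQ 2 b (Or.inl rfl) (by omega) (by omega) hbn).1, if_pos rfl, if_neg (by omega)]
        ring)]
    rw [(vQ 2 0 (Or.inl rfl) (by omega) (by omega) (by omega)).1,
      (vQ 2 1 (Or.inl rfl) (by omega) (by omega) (by omega)).1, c1]
    simp; ring
  have flap : ∀ (R : ArtinB n) k, k < n → k ≠ 2 →
      lap (fun k => if k = 2 then 1 else 0) k (L n R) = - L n R (k, 2) := by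
    intro R k hk hk2
    rw [lap_eq_sum (zero R) _ hk, Finset.sum_eq_single 2]
    · simp [hk2]
    · intro b _ hb
      simp [hk2, hb]
    · intro hb
      exact absurd (Finset.mem_range.2 (by omega)) hb
  have g2 : g 2 = 2 * q + s + ((n : ℤ) - 4) * s := by
    simp only [hg]
    rw [lap_eq_sum (zero P) _ (by omega), sum_range_four (by omega) (t := s)
      (fun b hb hbn => by
        rw [vP' 2 b (by omega) (by omega) (by omega) hbn (by omega), if_pos rfl,
          if_neg (by omega)]
        ring)]
    rw [(vP 0 2 (by omega) (by omega) (by omega)).2, (vP 1 2 (by omega) (by omega) (by omega)).2,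
      vP' 2 3 (by omega) (by omega) (by omega) (by omega) (by omega)]
    simp; ring
  have fk : ∀ k, k < n → k ≠ 2 → k ≠ 3 → f k = -q := by
    intro k hk h2 h3
    rw [hf]
    simp only
    rw [flap _ _ hk h2, (vQ 2 k (Or.inl rfl) h2 h3 hk).2]
  have f3 : f 3 = -p := by
    rw [hf]
    simp only
    rw [flap _ _ (by omega) (by omega), d1]
  have gk : ∀ k, k < 2 → g k = -q := by
    intro k hk
    rw [hg]
    simp only
    rw [flap _ _ (by omega) (by omega), (vP k 2 hk (by omega) (by omega)).1]
  have gk' : ∀ k, k < n → 3 ≤ k → g k = -s := by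
    intro k hk h2
    rw [hg]
    simp only
    rw [flap _ _ (by omega) (by omega), vP' k 2 (by omega) (by omega) hk (by omega) (by omega)]
  rw [lap_eq_sum (zero P) _ (by omega), lap_eq_sum (zero Q) _ (by omega),
    sum_range_four (by omega) (t := 0) (fun b hb hbn => by
      rw [fk 0 (by omega) (by omega) (by omega), fk b hbn (by omega) (by omega)]; ring),
    sum_range_four (by omega) (t := s * (s - q)) (fun b hb hbn => by
      rw [gk 0 (by omega), gk' b hbn (by omega),
        vQ' 0 b (by omega) (by omega) (by omega) (by omega) (by omega) hbn (by omega)]; ring),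
    f2, f3, fk 0 (by omega) (by omega) (by omega), fk 1 (by omega) (by omega) (by omega), g2,
    gk 0 (by omega), gk 1 (by omega), gk' 3 (by omega) (by omega),
    (vP 0 2 (by omega) (by omega) (by omega)).1, (vP 0 3 (by omega) (by omega) (by omega)).1,
    (vQ 2 0 (by omega) (by omega) (by omega) (by omega)).2,
    (vQ 3 0 (by omega) (by omega) (by omega) (by omega)).2] at e
  have e2 : ((n : ℤ) - 4) * (q - s) ^ 2 = 0 := by linear_combination -e
  rcases mul_eq_zero.1 e2 with h0 | h0
  · omega
  · exact sub_eq_zero.1 (pow_eq_zero_iff (two_ne_zero) |>.1 h0)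

theorem PoleData.mul_eq_zero {n : ℕ} (hn : 5 ≤ n) {φ : ArtinB n →* ArtinB n}
    (hφ : ∀ g, prm n (φ g) = prm n g) {a b c d p s y z : ℤ} (h : PoleData φ a b c d)
    (h' : TwistData φ p s s y z) : (c - d) * (c - d + (p - s)) = 0 := by
  set P := φ (sB n 0 ^ 2 * X n 0) with hP
  set Q := φ (X n 1) with hQ
  have hpX : ∀ i, prm n (φ (X n i)) = 1 := fun i => by rw [hφ, prm_X]
  have hp2 : prm n (φ (sB n 0 ^ 2)) = 1 := by rw [hφ, prm_sq (by omega)]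
  have hc : Commute P Q := by
    refine Commute.map ?_ φ
    have h4 := four_X (n := n) (i := 0) (by omega)
    rw [X_eq (by omega : 0 + 1 < n)]
    simp only [zero_add] at h4 ⊢
    rw [commute_iff_eq]
    calc _ = sB n 0 * X n 1 * sB n 0 * X n 1 := by group
      _ = _ := h4
      _ = _ := by group
  have e := lap_comm (by rw [hP, map_mul, map_mul, hpX, hp2, mul_one]) (hpX 1) hc
    (fun k => if k = 1 then 1 else 0) 0
  obtain ⟨-, a3⟩ := h 0 (by omega) _ (prm_X n 0) (L_X 0 (by omega))
  obtain ⟨-, b3⟩ := h 1 (by omega) _ (prm_X n 1) (L_X 1 (by omega))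
  obtain ⟨c1, -, c3⟩ := h' 0 1 (by omega) (by omega) (by omega) _ (prm_sq (by omega))
    (L_sq (by omega))
  obtain ⟨d1, -, d3⟩ := h' 1 0 (by omega) (by omega) (by omega) _ (prm_sq (i := 0) (by omega))
    (by rw [L_sq (by omega), add_comm])
  have hLP : ∀ i j, L n P (i, j) = L n (φ (sB n 0 ^ 2)) (i, j) + L n (φ (X n 0)) (i, j) := by
    intro i j
    rw [hP, map_mul, L_mul_pure hp2, Finsupp.add_apply]
  have zero : ∀ g : ArtinB n, ∀ a b, n ≤ a ∨ n ≤ b → L n g (a, b) = 0 :=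
    fun g a b hab => L_of_le hab g
  have P01 : L n P (0, 1) = p + c := by rw [hLP, c1, (a3 1 (by omega) (by omega)).2.1]
  have P10 : L n P (1, 0) = p + c := by rw [hLP, d1, (a3 1 (by omega) (by omega)).2.2.1]
  have P1 : ∀ k, 2 ≤ k → k < n → L n P (1, k) = s + d ∧ L n P (k, 1) = s + d := by
    intro k hk hkn
    rw [hLP, hLP, (d3 k hkn (by omega) (by omega)).2.1, (d3 k hkn (by omega) (by omega)).2.2.1,
      (a3 1 (by omega) (by omega)).2.2.2 k hkn (by omega) (by omega),
      (a3 k hkn (by omega)).2.2.2 1 (by omega) (by omega) (by omega)]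
    exact ⟨rfl, rfl⟩
  have Q1 : ∀ k, k ≠ 1 → k < n → L n Q (1, k) = c ∧ L n Q (k, 1) = c := fun k hk hkn =>
    ⟨(b3 k hkn hk).2.1, (b3 k hkn hk).2.2.1⟩
  have Q0 : ∀ k, 2 ≤ k → k < n → L n Q (0, k) = d := fun k hk hkn =>
    (b3 0 (by omega) (by omega)).2.2.2 k hkn (by omega) (by omega)
  set f := fun k => lap (fun k => if k = 1 then 1 else 0) k (L n Q) with hf
  set g := fun k => lap (fun k => if k = 1 then 1 else 0) k (L n P) with hg
  have flap : ∀ (R : ArtinB n) k, k < n → k ≠ 1 →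
      lap (fun k => if k = 1 then 1 else 0) k (L n R) = - L n R (k, 1) := by
    intro R k hk hk2
    rw [lap_eq_sum (zero R) _ hk, Finset.sum_eq_single 1]
    · simp [hk2]
    · intro b _ hb
      simp [hk2, hb]
    · intro hb
      exact absurd (Finset.mem_range.2 (by omega)) hb
  have f1 : f 1 = 3 * c + ((n : ℤ) - 4) * c := by
    simp only [hf]
    rw [lap_eq_sum (zero Q) _ (by omega), sum_range_four (by omega) (t := c)
      (fun b hb hbn => by
        rw [(Q1 b (by omega) hbn).1, if_pos rfl, if_neg (by omega)]
        ring)]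
    rw [(Q1 0 (by omega) (by omega)).1, (Q1 2 (by omega) (by omega)).1,
      (Q1 3 (by omega) (by omega)).1]
    simp; ring
  have g1 : g 1 = (p + c) + 2 * (s + d) + ((n : ℤ) - 4) * (s + d) := by
    simp only [hg]
    rw [lap_eq_sum (zero P) _ (by omega), sum_range_four (by omega) (t := s + d)
      (fun b hb hbn => by
        rw [(P1 b (by omega) hbn).1, if_pos rfl, if_neg (by omega)]
        ring)]
    rw [P10, (P1 2 (by omega) (by omega)).1, (P1 3 (by omega) (by omega)).1]
    simp; ring
  have fk : ∀ k, k < n → k ≠ 1 → f k = -c := by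
    intro k hk h2
    rw [hf]
    simp only
    rw [flap _ _ hk h2, (Q1 k h2 hk).2]
  have g0 : g 0 = -(p + c) := by
    rw [hg]
    simp only
    rw [flap _ _ (by omega) (by omega), P01]
  have gk : ∀ k, k < n → 2 ≤ k → g k = -(s + d) := by
    intro k hk h2
    rw [hg]
    simp only
    rw [flap _ _ (by omega) (by omega), (P1 k h2 hk).2]
  rw [lap_eq_sum (zero P) _ (by omega), lap_eq_sum (zero Q) _ (by omega),
    sum_range_four (by omega) (t := 0) (fun b hb hbn => by
      rw [fk 0 (by omega) (by omega), fk b hbn (by omega)]; ring),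
    sum_range_four (by omega) (t := d * ((s + d) - (p + c))) (fun b hb hbn => by
      rw [g0, gk b hbn (by omega), Q0 b (by omega) hbn]; ring),
    f1, g1, fk 0 (by omega) (by omega), fk 2 (by omega) (by omega), fk 3 (by omega) (by omega),
    g0, gk 2 (by omega) (by omega), gk 3 (by omega) (by omega), P01,
    (Q1 0 (by omega) (by omega)).2, Q0 2 (by omega) (by omega), Q0 3 (by omega) (by omega)] at e
  have e2 : ((n : ℤ) - 2) * ((c - d) * (c - d + (p - s))) = 0 := by linear_combination -e
  rcases _root_.mul_eq_zero.1 e2 with h0 | h0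
  · omega
  · exact h0

theorem PoleData.sub_eq {n : ℕ} (hn : 5 ≤ n) {φ : ArtinB n →* ArtinB n}
    (hφ : ∀ g, prm n (φ g) = prm n g) (hs : Function.Surjective φ)
    {a b c d p q s y : ℤ} (h : PoleData φ a b c d) (h' : TwistData φ p q s y y) :
    a - b = 1 ∨ a - b = -1 := by
  have hT : ∀ i j, i < j → j < n → ∀ k, k < n → L n (φ (A n i j)) (k, k) = y := by
    intro i j hij hj k hk
    obtain ⟨-, h1, h2⟩ := h' i j (by omega) hj (by omega) _ (prm_A hij hj) (L_A hij hj)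
    obtain ⟨-, h3, -⟩ := h' j i hj (by omega) (by omega) _ (prm_A hij hj)
      (by rw [L_A hij hj, add_comm])
    by_cases hki : k = i
    · rw [hki, h1]
    · by_cases hkj : k = j
      · rw [hkj, h3]
      · exact (h2 k hk hki hkj).1
  let K : Subgroup (ArtinB n) :=
    { carrier := {p | prm n p = 1 ∧ a - b ∣ L n (φ p) (0, 0) - L n (φ p) (1, 1)}
      one_mem' := by simp [L_one]
      mul_mem' := by
        rintro u v ⟨hu, hu'⟩ ⟨hv, hv'⟩
        refine ⟨by rw [map_mul, hu, hv, mul_one], ?_⟩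
        rw [map_mul, L_mul_pure (by rw [hφ, hu]), Finsupp.add_apply, Finsupp.add_apply,
          add_sub_add_comm]
        exact dvd_add hu' hv'
      inv_mem' := by
        rintro u ⟨hu, hu'⟩
        refine ⟨by rw [map_inv, hu, inv_one], ?_⟩
        rw [map_inv, L_inv_pure (by rw [hφ, hu]), Finsupp.neg_apply, Finsupp.neg_apply,
          neg_sub_neg, ← dvd_neg, neg_sub]
        exact hu' }
  obtain ⟨g, hg⟩ := hs (X n 0)
  have hK : g ∈ K := by
    refine pure_le K (fun i hi => ⟨prm_X n i, ?_⟩) (fun i j hij hj => ⟨prm_A hij hj, ?_⟩) g ?_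
    · obtain ⟨h1, h2⟩ := h i hi _ (prm_X n i) (L_X i hi)
      by_cases h0 : i = 0
      · subst h0
        rw [h1, (h2 1 (by omega) (by omega)).1]
      · by_cases h10 : i = 1
        · subst h10
          rw [h1, (h2 0 (by omega) (by omega)).1, ← dvd_neg, neg_sub]
        · rw [(h2 0 (by omega) (by omega)).1, (h2 1 (by omega) (by omega)).1, sub_self]
          exact dvd_zero _
    · rw [hT i j hij hj 0 (by omega), hT i j hij hj 1 (by omega), sub_self]
      exact dvd_zero _
    · rw [← hφ, hg, prm_X]
  have := hK.2
  rw [hg, L_X 0 (by omega)] at this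
  simp only [Finsupp.single_apply, Prod.mk.injEq] at this
  have h2 : a - b ∣ 1 := by simpa using this
  exact Int.isUnit_iff.1 (isUnit_of_dvd_one h2)

/-- After composing with the involution if necessary, the images of the poles do not wind around
each other nontrivially. -/
theorem exists_poleData_unit {n : ℕ} (hn : 5 ≤ n) {φ : ArtinB n →* ArtinB n}
    (hφ : ∀ g, prm n (φ g) = prm n g) (hs : Function.Surjective φ) :
    ∃ ε b d : ℤ, (ε = 1 ∨ ε = -1) ∧
      (PoleData φ (b + ε) b d d ∨ PoleData ((iB n).comp φ) (b + ε) b d d) := by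
  obtain ⟨a, b, c, d, h⟩ := exists_poleData (by omega) hφ
  obtain ⟨p, q, s, y, z, h'⟩ := exists_twistData (by omega) hφ
  have hφ' : ∀ g, prm n ((iB n).comp φ g) = prm n g := fun g => by
    rw [MonoidHom.comp_apply, prm_iB, hφ]
  obtain rfl := h'.eq hn hφ
  have hyz := h'.iB.eq hn hφ'
  obtain rfl : y = z := by linarith
  have h1 := h.mul_eq_zero hn hφ h'
  have h2' := h'.iB
  rw [show y + y - q = 2 * y - q by ring] at h2'
  have h2 := h.iB.mul_eq_zero hn hφ' h2'
  have h3 := h.sub_eq hn hφ hs h'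
  have hab : ∃ ε, (ε = 1 ∨ ε = -1) ∧ a = b + ε := ⟨a - b, h3, by ring⟩
  obtain ⟨ε, hε, rfl⟩ := hab
  rcases _root_.mul_eq_zero.1 h1 with h4 | h4
  · obtain rfl : c = d := by linarith
    exact ⟨ε, b, c, hε, Or.inl h⟩
  · rcases _root_.mul_eq_zero.1 h2 with h5 | h5
    · have h6 := h.iB
      rw [show b + ε + b - c = 2 * b - d by linarith] at h6
      exact ⟨ε, b, 2 * b - d, hε, Or.inr h6⟩
    · exfalso
      rcases hε with rfl | rfl <;> linarith

end Braid

namespace Braid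
open FreeGroup (of)

theorem hom_eq_of_kap {n : ℕ} {G : Type*} [Group G] {f g : FreeGroup ℕ →* G}
    (h : ∀ i, i < n → f (of i) = g (of i)) {u : FreeGroup ℕ} (hu : kap n u = u) : f u = g u := by
  have : f.comp (kap n) = g.comp (kap n) := by
    apply FreeGroup.ext_hom
    intro i
    rw [MonoidHom.comp_apply, MonoidHom.comp_apply]
    rcases lt_or_ge i n with hi | hi
    · rw [kap_of_lt hi, h i hi]
    · rw [kap_of_le hi, map_one, map_one]
  have h2 := DFunLike.congr_fun this u
  simpa only [MonoidHom.comp_apply, hu] using h2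

theorem isConj_iterate {G : Type*} [Group G] {τ : G →* G} {u : G} (h : IsConj u (τ u)) (N : ℕ) :
    IsConj u (τ^[N] u) := by
  induction N with
  | zero => exact IsConj.refl u
  | succ N ih =>
    rw [Function.iterate_succ_apply']
    exact h.trans (τ.map_isConj ih)

theorem eq_self_of_mem_avoid {c : ℕ} {f : FreeGroup ℕ →* FreeGroup ℕ}
    (hf : ∀ i, i ≠ c → f (of i) = of i) {E : FreeGroup ℕ} (hE : E ∈ FreeGroup.avoid c) :
    f E = E := by
  induction hE using Subgroup.closure_induction with
  | mem x hx =>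
    obtain ⟨i, hi, rfl⟩ := hx
    exact hf i hi
  | one => exact map_one f
  | mul x y _ _ hx hy => rw [map_mul, hx, hy]
  | inv x _ hx => rw [map_inv, hx]

/-- The endomorphism of the free group sending the generator `c` to `c * E`. -/
def transv (c : ℕ) (E : FreeGroup ℕ) : FreeGroup ℕ →* FreeGroup ℕ :=
  FreeGroup.lift fun i => if i = c then of c * E else of i

theorem transv_self (c : ℕ) (E : FreeGroup ℕ) : transv c E (of c) = of c * E := by
  simp [transv]

theorem transv_of_ne {c i : ℕ} (h : i ≠ c) (E : FreeGroup ℕ) : transv c E (of i) = of i := by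
  simp [transv, h]

theorem transv_transv_inv {c : ℕ} {E : FreeGroup ℕ} (hE : E ∈ FreeGroup.avoid c) :
    (transv c E).comp (transv c E⁻¹) = MonoidHom.id _ := by
  apply FreeGroup.ext_hom
  intro i
  rw [MonoidHom.comp_apply, MonoidHom.id_apply]
  by_cases h : i = c
  · subst h
    rw [transv_self, map_mul, transv_self, map_inv,
      eq_self_of_mem_avoid (fun j hj => transv_of_ne hj E) hE, mul_inv_cancel_right]
  · rw [transv_of_ne h, transv_of_ne h]

/-- `transv c E` as an automorphism. -/
def transvEquiv {c : ℕ} {E : FreeGroup ℕ} (hE : E ∈ FreeGroup.avoid c) :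
    FreeGroup ℕ ≃* FreeGroup ℕ :=
  MonoidHom.toMulEquiv (transv c E) (transv c E⁻¹)
    (by
      have := transv_transv_inv (inv_mem hE)
      rwa [inv_inv] at this)
    (transv_transv_inv hE)

theorem transvEquiv_apply {c : ℕ} {E : FreeGroup ℕ} (hE : E ∈ FreeGroup.avoid c)
    (x : FreeGroup ℕ) : transvEquiv hE x = transv c E x := rfl

theorem isConj_of_twist {a w : ℕ} (haw : a ≠ w) (κ : FreeGroup ℕ ≃* FreeGroup ℕ)
    (hκa : κ (of a) = of a) {τ : FreeGroup ℕ →* FreeGroup ℕ} {ε : ℤ} (hε : ε ≠ 0)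
    (hτa : τ (of a) = κ (of w) ^ ε * of a * κ (of w) ^ (-ε))
    (hτ : ∀ b, b ≠ a → τ (κ (of b)) = κ (of b)) {u : FreeGroup ℕ} (hu : IsConj u (τ u)) :
    (∃ h ∈ FreeGroup.avoid a, IsConj u (κ h)) ∨
      ∃ h ∈ Subgroup.closure {of a, of w}, IsConj u (κ h) := by
  have hsa : κ.symm (of a) = of a := by rw [← hκa, MulEquiv.symm_apply_apply, hκa]
  let τ' : FreeGroup ℕ →* FreeGroup ℕ := (κ.symm.toMonoidHom.comp τ).comp κ.toMonoidHom
  have hτ' : ∀ x, τ' x = κ.symm (τ (κ x)) := fun x => rfl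
  have key := FreeGroup.isConj_of_partialConj_invariant haw τ' hε
    (by rw [hτ', hκa, hτa, map_mul, map_mul, map_zpow, map_zpow, MulEquiv.symm_apply_apply, hsa])
    (fun b hb => by rw [hτ', hτ b hb, MulEquiv.symm_apply_apply]) (u := κ.symm u)
    (isConj_iterate (by
      rw [hτ', MulEquiv.apply_symm_apply]
      exact κ.symm.toMonoidHom.map_isConj hu))
  have back : ∀ h, IsConj (κ.symm u) h → IsConj u (κ h) := by
    intro h hh
    have := κ.toMonoidHom.map_isConj hh
    simpa using this
  rcases key with ⟨h, hh, hc⟩ | ⟨h, hh, hc⟩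
  · exact Or.inl ⟨h, hh, back h hc⟩
  · exact Or.inr ⟨h, hh, back h hc⟩

theorem exists_D_eq (k : ℕ) : ∃ E ∈ FreeGroup.avoid 0, D (k + 1) = of 0 * E ∧
    ∀ i, k + 1 ≤ i → ex i E = 0 := by
  induction k with
  | zero => exact ⟨1, one_mem _, by rw [D_succ, D_zero, one_mul, mul_one], by simp⟩
  | succ k ih =>
    obtain ⟨E, hE, h, hx⟩ := ih
    refine ⟨E * of (k + 1), mul_mem hE (Subgroup.subset_closure ⟨k + 1, by simp, rfl⟩), ?_, ?_⟩
    · rw [D_succ, h, mul_assoc]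
    · intro i hi
      rw [ex_mul, hx i (by omega), ex_of, if_neg (by omega), add_zero]

theorem ex_eq_zero_of_mem_avoid {a : ℕ} {h : FreeGroup ℕ} (hh : h ∈ FreeGroup.avoid a) :
    ex a h = 0 := by
  induction hh using Subgroup.closure_induction with
  | mem x hx =>
    obtain ⟨i, hi, rfl⟩ := hx
    rw [ex_of, if_neg hi]
  | one => exact ex_one a
  | mul x y _ _ hx hy => rw [ex_mul, hx, hy, add_zero]
  | inv x _ hx => rw [ex_inv, hx, neg_zero]

theorem ex_transv {a c : ℕ} {E : FreeGroup ℕ} (hE : ex a E = 0) (f : FreeGroup ℕ) :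
    ex a (transv c E f) = ex a f := by
  induction f using FreeGroup.induction_on with
  | C1 => rw [map_one]
  | of i =>
    by_cases h : i = c
    · subst h
      rw [transv_self, ex_mul, hE, add_zero]
    · rw [transv_of_ne h]
  | inv_of i ih => rw [map_inv, ex_inv, ih, ex_inv]
  | mul x y hx hy => rw [map_mul, ex_mul, hx, hy, ex_mul]

/-- First reduction: the class meets the subgroup generated by the last letter and the
product of the others. -/
theorem exists_isConj_mem_closure {m : ℕ} {u : FreeGroup ℕ} (hk : kap (m + 2) u = u)
    (hc : ∀ p, prm (m + 2) p = 1 → IsConj u (act (m + 2) p u)) (he : ex (m + 1) u ≠ 0) :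
    ∃ v ∈ Subgroup.closure {of (m + 1), D (m + 1)}, IsConj u v := by
  obtain ⟨E, hE, hD, hEx⟩ := exists_D_eq m
  let τ : FreeGroup ℕ →* FreeGroup ℕ := FreeGroup.lift fun i =>
    if i = m + 1 then D (m + 1) * of (m + 1) * (D (m + 1))⁻¹ else of i
  have hτ1 : τ (of (m + 1)) = D (m + 1) * of (m + 1) * (D (m + 1))⁻¹ := by simp [τ]
  have hτ2 : ∀ i, i ≠ m + 1 → τ (of i) = of i := fun i hi => by simp [τ, hi]
  have hτD : ∀ k, k ≤ m + 1 → τ (D k) = D k := by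
    intro k hk
    induction k with
    | zero => rw [D_zero, map_one]
    | succ k ih => rw [D_succ, map_mul, ih (by omega), hτ2 k (by omega)]
  set p := pr (m + 2) m ^ (m + 1) with hp
  have hact : ∀ i, i < m + 1 → act (m + 2) p (of i) = (D (m + 1))⁻¹ * of i * D (m + 1) :=
    fun i hi => act_twist (by omega) hi
  have hact2 : act (m + 2) p (of (m + 1)) = of (m + 1) :=
    act_pr_pow_of_gt (by omega) (by omega) _
  have hpp : prm (m + 2) p = 1 := by
    ext i
    rw [Equiv.Perm.one_apply]
    rcases lt_or_ge i (m + 2) with hi | hi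
    · apply prm_eq_of_isConj
      rcases Nat.lt_or_ge i (m + 1) with h | h
      · rw [hact i h]
        exact isConj_iff.2 ⟨D (m + 1), by group⟩
      · rw [show i = m + 1 by omega, hact2]
    · exact prm_of_le hi p
  have hτu : τ u = MulAut.conj (D (m + 1)) (act (m + 2) p u) := by
    refine hom_eq_of_kap (g := (MulAut.conj (D (m + 1))).toMonoidHom.comp
      (act (m + 2) p).toMonoidHom) (n := m + 2) ?_ hk
    intro i hi
    simp only [MonoidHom.comp_apply, MulEquiv.coe_toMonoidHom, MulAut.conj_apply]
    rcases Nat.lt_or_ge i (m + 1) with h | h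
    · rw [hact i h, hτ2 i (by omega)]
      group
    · rw [show i = m + 1 by omega, hact2, hτ1]
  have hu : IsConj u (τ u) := by
    rw [hτu, MulAut.conj_apply]
    exact (hc p hpp).trans (isConj_iff.2 ⟨D (m + 1), rfl⟩)
  have hκ0 : transvEquiv hE (of 0) = D (m + 1) := by
    rw [transvEquiv_apply, transv_self, hD]
  have hκa : transvEquiv hE (of (m + 1)) = of (m + 1) := by
    rw [transvEquiv_apply, transv_of_ne (by omega)]
  rcases isConj_of_twist (a := m + 1) (w := 0) (by omega) (transvEquiv hE) hκa (τ := τ)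
    (ε := 1) one_ne_zero (by rw [hκ0, hτ1]; simp) (fun b hb => by
      by_cases h : b = 0
      · rw [h, hκ0, hτD _ le_rfl]
      · rw [transvEquiv_apply, transv_of_ne h, hτ2 b hb]) hu with ⟨h, hh, hc⟩ | ⟨h, hh, hc⟩
  · refine absurd ?_ he
    rw [ex_isConj _ hc, transvEquiv_apply, ex_transv (hEx _ le_rfl), ex_eq_zero_of_mem_avoid hh]
  · refine ⟨_, ?_, hc⟩
    have := Subgroup.mem_map_of_mem (transvEquiv hE).toMonoidHom hh
    rw [MonoidHom.map_closure, Set.image_pair] at this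
    simpa only [MulEquiv.coe_toMonoidHom, hκa, hκ0] using this

/-- A conjugacy class of the free group which is invariant under the pure braid group and has
nonzero exponent sum in the last letter consists of conjugates of powers of that letter, or of
conjugates of powers of the product of all letters. -/
theorem isConj_zpow_last {m : ℕ} {u : FreeGroup ℕ} (hk : kap (m + 3) u = u)
    (hc : ∀ p, prm (m + 3) p = 1 → IsConj u (act (m + 3) p u)) (he : ex (m + 2) u ≠ 0) :
    ∃ k : ℤ, IsConj u (of (m + 2) ^ k) ∨ IsConj u (D (m + 3) ^ k) := by
  obtain ⟨v, hv, huv⟩ := exists_isConj_mem_closure hk hc he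
  have hE : (of (m + 2) : FreeGroup ℕ) ∈ FreeGroup.avoid (m + 1) :=
    Subgroup.subset_closure ⟨m + 2, by simp, rfl⟩
  have hκb : transvEquiv hE (of (m + 1)) = of (m + 1) * of (m + 2) := by
    rw [transvEquiv_apply, transv_self]
  have hκ : ∀ i, i ≠ m + 1 → transvEquiv hE (of i) = of i := fun i hi => by
    rw [transvEquiv_apply, transv_of_ne hi]
  have hact : ∀ x, act (m + 3) (sB (m + 3) (m + 1) ^ 2) x = ht (m + 1) (ht (m + 1) x) := by
    intro x
    rw [map_pow, act_sB (by omega), pow_two, MulAut.mul_apply]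
  let r : FreeGroup ℕ →* FreeGroup ℕ := FreeGroup.lift fun i =>
    if i = m + 2 then of (m + 2) else if i = m + 1 then (of (m + 2))⁻¹ else
      if i = 0 then D (m + 3) else 1
  have hra : r (of (m + 2)) = of (m + 2) := by simp [r]
  have hrb : r (of (m + 1)) = (of (m + 2))⁻¹ := by simp [r]
  have hr0 : r (of 0) = D (m + 3) := by simp [r]
  have hr : ∀ i, i ≠ m + 2 → i ≠ m + 1 → i ≠ 0 → r (of i) = 1 := fun i h1 h2 h3 => by
    simp [r, h1, h2, h3]
  have hrD : ∀ k, k < m + 1 → r (D (k + 1)) = D (m + 3) := by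
    intro k hk
    induction k with
    | zero => rw [D_succ, D_zero, one_mul, hr0]
    | succ k ih => rw [D_succ, map_mul, ih (by omega), hr _ (by omega) (by omega) (by omega),
        mul_one]
  have hrw : r (D (m + 2)) = D (m + 2) := by
    rw [D_succ (m + 1), map_mul, hrD m (by omega), hrb, D_succ (m + 2), D_succ (m + 1)]
    group
  have hrv : r v = v := by
    have h := Subgroup.mem_map_of_mem r hv
    clear huv
    induction hv using Subgroup.closure_induction with
    | mem x hx =>
      rcases hx with rfl | rfl
      · exact hra
      · exact hrw
    | one => exact map_one r
    | mul x y hx' hy' hx hy =>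
      rw [map_mul, hx (Subgroup.mem_map_of_mem r hx'), hy (Subgroup.mem_map_of_mem r hy')]
    | inv x hx' hx => rw [map_inv, hx (Subgroup.mem_map_of_mem r hx')]
  have fin : ∀ h, IsConj u (transvEquiv hE h) → IsConj u (r (transvEquiv hE h)) := by
    intro h hh
    have := r.map_isConj (huv.symm.trans hh)
    rw [hrv] at this
    exact huv.trans this
  have huτ := hc (sB (m + 3) (m + 1) ^ 2) (prm_sq (by omega))
  rcases isConj_of_twist (a := m + 2) (w := m + 1) (by omega) (transvEquiv hE)
    (hκ _ (by omega)) (τ := (act (m + 3) (sB (m + 3) (m + 1) ^ 2)).toMonoidHom)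
    (ε := -1) (by norm_num) (by
      rw [hκb, MulEquiv.coe_toMonoidHom, hact, ht_succ, map_mul, map_mul, map_inv, ht_self,
        ht_succ]
      group) (fun b hb => by
      rw [MulEquiv.coe_toMonoidHom, hact]
      by_cases h : b = m + 1
      · rw [h, hκb, map_mul, map_mul, ht_self, ht_succ, map_mul, map_mul, map_inv, ht_self,
          ht_succ]
        group
      · rw [hκ b h, ht_of_ne h (by omega), ht_of_ne h (by omega)]) huτ
    with ⟨h, hh, hc⟩ | ⟨h, hh, hc⟩
  · have h1 : r (transvEquiv hE h) ∈ Subgroup.zpowers (D (m + 3)) := by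
      clear hc
      induction hh using Subgroup.closure_induction with
      | mem x hx =>
        obtain ⟨i, hi, rfl⟩ := hx
        by_cases h : i = m + 1
        · rw [h, hκb, map_mul, hrb, hra, inv_mul_cancel]
          exact one_mem _
        · rw [hκ i h]
          by_cases h0 : i = 0
          · rw [h0, hr0]
            exact Subgroup.mem_zpowers _
          · rw [hr i hi h h0]
            exact one_mem _
      | one => rw [map_one, map_one]; exact one_mem _
      | mul x y _ _ hx hy => rw [map_mul, map_mul]; exact mul_mem hx hy
      | inv x _ hx => rw [map_inv, map_inv]; exact inv_mem hx
    obtain ⟨k, hk⟩ := Subgroup.mem_zpowers_iff.1 h1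
    exact ⟨k, Or.inr (hk ▸ fin h hc)⟩
  · have h1 : r (transvEquiv hE h) ∈ Subgroup.zpowers (of (m + 2)) := by
      clear hc
      induction hh using Subgroup.closure_induction with
      | mem x hx =>
        rcases hx with rfl | rfl
        · rw [hκ _ (by omega), hra]
          exact Subgroup.mem_zpowers _
        · rw [hκb, map_mul, hrb, hra, inv_mul_cancel]
          exact one_mem _
      | one => rw [map_one, map_one]; exact one_mem _
      | mul x y _ _ hx hy => rw [map_mul, map_mul]; exact mul_mem hx hy
      | inv x _ hx => rw [map_inv, map_inv]; exact inv_mem hx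
    obtain ⟨k, hk⟩ := Subgroup.mem_zpowers_iff.1 h1
    exact ⟨k, Or.inl (hk ▸ fin h hc)⟩

theorem act_D {n : ℕ} (g : ArtinB n) : ∃ ω, act n g (D n) = ω * D n * ω⁻¹ := by
  obtain ⟨f, hf, hg⟩ := exists_Xh_mul_eB g
  refine ⟨f, ?_⟩
  rw [hg, map_mul, MulAut.mul_apply, act_eB_D, act_Xh, hf, MulAut.conj_apply]

theorem ex_act {n : ℕ} (g : ArtinB n) (j : ℕ) (f : FreeGroup ℕ) :
    ex (prm n g j) (act n g f) = ex j f := by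
  induction f using FreeGroup.induction_on with
  | C1 => rw [map_one, ex_one, ex_one]
  | of i =>
    obtain ⟨ω, h⟩ := act_of_conj g i
    rw [h, ex_conj, ex_of, ex_of]
    simp only [EmbeddingLike.apply_eq_iff_eq]
  | inv_of i ih => rw [map_inv, ex_inv, ih, ex_inv]
  | mul x y hx hy => rw [map_mul, ex_mul, hx, hy, ex_mul]

/-- The same with an arbitrary letter in place of the last one. -/
theorem isConj_zpow_of_invariant {m : ℕ} {u : FreeGroup ℕ} (hk : kap (m + 3) u = u)
    (hc : ∀ p, prm (m + 3) p = 1 → IsConj u (act (m + 3) p u)) {g : ArtinB (m + 3)} {j : ℕ}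
    (hg : prm (m + 3) g j = m + 2) (he : ex j u ≠ 0) :
    ∃ k : ℤ, IsConj u (of j ^ k) ∨ IsConj u (D (m + 3) ^ k) := by
  have back : ∀ x, IsConj (act (m + 3) g u) x → IsConj u (act (m + 3) g⁻¹ x) := by
    intro x hx
    have := (act (m + 3) g⁻¹).toMonoidHom.map_isConj hx
    rwa [MulEquiv.coe_toMonoidHom, ← MulAut.mul_apply, ← map_mul, inv_mul_cancel, map_one,
      MulAut.one_apply] at this
  obtain ⟨k, h⟩ := isConj_zpow_last (u := act (m + 3) g u) (by rw [kap_act, hk])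
    (fun p hp => by
      have h1 := hc (g⁻¹ * p * g⁻¹⁻¹) (prm_conj_eq_one _ hp)
      have := (act (m + 3) g).toMonoidHom.map_isConj h1
      rwa [MulEquiv.coe_toMonoidHom, ← MulAut.mul_apply, ← map_mul,
        show g * (g⁻¹ * p * g⁻¹⁻¹) = p * g by group, map_mul, MulAut.mul_apply] at this)
    (by rwa [← hg, ex_act])
  refine ⟨k, h.imp (fun h => (back _ h).trans ?_) (fun h => (back _ h).trans ?_)⟩
  · obtain ⟨ω, hω⟩ := act_of_conj g⁻¹ (m + 2)
    rw [map_zpow, hω, map_inv, ← hg, show (prm (m + 3) g)⁻¹ (prm (m + 3) g j) = j by simp, conj_zpow]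
    exact (isConj_iff.2 ⟨ω, rfl⟩).symm
  · obtain ⟨ω, hω⟩ := act_D g⁻¹
    rw [map_zpow, hω, conj_zpow]
    exact (isConj_iff.2 ⟨ω, rfl⟩).symm

end Braid

namespace Braid
open FreeGroup (of)

theorem Delta_zpow_commute {n : ℕ} (hn : 0 < n) (k : ℤ) (g : ArtinB n) :
    Commute (ΔB n ^ k) g := (Delta_commute hn g).zpow_left k

section
variable {n : ℕ} (hn : 0 < n) {ψ : ArtinB n →* ArtinB n} {u : ℕ → FreeGroup ℕ} {d : ℤ}
  (hu : ∀ i, i < n → ψ (X n i) = Xh n (u i) * ΔB n ^ d)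
include hn hu

theorem map_Xh_eq (f : FreeGroup ℕ) :
    ∃ k : ℤ, ψ (Xh n f) = Xh n (FreeGroup.lift u (kap n f)) * ΔB n ^ k := by
  induction f using FreeGroup.induction_on with
  | C1 => exact ⟨0, by simp⟩
  | of i =>
    rcases lt_or_ge i n with hi | hi
    · exact ⟨d, by rw [Xh_of, hu i hi, kap_of_lt hi, FreeGroup.lift_apply_of]⟩
    · exact ⟨0, by rw [Xh_of, X_of_le hi, kap_of_le hi]; simp⟩
  | inv_of i ih =>
    obtain ⟨k, hk⟩ := ih
    refine ⟨-k, ?_⟩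
    rw [map_inv, map_inv, hk, map_inv, map_inv, map_inv, mul_inv_rev, ← zpow_neg]
    exact Delta_zpow_commute hn _ _
  | mul x y hx hy =>
    obtain ⟨k, hk⟩ := hx
    obtain ⟨l, hl⟩ := hy
    refine ⟨k + l, ?_⟩
    rw [map_mul, map_mul, hk, hl, map_mul, map_mul, map_mul, zpow_add, mul_assoc, mul_assoc,
      ← mul_assoc (ΔB n ^ k), (Delta_zpow_commute hn k _).eq, mul_assoc]

theorem map_Xh_D {k : ℕ} (hk : k ≤ n) :
    ψ (Xh n (D k)) = Xh n (FreeGroup.lift u (D k)) * ΔB n ^ (k * d) := by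
  induction k with
  | zero => simp
  | succ k ih =>
    rw [D_succ, map_mul, map_mul, ih (by omega), Xh_of, hu k (by omega), map_mul, map_mul,
      FreeGroup.lift_apply_of, mul_assoc, ← mul_assoc (ΔB n ^ _), (Delta_zpow_commute hn _ _).eq,
      show ((k + 1 : ℕ) : ℤ) * d = k * d + d by push_cast; ring, zpow_add]
    group

theorem map_conj_Xh (ω t : FreeGroup ℕ) :
    ψ (Xh n (ω * t * ω⁻¹)) = Xh n (FreeGroup.lift u (kap n ω)) * ψ (Xh n t) *
      (Xh n (FreeGroup.lift u (kap n ω)))⁻¹ := by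
  obtain ⟨k, hk⟩ := map_Xh_eq hn hu ω
  simp only [map_mul, map_inv, hk]
  rw [mul_inv_rev, mul_assoc _ (ΔB n ^ k), (Delta_zpow_commute hn k _).eq]
  group

theorem isConj_act_of_map (hs : Function.Surjective ψ)
    (hψ : ∀ g, prm n (ψ g) = prm n g) {t U : FreeGroup ℕ}
    (hact : ∀ g, prm n g = 1 → ∃ ω, act n g t = ω * t * ω⁻¹) (hU : kap n U = U) {e : ℤ}
    (htU : ψ (Xh n t) = Xh n U * ΔB n ^ e) (p : ArtinB n) (hp : prm n p = 1) :
    IsConj U (act n p U) := by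
  obtain ⟨g, rfl⟩ := hs p
  rw [hψ] at hp
  obtain ⟨ω, hω⟩ := hact g hp
  have h1 := map_conj_Xh hn hu ω t
  rw [← hω, ← conj_Xh, map_mul, map_mul, map_inv, htU] at h1
  have h2 : Xh n (act n (ψ g) U) = Xh n (FreeGroup.lift u (kap n ω) * U *
      (FreeGroup.lift u (kap n ω))⁻¹) := by
    rw [← conj_Xh, map_mul, map_mul, map_inv]
    have hc := fun x => (Delta_zpow_commute hn e x).eq
    rw [← mul_assoc, mul_assoc _ (ΔB n ^ e), hc, ← mul_assoc, ← mul_assoc, mul_assoc _ (ΔB n ^ e),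
      hc, ← mul_assoc] at h1
    exact mul_right_cancel h1
  have h3 := kap_eq_of_Xh_eq h2
  rw [kap_act, hU, map_mul, map_mul, hU, map_inv] at h3
  rw [h3]
  exact isConj_iff.2 ⟨_, rfl⟩

end

theorem exists_prm_apply {n a b : ℕ} (ha : a < n) (hb : b < n) : ∃ g, prm n g a = b := by
  have key : ∀ k, k < n → ∃ g, prm n g 0 = k := by
    intro k hk
    exact ⟨(pr n k)⁻¹, by rw [map_inv, Equiv.Perm.inv_eq_iff_eq, prm_pr_self hk]⟩
  obtain ⟨g, hg⟩ := key a ha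
  obtain ⟨h, hh⟩ := key b hb
  refine ⟨h * g⁻¹, ?_⟩
  rw [map_mul, Equiv.Perm.mul_apply, map_inv, Equiv.Perm.inv_eq_iff_eq.2 hg.symm, hh]

section
variable {m : ℕ} {φ : ArtinB (m + 1) →* ArtinB (m + 1)} {a b d : ℤ}
  (hφ : ∀ g, prm (m + 1) (φ g) = prm (m + 1) g) (hs : Function.Surjective φ)
  (hP : PoleData φ a b d d)
include hφ hP

theorem L_map_X {i : ℕ} (hi : i < m + 1) {j k : ℕ} (hj : j < m + 1) (hk : k < m + 1) :
    L (m + 1) (φ (X (m + 1) i)) (j, k) = if j = k then (if j = i then a else b) else d := by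
  obtain ⟨h1, h2⟩ := hP i hi (X (m + 1) i) (prm_X _ i) (L_X i hi)
  split_ifs with h h'
  · rw [← h, h', h1]
  · rw [← h, (h2 j hj h').1]
  · by_cases hji : j = i
    · rw [hji]
      exact (h2 k hk (by omega)).2.1
    · by_cases hki : k = i
      · rw [hki]
        exact (h2 j hj hji).2.2.1
      · exact (h2 j hj hji).2.2.2 k hk hki (by omega)

theorem L_map_X_mul {i : ℕ} (hi : i < m + 1) {j k : ℕ} (hj : j < m + 1) (hk : k < m + 1) :
    L (m + 1) (φ (X (m + 1) i) * ΔB (m + 1) ^ (-d)) (j, k) =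
      if j = k then (if j = i then a - d else b - d) else 0 := by
  have hD : L (m + 1) (ΔB (m + 1)) (j, k) = 1 := by rw [L_Delta, if_pos ⟨hj, hk⟩]
  rw [L_mul_pure (by rw [hφ, prm_X]), L_zpow_pure prm_Delta, Finsupp.add_apply,
    L_map_X hφ hP hi hj hk, Finsupp.smul_apply, hD, smul_eq_mul, mul_one]
  split_ifs <;> ring

include hs

theorem eB_map_X_mul {i : ℕ} (hi : i < m + 1) :
    eB (m + 1) (φ (X (m + 1) i) * ΔB (m + 1) ^ (-d)) = 1 := by
  set Y : Set (ArtinB (m + 1)) :=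
    {y | ∃ i, i < m + 1 ∧ y = φ (X (m + 1) i) * ΔB (m + 1) ^ (-d)} with hY
  have hpY : ∀ y ∈ Y, prm (m + 1) y = 1 := by
    rintro y ⟨i, hi, rfl⟩
    rw [map_mul, hφ, prm_X, map_zpow, prm_Delta, one_zpow, one_mul]
  have hX : ∀ f, ∃ ν ∈ Subgroup.closure Y, ∃ k : ℤ, φ (Xh (m + 1) f) = ν * ΔB (m + 1) ^ k := by
    intro f
    induction f using FreeGroup.induction_on with
    | C1 => exact ⟨1, one_mem _, 0, by simp⟩
    | of i =>
      rcases lt_or_ge i (m + 1) with hi | hi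
      · exact ⟨_, Subgroup.subset_closure ⟨i, hi, rfl⟩, d, by rw [Xh_of]; group⟩
      · exact ⟨1, one_mem _, 0, by rw [Xh_of, X_of_le hi]; simp⟩
    | inv_of i ih =>
      obtain ⟨ν, hν, k, hk⟩ := ih
      refine ⟨ν⁻¹, inv_mem hν, -k, ?_⟩
      rw [map_inv, map_inv, hk, mul_inv_rev, ← zpow_neg]
      exact Delta_zpow_commute (Nat.succ_pos m) _ _
    | mul x y hx hy =>
      obtain ⟨ν, hν, k, hk⟩ := hx
      obtain ⟨ξ, hξ, l, hl⟩ := hy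
      refine ⟨ν * ξ, mul_mem hν hξ, k + l, ?_⟩
      rw [map_mul, map_mul, hk, hl, zpow_add, mul_assoc, mul_assoc,
        ← mul_assoc (ΔB (m + 1) ^ k), (Delta_zpow_commute (Nat.succ_pos m) k _).eq, mul_assoc]
  refine eq_one_of_centralizing (Set.image (eB (m + 1)) Y) ?_ ?_ ?_ ?_ _ ⟨_, ⟨i, hi, rfl⟩, rfl⟩
  · rintro _ ⟨y, -, rfl⟩
    exact eB_eB y
  · rintro _ ⟨y, hy, rfl⟩
    rw [prm_eB, hpY y hy]
  · rintro _ ⟨y, ⟨i, hi, rfl⟩, rfl⟩ j k hjk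
    rw [L_eB, if_neg hjk]
    by_cases h : m + 1 ≤ j ∨ m + 1 ≤ k
    · exact L_of_le h _
    · rw [L_map_X_mul hφ hP hi (by omega) (by omega), if_neg hjk]
  · rintro p hp hp1 _ ⟨y, ⟨i, hi, rfl⟩, rfl⟩
    obtain ⟨g, rfl⟩ := hs p
    rw [hφ] at hp1
    obtain ⟨ω, hω⟩ := act_of_conj g i
    rw [hp1, Equiv.Perm.one_apply] at hω
    obtain ⟨ν, hν, k, hk⟩ := hX ω
    refine ⟨eB (m + 1) ν, ?_, ?_⟩
    · rw [← MonoidHom.map_closure]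
      exact Subgroup.mem_map_of_mem _ hν
    · have h1 : φ g * φ (X (m + 1) i) * (φ g)⁻¹ = ν * φ (X (m + 1) i) * ν⁻¹ := by
        rw [← map_inv, ← map_mul, ← map_mul, ← Xh_of, conj_Xh, hω, map_mul, map_mul, map_mul,
          map_mul, map_inv, map_inv, hk, mul_inv_rev, mul_assoc ν,
          (Delta_zpow_commute (Nat.succ_pos m) k _).eq]
        group
      have h2 : Commute (ν⁻¹ * φ g) (φ (X (m + 1) i)) := by
        rw [commute_iff_eq]
        calc ν⁻¹ * φ g * φ (X (m + 1) i) =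
            ν⁻¹ * (φ g * φ (X (m + 1) i) * (φ g)⁻¹) * φ g := by group
          _ = _ := by rw [h1]; group
      have h3 := (h2.mul_right (Delta_zpow_commute (Nat.succ_pos m) (-d) _).symm).map
        (eB (m + 1))
      rwa [map_mul, map_inv, hp] at h3

theorem exists_map_X_eq : ∃ u : ℕ → FreeGroup ℕ, ∀ i, i < m + 1 →
    kap (m + 1) (u i) = u i ∧ φ (X (m + 1) i) = Xh (m + 1) (u i) * ΔB (m + 1) ^ d ∧
      ∀ j, j < m + 1 → ex j (u i) = if j = i then a - d else b - d := by
  have : ∀ i, ∃ f : FreeGroup ℕ, i < m + 1 →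
      kap (m + 1) f = f ∧ φ (X (m + 1) i) = Xh (m + 1) f * ΔB (m + 1) ^ d ∧
      ∀ j, j < m + 1 → ex j f = if j = i then a - d else b - d := by
    intro i
    by_cases hi : i < m + 1
    · obtain ⟨f, hf, h⟩ := exists_Xh_of_eB_eq_one (eB_map_X_mul hφ hs hP hi)
      refine ⟨f, fun _ => ⟨hf, by rw [← h]; group, fun j hj => ?_⟩⟩
      have := L_map_X_mul hφ hP hi hj hj
      rwa [h, L_Xh, if_pos ⟨rfl, hj⟩, if_pos rfl] at this
    · exact ⟨1, fun h => absurd h hi⟩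
  exact ⟨fun i => (this i).choose, fun i => (this i).choose_spec⟩

end
end Braid

namespace Braid
open FreeGroup (of)

theorem ex_lift_D {u : ℕ → FreeGroup ℕ} {n j : ℕ} {ε : ℤ}
    (h : ∀ i, i < n → ex j (u i) = if j = i then ε else 0) (k : ℕ) (hk : k ≤ n) :
    ex j (FreeGroup.lift u (D k)) = if j < k then ε else 0 := by
  induction k with
  | zero => simp
  | succ k ih =>
    rw [D_succ, map_mul, ex_mul, ih (by omega), FreeGroup.lift_apply_of, h k (by omega)]
    split_ifs <;> omega

theorem kap_lift_D {u : ℕ → FreeGroup ℕ} {n : ℕ} (h : ∀ i, i < n → kap n (u i) = u i) (k : ℕ)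
    (hk : k ≤ n) : kap n (FreeGroup.lift u (D k)) = FreeGroup.lift u (D k) := by
  induction k with
  | zero => simp
  | succ k ih =>
    rw [D_succ, map_mul, map_mul, ih (by omega), FreeGroup.lift_apply_of, h k (by omega)]

/-- A surjective endomorphism preserving permutations and with unimodular abelian data sends, up
to central factors, the free generators to conjugates of their `ε`-th powers. -/
theorem exists_isConj_zpow {n : ℕ} (hn : 5 ≤ n) {φ : ArtinB n →* ArtinB n}
    (hφ : ∀ g, prm n (φ g) = prm n g) (hs : Function.Surjective φ) {ε b d : ℤ}
    (hε : ε = 1 ∨ ε = -1) (hP : PoleData φ (b + ε) b d d) :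
    ∃ u : ℕ → FreeGroup ℕ, (∀ i, i < n → kap n (u i) = u i ∧ φ (X n i) = Xh n (u i) * ΔB n ^ d ∧
      IsConj (u i) (of i ^ ε)) ∧ IsConj (FreeGroup.lift u (D n)) (D n ^ ε) := by
  obtain ⟨m, rfl⟩ : ∃ m, n = m + 3 := ⟨n - 3, by omega⟩
  have hε0 : ε ≠ 0 := by rcases hε with rfl | rfl <;> norm_num
  obtain ⟨u, hu⟩ := exists_map_X_eq hφ hs hP
  have hinv : ∀ i, i < m + 3 → ∀ p, prm (m + 3) p = 1 → IsConj (u i) (act (m + 3) p (u i)) := by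
    intro i hi
    refine isConj_act_of_map (Nat.succ_pos _) (fun i hi => (hu i hi).2.1) hs hφ (t := of i) ?_
      (hu i hi).1 (by rw [Xh_of]; exact (hu i hi).2.1)
    intro g hg
    obtain ⟨ω, hω⟩ := act_of_conj g i
    exact ⟨ω, by rw [hω, hg, Equiv.Perm.one_apply]⟩
  have cls : ∀ U : FreeGroup ℕ, kap (m + 3) U = U →
      (∀ p, prm (m + 3) p = 1 → IsConj U (act (m + 3) p U)) → ∀ j, j < m + 3 → ex j U ≠ 0 →
      ∃ k : ℤ, IsConj U (of j ^ k) ∨ IsConj U (D (m + 3) ^ k) := by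
    intro U h1 h2 j hj h3
    obtain ⟨g, hg⟩ := exists_prm_apply hj (show m + 2 < m + 3 by omega)
    exact isConj_zpow_of_invariant h1 h2 hg h3
  have hbd : b - d = 0 := by
    by_contra hne
    obtain ⟨h1, -, h2⟩ := hu 0 (by omega)
    have e0 := h2 0 (by omega)
    have e1 := h2 1 (by omega)
    have e2 := h2 2 (by omega)
    simp only [if_true, one_ne_zero, if_false, OfNat.ofNat_ne_zero] at e0 e1 e2
    obtain ⟨k, hk | hk⟩ := cls _ h1 (hinv 0 (by omega)) 1 (by omega) (by rwa [e1])
    · have := ex_isConj 2 hk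
      rw [ex_zpow, ex_of, e2] at this
      simp at this
      exact hne this
    · have h0 := ex_isConj 0 hk
      have h1 := ex_isConj 1 hk
      rw [ex_zpow, ex_D, if_pos (by omega)] at h0 h1
      apply hε0
      linarith
  have hex : ∀ i, i < m + 3 → ∀ j, j < m + 3 → ex j (u i) = if j = i then ε else 0 := by
    intro i hi j hj
    rw [(hu i hi).2.2 j hj, hbd, show b + ε - d = ε by linarith]
  refine ⟨u, fun i hi => ⟨(hu i hi).1, (hu i hi).2.1, ?_⟩, ?_⟩
  · obtain ⟨j, hj, hij⟩ : ∃ j, j < m + 3 ∧ j ≠ i := by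
      by_cases h : i = 0
      · exact ⟨1, by omega, by omega⟩
      · exact ⟨0, by omega, by omega⟩
    obtain ⟨k, hk | hk⟩ := cls _ (hu i hi).1 (hinv i hi) i hi
      (by rw [hex i hi i hi, if_pos rfl]; exact hε0)
    · have := ex_isConj i hk
      rw [hex i hi i hi, if_pos rfl, ex_zpow, ex_of, if_pos rfl, mul_one] at this
      rwa [this]
    · have h1 := ex_isConj i hk
      have h2 := ex_isConj j hk
      rw [hex i hi i hi, if_pos rfl, ex_zpow, ex_D, if_pos hi] at h1
      rw [hex i hi j hj, if_neg hij, ex_zpow, ex_D, if_pos hj] at h2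
      exact absurd (h1.trans h2.symm) hε0
  · have hexD : ∀ j, j < m + 3 → ex j (FreeGroup.lift u (D (m + 3))) = ε := by
      intro j hj
      rw [ex_lift_D (fun i hi => hex i hi j hj) _ le_rfl, if_pos hj]
    have hkD := kap_lift_D (fun i hi => (hu i hi).1) (m + 3) le_rfl
    have hinvD := isConj_act_of_map (Nat.succ_pos _) (fun i hi => (hu i hi).2.1) hs hφ
      (t := D (m + 3)) (fun g _ => act_D g) hkD
      (map_Xh_D (Nat.succ_pos _) (fun i hi => (hu i hi).2.1) le_rfl)
    obtain ⟨k, hk | hk⟩ := cls _ hkD hinvD 0 (by omega) (by rw [hexD 0 (by omega)]; exact hε0)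
    · have := ex_isConj 1 hk
      rw [hexD 1 (by omega), ex_zpow, ex_of, if_neg (by omega), mul_zero] at this
      exact absurd this hε0
    · have := ex_isConj 0 hk
      rw [hexD 0 (by omega), ex_zpow, ex_D, if_pos (by omega), mul_one] at this
      rwa [this]

/-- An endomorphism sending, up to central factors, the free generators to conjugates of free
generators, and compatible with their product, is up to conjugation trivial on the free
generators. -/
theorem exists_conjComp_X {n : ℕ} (hn : 0 < n) {ψ : ArtinB n →* ArtinB n} {u : ℕ → FreeGroup ℕ}
    {π : ℕ → ℕ} {d : ℤ} (hu : ∀ i, i < n → kap n (u i) = u i ∧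
      ψ (X n i) = Xh n (u i) * ΔB n ^ d ∧ IsConj (u i) (of (π i)))
    (hD : IsConj (FreeGroup.lift u (D n)) (D n)) :
    ∃ g, ∀ i, i < n → conjComp g ψ (X n i) = X n i * ΔB n ^ d := by
  obtain ⟨f, hf⟩ := isConj_iff.1 hD
  let α : FreeGroup ℕ →* FreeGroup ℕ := (MulAut.conj f).toMonoidHom.comp (FreeGroup.lift u)
  have hα : ∀ x, α x = f * FreeGroup.lift u x * f⁻¹ := fun x => rfl
  have hω : ∀ i, ∃ ω, i < n → α (of i) = ω * of (π i) * ω⁻¹ := by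
    intro i
    by_cases hi : i < n
    · obtain ⟨c, hc⟩ := isConj_iff.1 (hu i hi).2.2.symm
      exact ⟨f * c, fun _ => by rw [hα, FreeGroup.lift_apply_of, ← hc]; group⟩
    · exact ⟨1, fun h => absurd h hi⟩
  choose ω hω using hω
  obtain ⟨g, hg⟩ := exists_braid α ω π hω hf
  refine ⟨Xh n f * ψ (eB n g), fun i hi => ?_⟩
  obtain ⟨c, hc⟩ := act_of_conj (eB n g) i
  have hj : prm n (eB n g) i < n := prm_lt hi _
  set j := prm n (eB n g) i
  have h1 := map_conj_Xh hn (fun i hi => (hu i hi).2.1) c (of j)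
  rw [← hc, ← conj_Xh, Xh_of, Xh_of, (hu j hj).2.1] at h1
  have h2 : FreeGroup.lift u (act n (eB n g) (of i)) = FreeGroup.lift u (kap n c) * u j *
      (FreeGroup.lift u (kap n c))⁻¹ := by
    rw [← kap_of_lt hi, ← kap_act, hc]
    simp only [map_mul, map_inv, kap_of_lt hj, FreeGroup.lift_apply_of]
  have h3 := hg i hi
  rw [hα, h2] at h3
  simp only [conjComp, MonoidHom.comp_apply, MulEquiv.coe_toMonoidHom, MulAut.conj_apply]
  have h4 : Xh n f * ψ (eB n g) * ψ (X n i) * (Xh n f * ψ (eB n g))⁻¹ =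
      Xh n f * ψ (eB n g * X n i * (eB n g)⁻¹) * (Xh n f)⁻¹ := by
    rw [map_mul, map_mul, map_inv]
    group
  have h5 := congrArg (Xh n) h3
  rw [Xh_of] at h5
  rw [h4, h1, ← h5]
  simp only [map_mul, map_inv]
  have hc := fun x => (Delta_zpow_commute hn d x).eq
  rw [mul_assoc _ _ (ΔB n ^ d), ← hc, mul_assoc _ _ (Xh n f)⁻¹, mul_assoc]
  simp only [← mul_assoc, hc]
  simp only [mul_assoc, hc]

/-- An endomorphism which is trivial on the free generators, up to central factors, is trivial up
to central factors. -/
theorem exists_map_eq_mul {n : ℕ} (hn : 0 < n) {ψ : ArtinB n →* ArtinB n} {d : ℤ}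
    (h : ∀ i, i < n → ψ (X n i) = X n i * ΔB n ^ d) (g : ArtinB n) :
    ∃ k : ℤ, ψ g = g * ΔB n ^ k := by
  apply ext_of_conj_X hn
  intro i hi
  obtain ⟨c, hc⟩ := act_of_conj g i
  have hj : prm n g i < n := prm_lt hi _
  have hl : ∀ x : FreeGroup ℕ, FreeGroup.lift (fun i => of i) x = x := fun x =>
    DFunLike.congr_fun (FreeGroup.lift_of_eq_id ℕ) x
  have h1 := map_conj_Xh hn (u := fun i => of i) (fun i hi => by rw [h i hi, Xh_of]) c
    (of (prm n g i))
  rw [← hc, ← conj_Xh, Xh_of, Xh_of, h _ hj, map_mul, map_mul, map_inv, h i hi, hl, Xh_kap] at h1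
  have h2 : g * X n i * g⁻¹ = Xh n c * X n (prm n g i) * (Xh n c)⁻¹ := by
    rw [← Xh_of, conj_Xh, hc, map_mul, map_mul, map_inv, Xh_of]
  have hc := fun x => (Delta_zpow_commute hn d x).eq
  rw [← mul_assoc, mul_assoc _ (ΔB n ^ d), hc, ← mul_assoc, ← mul_assoc, mul_assoc _ (ΔB n ^ d),
    hc, ← mul_assoc] at h1
  rw [h2, mul_right_cancel h1]
end Braid

namespace Braid
open FreeGroup (of)

theorem isType2a_of_map_X {m : ℕ} {ψ : ArtinB (m + 3) →* ArtinB (m + 3)}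
    (hs : Function.Surjective ψ) {d : ℤ}
    (h : ∀ i, i < m + 3 → ψ (X (m + 3) i) = X (m + 3) i * ΔB (m + 3) ^ d) :
    ∃ p, IsType2a (m + 3) 1 p 0 ψ := by
  have hn : 0 < m + 3 := by omega
  have hc := fun k x => (Delta_zpow_commute hn k x).eq
  have ht := exists_map_eq_mul hn h
  obtain ⟨p, hp⟩ := ht (sB (m + 3) 0)
  obtain ⟨q, hq⟩ := ht (ρB (m + 3))
  have hconj : ∀ (x : ArtinB (m + 3)) (p : ℤ), ψ x = x * ΔB (m + 3) ^ p →
      ψ (ρB (m + 3) * x * (ρB (m + 3))⁻¹) = ρB (m + 3) * x * (ρB (m + 3))⁻¹ * ΔB (m + 3) ^ p := by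
    intro x p hx
    rw [map_mul, map_mul, map_inv, hx, hq, mul_inv_rev]
    calc ρB (m + 3) * ΔB (m + 3) ^ q * (x * ΔB (m + 3) ^ p) * ((ΔB (m + 3) ^ q)⁻¹ * (ρB (m + 3))⁻¹)
        = ρB (m + 3) * (ΔB (m + 3) ^ q * (x * ΔB (m + 3) ^ p)) * (ΔB (m + 3) ^ q)⁻¹ *
          (ρB (m + 3))⁻¹ := by group
      _ = ρB (m + 3) * x * (ΔB (m + 3) ^ p * (ρB (m + 3))⁻¹) := by rw [hc q]; group
      _ = _ := by rw [hc p]; group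
  have hsB : ∀ i, i + 1 < m + 3 → ψ (sB (m + 3) i) = sB (m + 3) i * ΔB (m + 3) ^ p := by
    intro i
    induction i with
    | zero => exact fun _ => hp
    | succ i ih =>
      intro hi
      have := rho_shift (n := m + 3) (i := i) (by omega)
      rw [← mul_inv_eq_iff_eq_mul] at this
      rw [← this]
      exact hconj _ _ (ih (by omega))
  have hq0 : q = 0 := by
    obtain ⟨g, hg⟩ := hs (ΔB (m + 3))
    obtain ⟨k, hk⟩ := ht g
    have hD : ψ (ΔB (m + 3)) = ΔB (m + 3) ^ (1 + (m + 3 : ℕ) * q) := by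
      conv_lhs => rw [ΔB, map_pow, hq, ((Delta_zpow_commute hn q _).symm).mul_pow]
      rw [zpow_add, zpow_one, mul_comm ((m + 3 : ℕ) : ℤ) q, zpow_mul, zpow_natCast]
      rfl
    have hg2 : g = ΔB (m + 3) ^ (1 - k) := by
      rw [zpow_sub, zpow_one, eq_mul_inv_iff_mul_eq, ← hk, hg]
    rw [hg2, map_zpow, hD, ← zpow_mul] at hg
    have h1 := Delta_zpow_injective hn (hg.trans (zpow_one _).symm)
    have h2 : IsUnit (1 + (m + 3 : ℕ) * q) := IsUnit.of_mul_eq_one _ h1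
    rcases Int.isUnit_iff.1 h2 with h3 | h3
    · have h4 : ((m + 3 : ℕ) : ℤ) * q = 0 := by linarith
      rcases _root_.mul_eq_zero.1 h4 with h5 | h5
      · omega
      · exact h5
    · have h4 : ((m + 3 : ℕ) : ℤ) * (-q) = 2 := by linarith
      have h5 := Int.le_of_dvd (by norm_num) (Dvd.intro _ h4)
      omega
  refine ⟨p, Or.inl rfl, ?_, by rw [hq, hq0]⟩
  intro i hi
  rw [zpow_one]
  rcases i with _ | i
  · rw [tB_zero]
    exact hconj _ _ (hsB (m + 1) (by omega))
  · rw [tB_succ hi]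
    exact hsB i hi

theorem conjComp_conjComp {G : Type*} [Group G] (x y : G) (φ : G →* G) :
    conjComp x (conjComp y φ) = conjComp (x * y) φ := by
  ext g
  simp only [conjComp, MonoidHom.comp_apply, MulEquiv.coe_toMonoidHom, MulAut.conj_apply]
  group

/-- Up to conjugation, `φ` is of type (2a) or (2b) with vanishing last parameter. -/
def Standard (n : ℕ) (φ : ArtinB n →* ArtinB n) : Prop :=
  ∃ x, (∃ ε p, IsType2a n ε p 0 (conjComp x φ)) ∨ (∃ ε p, IsType2b n ε p 0 (conjComp x φ))

theorem standard_of_conjComp {n : ℕ} {φ : ArtinB n →* ArtinB n} {x : ArtinB n}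
    (h : Standard n (conjComp x φ)) : Standard n φ := by
  obtain ⟨y, h⟩ := h
  rw [conjComp_conjComp] at h
  exact ⟨_, h⟩

theorem neg_eq_one_or {ε : ℤ} (h : ε = 1 ∨ ε = -1) : -ε = 1 ∨ -ε = -1 := by omega

theorem standard_of_iB {m : ℕ} {φ : ArtinB (m + 2) →* ArtinB (m + 2)}
    (h : Standard (m + 2) ((iB (m + 2)).comp φ)) : Standard (m + 2) φ := by
  obtain ⟨x, h⟩ := h
  have e : ∀ g, conjComp (iB (m + 2) x) φ g = iB (m + 2) (conjComp x ((iB (m + 2)).comp φ) g) := by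
    intro g
    simp only [conjComp, MonoidHom.comp_apply, MulEquiv.coe_toMonoidHom, MulAut.conj_apply,
      map_mul, map_inv, iB_iB]
  refine ⟨iB (m + 2) x, ?_⟩
  rcases h with ⟨ε, p, h1, h2, h3⟩ | ⟨ε, p, h1, h2, h3⟩
  · refine Or.inl ⟨-ε, p, neg_eq_one_or h1, fun i hi => ?_, ?_⟩
    · rw [e, h2 i hi, map_mul, map_zpow, map_zpow, iB_tB hi, iB_Delta, inv_zpow']
    · rw [e, h3, map_mul, map_zpow, iB_rho, zpow_zero, zpow_zero]
  · refine Or.inr ⟨-ε, p, neg_eq_one_or h1, fun i hi => ?_, ?_⟩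
    · have ht : iB (m + 2) (tB (m + 2) (m + 2 - i)) = (tB (m + 2) (m + 2 - i))⁻¹ := by
        rcases i with _ | i
        · rw [Nat.sub_zero, tB_self, iB_tB (by omega)]
        · exact iB_tB (by omega)
      rw [e, h2 i hi, map_mul, map_zpow, map_zpow, ht, iB_Delta, inv_zpow']
    · rw [e, h3, map_mul, map_zpow, map_inv, iB_rho, zpow_zero, zpow_zero]

theorem standard_of_nB {m : ℕ} {φ : ArtinB (m + 2) →* ArtinB (m + 2)} {x : ArtinB (m + 2)}
    {ε p : ℤ} (h : IsType2a (m + 2) ε p 0 (conjComp x ((nB (m + 2)).comp φ))) :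
    Standard (m + 2) φ := by
  obtain ⟨h1, h2, h3⟩ := h
  have e : ∀ g, conjComp (nB (m + 2) x) φ g = nB (m + 2) (conjComp x ((nB (m + 2)).comp φ) g) := by
    intro g
    simp only [conjComp, MonoidHom.comp_apply, MulEquiv.coe_toMonoidHom, MulAut.conj_apply,
      map_mul, map_inv, nB_nB]
  refine ⟨nB (m + 2) x, Or.inr ⟨-ε, -p, neg_eq_one_or h1, fun i hi => ?_, ?_⟩⟩
  · rw [e, h2 i hi, map_mul, map_zpow, map_zpow, nB_tB hi, nB_Delta (by omega), inv_zpow',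
      inv_zpow']
  · rw [e, h3, map_mul, map_zpow, nB_rho (by omega), zpow_zero, zpow_zero]

theorem conjComp_surjective {G : Type*} [Group G] {x : G} {φ : G →* G} :
    Function.Surjective (conjComp x φ) ↔ Function.Surjective φ := by
  unfold conjComp
  rw [MonoidHom.coe_comp]
  exact Function.Surjective.of_comp_iff' (MulAut.conj x).bijective φ

theorem exists_type2a {m : ℕ} {ψ : ArtinB (m + 3) →* ArtinB (m + 3)}
    (hs : Function.Surjective ψ) {u : ℕ → FreeGroup ℕ} {π : ℕ → ℕ} {d : ℤ}
    (hu : ∀ i, i < m + 3 → kap (m + 3) (u i) = u i ∧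
      ψ (X (m + 3) i) = Xh (m + 3) (u i) * ΔB (m + 3) ^ d ∧ IsConj (u i) (of (π i)))
    (hD : IsConj (FreeGroup.lift u (D (m + 3))) (D (m + 3))) :
    ∃ x p, IsType2a (m + 3) 1 p 0 (conjComp x ψ) := by
  obtain ⟨g, hg⟩ := exists_conjComp_X (by omega) hu hD
  obtain ⟨p, hp⟩ := isType2a_of_map_X (conjComp_surjective.2 hs) hg
  exact ⟨g, p, hp⟩

/-- The endomorphism of the free group induced by `nB`. -/
def nF (n : ℕ) : FreeGroup ℕ →* FreeGroup ℕ :=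
  FreeGroup.lift fun i => if i < n then (D n)⁻¹ * (of (n - 1 - i))⁻¹ * D n else 1

theorem nF_of {n i : ℕ} (hi : i < n) : nF n (of i) = (D n)⁻¹ * (of (n - 1 - i))⁻¹ * D n := by
  simp [nF, hi]

theorem Xh_nF {n : ℕ} (f : FreeGroup ℕ) : Xh n (nF n f) = nB n (Xh n f) := by
  have : (Xh n).comp (nF n) = (nB n).comp (Xh n) := by
    apply FreeGroup.ext_hom
    intro i
    rw [MonoidHom.comp_apply, MonoidHom.comp_apply, Xh_of]
    rcases lt_or_ge i n with hi | hi
    · rw [nF_of hi, nB_X i hi]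
    · rw [X_of_le hi, map_one]
      simp [nF, not_lt.2 hi]
  exact DFunLike.congr_fun this f

theorem kap_nF {n : ℕ} (f : FreeGroup ℕ) : kap n (nF n f) = nF n f := by
  have : (kap n).comp (nF n) = nF n := by
    apply FreeGroup.ext_hom
    intro i
    rw [MonoidHom.comp_apply]
    rcases lt_or_ge i n with hi | hi
    · simp only [nF_of hi, map_mul, map_inv, kap_D le_rfl, kap_of_lt (show n - 1 - i < n by omega)]
    · simp [nF, not_lt.2 hi]
  exact DFunLike.congr_fun this f

theorem nF_D {n : ℕ} (hn : 0 < n) : nF n (D n) = (D n)⁻¹ := by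
  rw [← kap_nF, kap_eq_of_Xh_eq (g := (D n)⁻¹) (by rw [Xh_nF, nB_Xh_D hn, map_inv]), map_inv,
    kap_D le_rfl]

theorem standard_of_poleData {m : ℕ} (hn : 5 ≤ m + 3) {φ : ArtinB (m + 3) →* ArtinB (m + 3)}
    (hφ : ∀ g, prm (m + 3) (φ g) = prm (m + 3) g) (hs : Function.Surjective φ) {ε b d : ℤ}
    (hε : ε = 1 ∨ ε = -1) (hP : PoleData φ (b + ε) b d d) : Standard (m + 3) φ := by
  obtain ⟨u, hu, hD⟩ := exists_isConj_zpow hn hφ hs hε hP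
  rcases hε with rfl | rfl
  · simp only [zpow_one] at hu hD
    obtain ⟨x, p, h⟩ := exists_type2a hs (π := id) hu hD
    exact ⟨x, Or.inl ⟨1, p, h⟩⟩
  · have hs2 : Function.Surjective ((nB (m + 3)).comp φ) := by
      intro g
      obtain ⟨y, hy⟩ := hs (nB (m + 3) g)
      exact ⟨y, by rw [MonoidHom.comp_apply, hy, nB_nB]⟩
    have hl : ∀ f, FreeGroup.lift (fun i => nF (m + 3) (u i)) f =
        nF (m + 3) (FreeGroup.lift u f) := by
      have : FreeGroup.lift (fun i => nF (m + 3) (u i)) = (nF (m + 3)).comp (FreeGroup.lift u) := by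
        apply FreeGroup.ext_hom
        intro i
        simp
      exact fun f => DFunLike.congr_fun this f
    obtain ⟨x, p, h⟩ := exists_type2a hs2 (u := fun i => nF (m + 3) (u i))
      (π := fun i => m + 3 - 1 - i) (d := -d) (fun i hi => by
        obtain ⟨-, h2, h3⟩ := hu i hi
        refine ⟨kap_nF _, ?_, ?_⟩
        · rw [MonoidHom.comp_apply, h2, map_mul, map_zpow, nB_Delta (by omega), Xh_nF, inv_zpow']
        · refine ((nF (m + 3)).map_isConj h3).trans (isConj_iff.2 ⟨D (m + 3), ?_⟩)
          rw [zpow_neg_one, map_inv, nF_of hi]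
          group) (by
      rw [hl]
      have := (nF (m + 3)).map_isConj hD
      rwa [zpow_neg_one, map_inv, nF_D (by omega), inv_inv] at this)
    exact standard_of_nB h

theorem standard_of_surjective {n : ℕ} (hn : 5 ≤ n) {φ : ArtinB n →* ArtinB n}
    (hs : Function.Surjective φ) : Standard n φ := by
  obtain ⟨x, hx⟩ := exists_conjComp_prm hn hs
  apply standard_of_conjComp (x := x)
  have hs' := conjComp_surjective (x := x).2 hs
  obtain ⟨m, rfl⟩ : ∃ m, n = m + 3 := ⟨n - 3, by omega⟩
  obtain ⟨ε, b, d, hε, h | h⟩ := exists_poleData_unit hn hx hs'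
  · exact standard_of_poleData hn hx hs' hε h
  · apply standard_of_iB
    refine standard_of_poleData hn (fun g => ?_) ?_ hε h
    · rw [MonoidHom.comp_apply, prm_iB, hx]
    · intro g
      obtain ⟨y, hy⟩ := hs' (iB (m + 3) g)
      exact ⟨y, by rw [MonoidHom.comp_apply, hy, iB_iB]⟩

theorem eq_top_of_tB_mem {m : ℕ} {K : Subgroup (ArtinB (m + 2))}
    (ht : ∀ i, 0 < i → i < m + 2 → tB (m + 2) i ∈ K) (hρ : ρB (m + 2) ∈ K) : K = ⊤ := by
  have hsB : ∀ i, i + 1 < m + 2 → sB (m + 2) i ∈ K := fun i hi => by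
    rw [← tB_succ hi]
    exact ht _ (by omega) hi
  have hpr : ∀ k, k ≤ m + 1 → pr (m + 2) k ∈ K := by
    intro k hk
    induction k with
    | zero => rw [pr_zero]; exact one_mem _
    | succ k ih => rw [pr_succ]; exact mul_mem (ih (by omega)) (hsB k (by omega))
  rw [eq_top_iff]
  refine fun g _ => ArtinB.closure_eq_top (fun i hi => ?_) g
  rcases Nat.lt_or_ge (i + 1) (m + 2) with h | h
  · exact hsB i h
  · rw [show i = m + 1 by omega]
    rw [rhoB_eq, pr_succ] at hρ
    exact (Subgroup.mul_mem_cancel_left _ (hpr _ le_rfl)).1 hρ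

theorem surjective_of_standard {m : ℕ} {φ : ArtinB (m + 2) →* ArtinB (m + 2)}
    (h : Standard (m + 2) φ) : Function.Surjective φ := by
  obtain ⟨x, h⟩ := h
  rw [← conjComp_surjective (x := x), ← MonoidHom.range_eq_top]
  set ψ := conjComp x φ
  have key : ρB (m + 2) ∈ ψ.range → (∀ i, 0 < i → i < m + 2 →
      ∃ ε p : ℤ, (ε = 1 ∨ ε = -1) ∧ tB (m + 2) i ^ ε * ΔB (m + 2) ^ p ∈ ψ.range) →
      ψ.range = ⊤ := by
    intro hρ ht
    refine eq_top_of_tB_mem (fun i h0 hi => ?_) hρ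
    obtain ⟨ε, p, hε, h⟩ := ht i h0 hi
    have h2 := (Subgroup.mul_mem_cancel_right _ (zpow_mem (pow_mem hρ (m + 2)) p)).1 h
    rcases hε with rfl | rfl
    · simpa using h2
    · simpa using h2
  rcases h with ⟨ε, p, h1, h2, h3⟩ | ⟨ε, p, h1, h2, h3⟩
  · exact key ⟨_, h3.trans (by simp)⟩ fun i _ hi => ⟨ε, p, h1, _, h2 i hi⟩
  · refine key ?_ fun i h0 hi => ⟨ε, p, h1, tB (m + 2) (m + 2 - i), ?_⟩
    · rw [← inv_mem_iff]
      exact ⟨_, h3.trans (by simp)⟩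
    · rw [h2 _ (by omega), show m + 2 - (m + 2 - i) = i by omega]

end Braid

/-- an endomorphism of `A[Bₙ]`, `n ≥ 5`, is surjective iff it is conjugate
to an endomorphism of type (2a) or (2b) with `q = 0`. -/
theorem endomorphism_surjective_iff (n : ℕ) (hn : 5 ≤ n) (φ : ArtinB n →* ArtinB n) :
    Function.Surjective φ ↔
      ∃ x : ArtinB n,
        (∃ ε p : ℤ, IsType2a n ε p 0 (conjComp x φ)) ∨
        (∃ ε p : ℤ, IsType2b n ε p 0 (conjComp x φ)) := by
  obtain ⟨m, rfl⟩ : ∃ m, n = m + 2 := ⟨n - 2, by omega⟩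
  exact ⟨Braid.standard_of_surjective hn, Braid.surjective_of_standard⟩
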